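/- Let K be a quadratic field and let c ∈ K be such that the map f_c(z) = z² + c has both a point of exact period 3 and a point of exact period 2 in K (as holds in particular when the preperiodic graph G(f_c, K) has a subgraph of type 10(3,2)). Then there is a rational number x ∉ {0, −1} such that c = −(x⁶ + 2x⁵ + 4x⁴ + 8x³ + 9x² + 4x + 1) / (4x²(x+1)²) and K = ℚ(√(x⁶ + 2x⁵ + x⁴ + 2x³ + 6x² + 4x + 1)). In particular, c ∈ ℚ and K is a real quadratic field, i.e., K ⊆ ℝ. -/

import Mathlib

open Polynomial NumberField



/-- hypotheses on the sextic field -/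
structure Sextic (L : Type) [Field L] [NumberField L] (θ : L) : Prop where
  fin : Module.finrank ℚ L = 6
  root : θ ^ 6 + 2 * θ ^ 5 + θ ^ 4 + 2 * θ ^ 3 + 6 * θ ^ 2 + 4 * θ + 1 = 0
  indep : ∀ a0 a1 a2 a3 a4 a5 : ℚ, (a0 : L) + a1 * θ + a2 * θ ^ 2 + a3 * θ ^ 3 + a4 * θ ^ 4
    + a5 * θ ^ 5 = 0 → a0 = 0 ∧ a1 = 0 ∧ a2 = 0 ∧ a3 = 0 ∧ a4 = 0 ∧ a5 = 0

noncomputable section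

namespace Sextic

variable {L : Type} [Field L] [NumberField L] {θ : L}

/-- the square root of -1 -/
def im (θ : L) : L := -(θ ^ 3 + θ ^ 2 - 2 * θ - 1) / (2 * (θ ^ 2 + θ))

theorem th_ne (h : Sextic L θ) : θ ≠ 0 := by
  intro h0
  have := h.root
  simp [h0] at this

theorem th1_ne (h : Sextic L θ) : θ + 1 ≠ 0 := by
  intro h0
  have := h.root
  have h1 : θ = -1 := by linear_combination h0
  rw [h1] at this
  norm_num at this

theorem im_mul (h : Sextic L θ) : 2 * (θ ^ 2 + θ) * im θ = -(θ ^ 3 + θ ^ 2 - 2 * θ - 1) := by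
  have h1 := h.th_ne
  have h2 := h.th1_ne
  have h3 : θ ^ 2 + θ ≠ 0 := by
    have : θ ^ 2 + θ = θ * (θ + 1) := by ring
    rw [this]; exact mul_ne_zero h1 h2
  unfold im
  field_simp

theorem im_sq (h : Sextic L θ) : im θ ^ 2 = -1 := by
  have h1 := h.th_ne
  have h2 := h.th1_ne
  have h3 : θ ^ 2 + θ ≠ 0 := by
    have : θ ^ 2 + θ = θ * (θ + 1) := by ring
    rw [this]; exact mul_ne_zero h1 h2
  have h4 : (2 * (θ ^ 2 + θ)) ^ 2 * (im θ ^ 2 + 1) = 0 := by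
    linear_combination (2 * (θ ^ 2 + θ) * im θ -(θ ^ 3 + θ ^ 2 - 2 * θ - 1)) * h.im_mul + h.root
  have h5 : (2 * (θ ^ 2 + θ)) ^ 2 ≠ 0 := pow_ne_zero _ (mul_ne_zero two_ne_zero h3)
  have := (mul_eq_zero.1 h4).resolve_left h5
  linear_combination this

theorem cub (h : Sextic L θ) : θ ^ 3 = 1 + 2 * θ - θ ^ 2 - 2 * im θ * θ - 2 * im θ * θ ^ 2 := by
  linear_combination h.im_mul

/-- the basis vectors -/
def bv (θ : L) : Fin 6 → L := ![1, θ, θ ^ 2, im θ, im θ * θ, im θ * θ ^ 2]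

theorem bv_indep (h : Sextic L θ) : LinearIndependent ℚ (bv θ) := by
  rw [Fintype.linearIndependent_iff]
  intro g hg
  simp only [Fin.sum_univ_succ, bv] at hg
  simp [Algebra.smul_def] at hg
  have hi := h.im_mul
  have key := h.indep (g 3) (2 * g 0 + 2 * g 3 + g 4) (2 * g 0 + 2 * g 1 - g 3 + 2 * g 4 + g 5)
    (2 * g 1 + 2 * g 2 - g 3 - g 4 + 2 * g 5) (2 * g 2 - g 4 - g 5) (- g 5) (by
      push_cast
      linear_combination (2 * (θ ^ 2 + θ)) * hg - (g 3 + g 4 * θ + g 5 * θ ^ 2) * hi)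
  obtain ⟨k0, k1, k2, k3, k4, k5⟩ := key
  intro i
  fin_cases i <;> simp <;> linarith

/-- the basis -/
def bas (h : Sextic L θ) : Module.Basis (Fin 6) ℚ L :=
  haveI := h.fin
  basisOfLinearIndependentOfCardEqFinrank h.bv_indep (by simp [h.fin])

theorem bas_coe (h : Sextic L θ) : ⇑h.bas = bv θ := by
  simp [bas]

def Mt : Matrix (Fin 6) (Fin 6) ℚ := !![
  0,0,1,0,0,0;
  1,0,2,0,0,2;
  0,1,-1,0,0,2;
  0,0,0,0,0,1;
  0,0,-2,1,0,2;
  0,0,-2,0,1,-1]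

def Mi : Matrix (Fin 6) (Fin 6) ℚ := !![
  0,0,0,-1,0,0;
  0,0,0,0,-1,0;
  0,0,0,0,0,-1;
  1,0,0,0,0,0;
  0,1,0,0,0,0;
  0,0,1,0,0,0]

theorem lmul_of (h : Sextic L θ) (x : L) (M : Matrix (Fin 6) (Fin 6) ℚ)
    (hM : ∀ j, x * bv θ j = ∑ k, M k j • bv θ k) : Algebra.leftMulMatrix h.bas x = M := by
  ext i j
  rw [Algebra.leftMulMatrix_eq_repr_mul, h.bas_coe, hM, ← h.bas_coe]
  simp [Finsupp.single_apply]

theorem lmul_th (h : Sextic L θ) : Algebra.leftMulMatrix h.bas θ = Mt := by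
  apply h.lmul_of
  have h1 := h.cub
  have h2 := h.im_sq
  intro j
  simp only [Fin.sum_univ_succ, Algebra.smul_def]
  fin_cases j <;> simp [bv, Mt] 
  · ring
  · linear_combination h1
  · ring
  · ring
  · linear_combination (im θ) * h1 - (2 * θ + 2 * θ ^ 2) * h2

theorem lmul_im (h : Sextic L θ) : Algebra.leftMulMatrix h.bas (im θ) = Mi := by
  apply h.lmul_of
  have h2 := h.im_sq
  intro j
  simp only [Fin.sum_univ_succ, Algebra.smul_def]
  fin_cases j <;> simp [bv, Mi]
  · linear_combination h2
  · linear_combination θ * h2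
  · linear_combination θ ^ 2 * h2

end Sextic
end


namespace Sextic
variable {L : Type} [Field L] [NumberField L] {θ : L}

def Bm : Fin 6 → Matrix (Fin 6) (Fin 6) ℚ := ![1, Mt, Mt * Mt, Mi, Mi * Mt, Mi * (Mt * Mt)]

def Tm : Matrix (Fin 6) (Fin 6) ℚ := !![
  6, -2, 2, 0, 4, 0;
  -2, 2, -8, 4, 0, 8;
  2, -8, -6, 0, 8, -16;
  0, 4, 0, -6, 2, -2;
  4, 0, 8, 2, -2, 8;
  0, 8, -16, -2, 8, 6]

theorem lmul_bv (h : Sextic L θ) (j : Fin 6) : Algebra.leftMulMatrix h.bas (bv θ j) = Bm j := by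
  fin_cases j <;> simp [bv, Bm, map_mul, h.lmul_th, h.lmul_im, pow_two]

theorem tm_eq : ∀ i j : Fin 6, (Bm i * Bm j).trace = Tm i j := by
  intro i j
  unfold Bm Tm Mt Mi
  revert i j
  exact fun i j => by fin_cases i <;> fin_cases j <;> exact of_decide_eq_true (by decide +kernel)

theorem tm_det : Tm.det = -10816 := by
  simp [Tm, Matrix.det_succ_row_zero, Fin.sum_univ_succ, Fin.succAbove]
  norm_num

theorem discr_bv (h : Sextic L θ) : Algebra.discr ℚ (bv θ) = -10816 := by
  rw [Algebra.discr_def, ← tm_det]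
  congr 1
  ext i j
  rw [Algebra.traceMatrix_apply, Algebra.traceForm_apply, Algebra.trace_eq_matrix_trace h.bas,
    map_mul, h.lmul_bv, h.lmul_bv, tm_eq]

theorem th_int (h : Sextic L θ) : IsIntegral ℤ θ := by
  refine ⟨X ^ 6 + 2 * X ^ 5 + X ^ 4 + 2 * X ^ 3 + 6 * X ^ 2 + 4 * X + 1, by monicity!, ?_⟩
  have := h.root
  simpa [eval₂_add, eval₂_mul] using this

theorem im_int (h : Sextic L θ) : IsIntegral ℤ (im θ) := by
  refine ⟨X ^ 2 + 1, by monicity!, ?_⟩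
  simp [h.im_sq]

theorem bv_int (h : Sextic L θ) (j : Fin 6) : IsIntegral ℤ (bv θ j) := by
  have h1 := h.th_int
  have h2 := h.im_int
  fin_cases j <;> simp [bv]
  · exact isIntegral_one
  · exact h1
  · exact h1
  · exact h2
  · exact h2.mul h1
  · exact h2.mul (h1.pow 2)

theorem discr_le (h : Sextic L θ) : |discr L| ≤ 10816 := by
  have e : Module.Free.ChooseBasisIndex ℤ (𝓞 L) ≃ Fin 6 := 
    (Fintype.equivFinOfCardEq (by rw [← Module.finrank_eq_card_chooseBasisIndex, RingOfIntegers.rank, h.fin]))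
  let ib : Module.Basis (Fin 6) ℚ L := (integralBasis L).reindex e
  have hint : ∀ i j, IsIntegral ℤ (ib.toMatrix (bv θ) i j) := by
    intro i j
    let x : 𝓞 L := ⟨bv θ j, h.bv_int j⟩
    have : bv θ j = algebraMap (𝓞 L) L x := rfl
    simp only [ib, Module.Basis.toMatrix_apply, Module.Basis.repr_reindex, Finsupp.mapDomain_equiv_apply]
    rw [this, integralBasis_repr_apply]
    exact isIntegral_algebraMap
  have hd : Algebra.discr ℚ (bv θ) = (ib.toMatrix (bv θ)).det ^ 2 * Algebra.discr ℚ ib := by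
    rw [← Algebra.discr_of_matrix_vecMul, Module.Basis.toMatrix_map_vecMul]
  have hd2 : Algebra.discr ℚ ib = discr L := by
    rw [coe_discr, ← Algebra.discr_reindex ℚ (integralBasis L) e]
    simp [ib, Module.Basis.coe_reindex]
  have hdet : IsIntegral ℤ (ib.toMatrix (bv θ)).det := IsIntegral.det hint
  obtain ⟨n, hn⟩ := IsIntegrallyClosed.isIntegral_iff.1 hdet
  rw [h.discr_bv, hd2, ← hn] at hd
  have hd3 : -10816 = n ^ 2 * discr L := by
    simp at hd
    exact_mod_cast hd
  have hn0 : n ≠ 0 := by rintro rfl; norm_num at hd3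
  have : |(-10816 : ℤ)| = n ^ 2 * |discr L| := by rw [hd3, abs_mul, abs_of_nonneg (sq_nonneg n)]
  have h1 : 1 ≤ n ^ 2 := by have := sq_nonneg n; have : n ^ 2 ≠ 0 := pow_ne_zero _ hn0; omega
  norm_num at this
  nlinarith [abs_nonneg (discr L)]

end Sextic


namespace Sextic
variable {L : Type} [Field L] [NumberField L] {θ : L}

theorem totC (h : Sextic L θ) : IsTotallyComplex L := by
  refine ⟨fun v => ?_⟩
  rw [← InfinitePlace.not_isReal_iff_isComplex]
  intro hv
  obtain ⟨φ, hφ, rfl⟩ := InfinitePlace.isReal_iff.1 hv |> fun hr => (⟨_, hr, rfl⟩ : ∃ φ : L →+* ℂ, ComplexEmbedding.IsReal φ ∧ φ = InfinitePlace.embedding v)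
  have h1 : hφ.embedding (im θ) ^ 2 = -1 := by
    rw [← map_pow, h.im_sq]; simp
  nlinarith [sq_nonneg (hφ.embedding (im θ))]

theorem nrC (h : Sextic L θ) : InfinitePlace.nrComplexPlaces L = 3 := by
  haveI := h.totC
  have := IsTotallyComplex.finrank L
  rw [h.fin] at this
  omega

theorem rank2 (h : Sextic L θ) : Units.rank L = 2 := by
  haveI := h.totC
  have h1 := InfinitePlace.card_eq_nrRealPlaces_add_nrComplexPlaces L
  have h2 := IsTotallyComplex.nrRealPlaces_eq_zero L
  have h3 := h.nrC
  rw [Units.rank]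
  omega

/-- theta as an algebraic integer -/
def thO (h : Sextic L θ) : 𝓞 L := ⟨θ, h.th_int⟩
/-- i as an algebraic integer -/
noncomputable def imO (h : Sextic L θ) : 𝓞 L := ⟨im θ, h.im_int⟩

theorem thO_coe (h : Sextic L θ) : (h.thO : L) = θ := rfl
theorem imO_coe (h : Sextic L θ) : (h.imO : L) = im θ := rfl

theorem rootO (h : Sextic L θ) : h.thO ^ 6 + 2 * h.thO ^ 5 + h.thO ^ 4 + 2 * h.thO ^ 3 + 6 * h.thO ^ 2 + 4 * h.thO + 1 = 0 := by
  apply RingOfIntegers.coe_injective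
  simpa [thO_coe, map_ofNat] using h.root

theorem imO_sq (h : Sextic L θ) : h.imO ^ 2 = -1 := by
  apply RingOfIntegers.coe_injective
  simpa [imO_coe] using h.im_sq

theorem cubO (h : Sextic L θ) : h.thO ^ 3 = 1 + 2 * h.thO - h.thO ^ 2 - 2 * h.imO * h.thO - 2 * h.imO * h.thO ^ 2 := by
  apply RingOfIntegers.coe_injective
  simpa [imO_coe, thO_coe, map_ofNat] using h.cub

theorem no_small {k : Type*} [Field k] (t : k) (ht : t ^ 6 + 2 * t ^ 5 + t ^ 4 + 2 * t ^ 3 + 6 * t ^ 2 + 4 * t + 1 = 0)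
    : Nat.card k ≠ 2 ∧ Nat.card k ≠ 3 := by
  constructor
  · intro hk
    haveI : Finite k := Nat.finite_of_card_ne_zero (by omega)
    haveI := Fintype.ofFinite k
    have h1 : t ^ 2 = t := by
      have := FiniteField.pow_card t
      rwa [Fintype.card_eq_nat_card, hk] at this
    have h2 : (2 : k) = 0 := by
      have := FiniteField.cast_card_eq_zero k
      rw [Fintype.card_eq_nat_card, hk] at this
      exact_mod_cast this
    have : (1 : k) = 0 := by grind
    exact one_ne_zero this
  · intro hk
    haveI : Finite k := Nat.finite_of_card_ne_zero (by omega)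
    haveI := Fintype.ofFinite k
    have h1 : t ^ 3 = t := by
      have := FiniteField.pow_card t
      rwa [Fintype.card_eq_nat_card, hk] at this
    have h2 : (3 : k) = 0 := by
      have := FiniteField.cast_card_eq_zero k
      rw [Fintype.card_eq_nat_card, hk] at this
      exact_mod_cast this
    have : (1 : k) = 0 := by grind
    exact one_ne_zero this

theorem pid (h : Sextic L θ) : IsPrincipalIdealRing (𝓞 L) := by
  apply RingOfIntegers.isPrincipalIdealRing_of_isPrincipal_of_norm_le_of_isPrime
  intro I hI hn
  exfalso
  rw [h.nrC, h.fin] at hn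
  have hlt : (Ideal.absNorm (I : Ideal (𝓞 L)) : ℝ) < 4 := by
    refine lt_of_le_of_lt hn ?_
    have h1 : √|(discr L : ℝ)| ≤ 104 := by
      rw [Real.sqrt_le_left (by norm_num)]
      have := h.discr_le
      have h2 : ((|discr L| : ℤ) : ℝ) ≤ 10816 := by exact_mod_cast this
      push_cast at h2
      linarith
    have hpi := Real.pi_gt_three
    have h3 : (4 / Real.pi) ^ 3 < (4 / 3) ^ 3 := by
      gcongr
    have h4 : (0:ℝ) < (4 / Real.pi) ^ 3 := by positivity
    have h5 : (Nat.factorial 6 : ℝ) = 720 := by norm_num [Nat.factorial]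
    rw [h5]
    push_cast
    have h6 := Real.sqrt_nonneg |(discr L : ℝ)|
    calc _ ≤ (4 / Real.pi) ^ 3 * (720 / 6 ^ 6 * 104) := by gcongr
      _ < (4 / 3) ^ 3 * (720 / 6 ^ 6 * 104) := by gcongr
      _ < 4 := by norm_num
  have hlt' : Ideal.absNorm (I : Ideal (𝓞 L)) < 4 := by exact_mod_cast hlt
  have hne : (I : Ideal (𝓞 L)) ≠ ⊥ := nonZeroDivisors.coe_ne_zero I
  have hmax : (I : Ideal (𝓞 L)).IsMaximal := hI.isMaximal hne
  letI := Ideal.Quotient.field (I : Ideal (𝓞 L))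
  have h0 := Ideal.absNorm_apply (I : Ideal (𝓞 L))
  have hc : Ideal.absNorm (I : Ideal (𝓞 L)) = Nat.card (𝓞 L ⧸ (I : Ideal (𝓞 L))) := rfl
  have hn0 : Ideal.absNorm (I : Ideal (𝓞 L)) ≠ 0 := Ideal.absNorm_ne_zero_of_nonZeroDivisors I
  have hn1 : Ideal.absNorm (I : Ideal (𝓞 L)) ≠ 1 := by
    rw [Ne, Ideal.absNorm_eq_one_iff]; exact hI.ne_top
  have := no_small (Ideal.Quotient.mk (I : Ideal (𝓞 L)) h.thO) (by
    have := congrArg (Ideal.Quotient.mk (I : Ideal (𝓞 L))) h.rootO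
    simpa [map_ofNat] using this)
  rw [← hc] at this
  omega

end Sextic


section ringA
variable {A : Type*} [CommRing A] {t ε : A}

theorem int_cast_two (h2 : (2 : A) = 0) (c : ℤ) : (Even c ∧ (c : A) = 0) ∨ (Odd c ∧ (c : A) = 1) := by
  rcases Int.even_or_odd' c with ⟨k, rfl | rfl⟩
  · left; refine ⟨by simp, ?_⟩; push_cast; rw [h2, zero_mul]
  · right; refine ⟨by simp, ?_⟩; push_cast; rw [h2, zero_mul, zero_add]

theorem BL2 (h2 : (2 : A) = 0) (ht : t ^ 3 = t ^ 2 + 1) (c0 c1 c2 : ℤ) :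
    (Even c0 ∧ Even c1 ∧ Even c2 ∧ (c0 + c1 * t + c2 * t ^ 2 : A) = 0) ∨ ∃ d0 d1 d2 : ℤ,
      (c0 + c1 * t + c2 * t ^ 2 : A) * (d0 + d1 * t + d2 * t ^ 2) = 1 := by
  rcases int_cast_two h2 c0 with ⟨e0, h0⟩ | ⟨e0, h0⟩ <;>
  rcases int_cast_two h2 c1 with ⟨e1, h1⟩ | ⟨e1, h1⟩ <;>
  rcases int_cast_two h2 c2 with ⟨e2, h3⟩ | ⟨e2, h3⟩ <;> rw [h0, h1, h3]
  · left; exact ⟨e0, e1, e2, by ring⟩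
  · right; refine ⟨1, 1, 0, ?_⟩; push_cast; linear_combination ht + (t ^ 2) * h2
  · right; refine ⟨0, -1, 1, ?_⟩; push_cast; linear_combination ht
  · right; refine ⟨0, 1, 0, ?_⟩; push_cast; linear_combination ht + (t ^ 2) * h2
  · right; refine ⟨1, 0, 0, ?_⟩; push_cast; ring
  · right; refine ⟨1, 1, 1, ?_⟩; push_cast; linear_combination (t + 2) * ht + (1 + t + 2 * t ^ 2) * h2
  · right; refine ⟨0, 0, 1, ?_⟩; push_cast; linear_combination ht + (t ^ 2) * h2
  · right; refine ⟨1, 0, 1, ?_⟩; push_cast; linear_combination (t + 2) * ht + (1 + t + 2 * t ^ 2) * h2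

theorem BL [Nontrivial A] (h2 : (2 : A) = 0) (ht : t ^ 3 = t ^ 2 + 1) (c0 c1 c2 : ℤ)
    (h : (c0 + c1 * t + c2 * t ^ 2 : A) = 0) : Even c0 ∧ Even c1 ∧ Even c2 := by
  rcases BL2 h2 ht c0 c1 c2 with h' | ⟨d0, d1, d2, h'⟩
  · exact ⟨h'.1, h'.2.1, h'.2.2.1⟩
  · rw [h, zero_mul] at h'; exact absurd h' zero_ne_one

/-- the image of `ℤ[X]` -/
noncomputable def TT (t : A) : Subalgebra ℤ A := (aeval t : ℤ[X] →ₐ[ℤ] A).range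

theorem mem_TT (t : A) (c0 c1 c2 : ℤ) : (c0 + c1 * t + c2 * t ^ 2 : A) ∈ TT t :=
  ⟨C c0 + C c1 * X + C c2 * X ^ 2, by simp⟩

theorem TT_form (h2 : (2 : A) = 0) (ht : t ^ 3 = t ^ 2 + 1) {x : A} (hx : x ∈ TT t) :
    ∃ c0 c1 c2 : ℤ, x = c0 + c1 * t + c2 * t ^ 2 := by
  obtain ⟨p, rfl⟩ := hx
  have hm : (X ^ 3 + X ^ 2 + 1 : ℤ[X]).Monic := by monicity!
  have hdeg : (X ^ 3 + X ^ 2 + 1 : ℤ[X]).natDegree = 3 := by compute_degree!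
  have h1 := modByMonic_add_div p (X ^ 3 + X ^ 2 + 1 : ℤ[X])
  have h3 : natDegree (p %ₘ (X ^ 3 + X ^ 2 + 1 : ℤ[X])) < 3 := by
    have := natDegree_modByMonic_lt p hm (by intro h; rw [h] at hdeg; simp at hdeg)
    omega
  have h4 := as_sum_range_C_mul_X_pow' (p := p %ₘ (X ^ 3 + X ^ 2 + 1 : ℤ[X])) (n := 3) h3
  set r := p %ₘ (X ^ 3 + X ^ 2 + 1 : ℤ[X])
  refine ⟨r.coeff 0, r.coeff 1, r.coeff 2, ?_⟩
  have h5 : aeval t (X ^ 3 + X ^ 2 + 1 : ℤ[X]) = 0 := by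
    simp; linear_combination ht + (t ^ 2 + 1) * h2
  have h6 := congrArg (aeval t) h1
  rw [map_add, map_mul, h5, zero_mul, add_zero] at h6
  have h7 := congrArg (aeval t) h4
  refine (h6.symm.trans h7).trans ?_
  simp [Finset.sum_range_succ]

theorem TT_unit (h2 : (2 : A) = 0) (ht : t ^ 3 = t ^ 2 + 1) {x : A} (hx : x ∈ TT t) :
    x = 0 ∨ ∃ y ∈ TT t, x * y = 1 := by
  obtain ⟨c0, c1, c2, rfl⟩ := TT_form h2 ht hx
  rcases BL2 h2 ht c0 c1 c2 with h' | ⟨d0, d1, d2, h'⟩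
  · left; exact h'.2.2.2
  · right; exact ⟨_, mem_TT t d0 d1 d2, h'⟩

theorem TT_disj (h2 : (2 : A) = 0) (ht : t ^ 3 = t ^ 2 + 1) (he : ε ^ 2 = 0) (he0 : ε ≠ 0)
    {x y : A} (hx : x ∈ TT t) (hy : y ∈ TT t) (h : x + ε * y = 0) : x = 0 ∧ y = 0 := by
  have hx0 : x = 0 := by
    rcases TT_unit h2 ht hx with h' | ⟨z, _, hz⟩
    · exact h'
    · exact absurd (by linear_combination (-ε) * hz + ε * z * h - y * z * he) he0
  refine ⟨hx0, ?_⟩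
  rcases TT_unit h2 ht hy with h' | ⟨z, _, hz⟩
  · exact h'
  · exact absurd (by linear_combination (-ε) * hz + z * h - z * hx0) he0

theorem TT_cover (h2 : (2 : A) = 0) (ht : t ^ 3 = t ^ 2 + 1) (he : ε ^ 2 = 0) (he0 : ε ≠ 0)
    (hc : Nat.card A = 64) (z : A) : ∃ x ∈ TT t, ∃ y ∈ TT t, z = x + ε * y := by
  have : Finite A := Nat.finite_of_card_ne_zero (by omega)
  have : Nontrivial A := ⟨ε, 0, he0⟩
  let el : (Fin 2 × Fin 2 × Fin 2) → A := fun v => ((v.1 : ℕ) : ℤ) + (((v.2.1 : ℕ) : ℤ) : A) * t + (((v.2.2 : ℕ) : ℤ) : A) * t ^ 2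
  have el_mem : ∀ v, el v ∈ TT t := fun v => mem_TT t _ _ _
  have el_inj : Function.Injective el := by
    rintro ⟨a, b, c⟩ ⟨a', b', c'⟩ h
    simp only [el] at h
    have := BL h2 ht (((a : ℕ) : ℤ) - ((a' : ℕ) : ℤ)) (((b : ℕ) : ℤ) - ((b' : ℕ) : ℤ)) (((c : ℕ) : ℤ) - ((c' : ℕ) : ℤ)) (by
      push_cast at h ⊢; linear_combination h)
    obtain ⟨⟨k0, h0⟩, ⟨k1, h1⟩, ⟨k2, h3⟩⟩ := this
    have := a.2; have := b.2; have := c.2; have := a'.2; have := b'.2; have := c'.2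
    simp only [Prod.mk.injEq, Fin.ext_iff]
    omega
  let Φ : (Fin 2 × Fin 2 × Fin 2) × (Fin 2 × Fin 2 × Fin 2) → A := fun v => el v.1 + ε * el v.2
  have hΦ : Function.Injective Φ := by
    rintro ⟨v, w⟩ ⟨v', w'⟩ h
    simp only [Φ] at h
    have := TT_disj h2 ht he he0 ((TT t).sub_mem (el_mem v) (el_mem v')) ((TT t).sub_mem (el_mem w) (el_mem w')) (by linear_combination h)
    rw [el_inj (sub_eq_zero.1 this.1), el_inj (sub_eq_zero.1 this.2)]
  have hb := hΦ.bijective_of_nat_card_le (by rw [hc]; simp)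
  obtain ⟨v, hv⟩ := hb.2 z
  exact ⟨_, el_mem v.1, _, el_mem v.2, hv.symm⟩

theorem TT_sq (h2 : (2 : A) = 0) (ht : t ^ 3 = t ^ 2 + 1) (he : ε ^ 2 = 0) (he0 : ε ≠ 0)
    (hc : Nat.card A = 64) (z : A) : z ^ 2 ∈ TT t := by
  obtain ⟨x, hx, y, hy, rfl⟩ := TT_cover h2 ht he he0 hc z
  have : (x + ε * y) ^ 2 = x ^ 2 := by linear_combination y ^ 2 * he + ε * x * y * h2
  rw [this]; exact (TT t).pow_mem hx 2

end ringA


namespace Sextic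
variable {L : Type} [Field L] [NumberField L] {θ : L}

/-- the ideal (2) -/
abbrev I2 (L : Type) [Field L] [NumberField L] : Ideal (𝓞 L) := Ideal.span {(2 : 𝓞 L)}

/-- reduction mod 2 -/
noncomputable abbrev ph (L : Type) [Field L] [NumberField L] : 𝓞 L →+* (𝓞 L ⧸ I2 L) := Ideal.Quotient.mk (I2 L)

theorem A_two : (2 : 𝓞 L ⧸ I2 L) = 0 := by
  have : ph L 2 = 0 := Ideal.Quotient.eq_zero_iff_mem.2 (Ideal.mem_span_singleton_self _)
  rwa [map_ofNat] at this

theorem A_card (h : Sextic L θ) : Nat.card (𝓞 L ⧸ I2 L) = 64 := by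
  rw [← Submodule.cardQuot_apply, ← Ideal.absNorm_apply, Ideal.absNorm_span_singleton]
  have : (2 : 𝓞 L) = algebraMap ℤ (𝓞 L) 2 := by simp
  rw [this, Algebra.norm_algebraMap, RingOfIntegers.rank, h.fin]
  rfl

theorem A_t (h : Sextic L θ) : (ph L h.thO) ^ 3 = (ph L h.thO) ^ 2 + 1 := by
  have := congrArg (ph L) h.cubO
  simp only [map_pow, map_add, map_sub, map_mul, map_one, map_ofNat] at this
  linear_combination this + (ph L h.thO - ph L h.thO ^ 2 - (ph L h.imO) * ph L h.thO - ph L h.imO * ph L h.thO ^ 2) * A_two (L := L)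

theorem A_e (h : Sextic L θ) : (ph L (1 + h.imO)) ^ 2 = 0 := by
  have := congrArg (ph L) h.imO_sq
  simp only [map_pow, map_add, map_one, map_neg] at this ⊢
  linear_combination this + ph L h.imO * A_two (L := L)

theorem A_e0 (h : Sextic L θ) : ph L (1 + h.imO) ≠ 0 := by
  intro h0
  rw [Ideal.Quotient.eq_zero_iff_mem, Ideal.mem_span_singleton] at h0
  obtain ⟨z, hz⟩ := h0
  have h2 : (2 : 𝓞 L) * (1 - z * (1 - h.imO)) = 0 := by
    linear_combination h.imO_sq + (1 - h.imO) * hz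
  have h3 : 1 = z * (1 - h.imO) := by
    rcases mul_eq_zero.1 h2 with h | h
    · exact absurd h two_ne_zero
    · linear_combination h
  have h4 : (1 : 𝓞 L) = 2 * (- z ^ 2 * h.imO) := by
    have : (1 - h.imO) ^ 2 = - 2 * h.imO := by linear_combination h.imO_sq
    linear_combination (1 + z * (1 - h.imO)) * h3 + z ^ 2 * this
  have h5 : I2 L = ⊤ := by
    rw [Ideal.eq_top_iff_one, Ideal.mem_span_singleton]; exact ⟨_, h4⟩
  have h6 := h.A_card
  have : Subsingleton (𝓞 L ⧸ I2 L) := Ideal.Quotient.subsingleton_iff.2 h5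
  rw [Nat.card_eq_one_iff_unique.2 ⟨this, ⟨0⟩⟩] at h6
  omega

/-- units which reduce to polynomials in t -/
noncomputable def SS (h : Sextic L θ) : Subgroup (𝓞 L)ˣ where
  carrier := {u | ph L u ∈ TT (ph L h.thO)}
  mul_mem' := by
    intro a b ha hb
    simp only [Set.mem_ofPred_eq, Units.val_mul, map_mul] at *
    exact (TT _).mul_mem ha hb
  one_mem' := by
    simp only [Set.mem_ofPred_eq, Units.val_one, map_one]
    exact (TT _).one_mem
  inv_mem' := by
    intro a ha
    simp only [Set.mem_ofPred_eq] at *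
    have h1 : ph L a * ph L (a⁻¹ : (𝓞 L)ˣ) = 1 := by
      rw [← map_mul]; simp
    rcases TT_unit A_two h.A_t ha with h0 | ⟨y, hy, h2⟩
    · rw [h0, zero_mul] at h1
      have := h.A_e0
      exact absurd (by linear_combination (-ph L (1 + h.imO)) * h1) this
    · have : ph L (a⁻¹ : (𝓞 L)ˣ) = y := by
        linear_combination (-ph L (a⁻¹ : (𝓞 L)ˣ)) * h2 + y * h1
      rw [this]; exact hy

theorem mem_SS (h : Sextic L θ) (u : (𝓞 L)ˣ) : u ∈ h.SS ↔ ph L u ∈ TT (ph L h.thO) := Iff.rfl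

/-- squares -/
noncomputable def HH (L : Type) [Field L] [NumberField L] : Subgroup (𝓞 L)ˣ := (powMonoidHom 2).range

theorem mem_HH (u : (𝓞 L)ˣ) : u ∈ HH L ↔ ∃ v, v ^ 2 = u := Iff.rfl

theorem HH_le (h : Sextic L θ) : HH L ≤ h.SS := by
  rintro u ⟨v, rfl⟩
  rw [mem_SS]
  simp only [powMonoidHom_apply, Units.val_pow_eq_pow_val, map_pow]
  exact TT_sq A_two h.A_t h.A_e h.A_e0 h.A_card _

/-- unit i -/
noncomputable def u1 (h : Sextic L θ) : (𝓞 L)ˣ := ⟨h.imO, -h.imO, by linear_combination -h.imO_sq, by linear_combination -h.imO_sq⟩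
/-- unit θ + i -/
noncomputable def u2 (h : Sextic L θ) : (𝓞 L)ˣ := ⟨h.thO + h.imO, h.imO * (h.thO ^ 2 + (1 + h.imO) * h.thO + h.imO - 1),
  by linear_combination h.imO * h.cubO + (-1 + h.imO + h.imO * h.thO) * h.imO_sq,
  by linear_combination h.imO * h.cubO + (-1 + h.imO + h.imO * h.thO) * h.imO_sq⟩
/-- unit 1 + θ + i -/
noncomputable def u3 (h : Sextic L θ) : (𝓞 L)ˣ := ⟨1 + h.thO + h.imO, -(h.thO ^ 2 + h.imO * h.thO + h.imO - 1),
  by linear_combination -h.cubO - (1 + h.thO) * h.imO_sq,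
  by linear_combination -h.cubO - (1 + h.thO) * h.imO_sq⟩

theorem SS_odd (h : Sextic L θ) (y0 y1 y2 : ℤ) (u : (𝓞 L)ˣ) (hu : u ∈ h.SS) (x0 x1 x2 : ℤ)
    (hx : ph L u = (x0 + x1 * ph L h.thO + x2 * (ph L h.thO) ^ 2) + ph L (1 + h.imO) * (y0 + y1 * ph L h.thO + y2 * (ph L h.thO) ^ 2)) :
    Even y0 ∧ Even y1 ∧ Even y2 := by
  have hnt : Nontrivial (𝓞 L ⧸ I2 L) := ⟨_, _, h.A_e0⟩
  rw [mem_SS] at hu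
  have := TT_disj A_two h.A_t h.A_e h.A_e0 ((TT _).sub_mem (mem_TT _ x0 x1 x2) hu) (mem_TT _ y0 y1 y2)
    (by rw [hx]; ring)
  exact BL A_two h.A_t _ _ _ this.2

theorem SS_exp (h : Sextic L θ) (p q r : ℕ) (hm : h.u1 ^ p * h.u2 ^ q * h.u3 ^ r ∈ h.SS) :
    p % 2 = 0 ∧ q % 2 = 0 ∧ r % 2 = 0 := by
  have key : h.u1 ^ (p % 2) * h.u2 ^ (q % 2) * h.u3 ^ (r % 2) ∈ h.SS := by
    have h1 : h.u1 ^ p * h.u2 ^ q * h.u3 ^ r = h.u1 ^ (p % 2) * h.u2 ^ (q % 2) * h.u3 ^ (r % 2) *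
      (h.u1 ^ (p / 2) * h.u2 ^ (q / 2) * h.u3 ^ (r / 2)) ^ 2 := by
      conv_lhs => rw [← Nat.mod_add_div p 2, ← Nat.mod_add_div q 2, ← Nat.mod_add_div r 2]
      simp only [pow_add, pow_mul, mul_pow]
      rw [pow_right_comm h.u1 2, pow_right_comm h.u2 2, pow_right_comm h.u3 2]
      generalize (h.u1 ^ (p / 2)) ^ 2 = a1
      generalize (h.u2 ^ (q / 2)) ^ 2 = a2
      generalize (h.u3 ^ (r / 2)) ^ 2 = a3
      generalize (h.u1) ^ (p % 2) = a4
      generalize (h.u2) ^ (q % 2) = a5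
      generalize (h.u3) ^ (r % 2) = a6
      simp only [mul_assoc, mul_left_comm, mul_comm]
    rw [h1] at hm
    exact (h.SS.mul_mem_cancel_right (h.HH_le ⟨_, rfl⟩)).1 hm
  have hE := h.A_e
  have hT := h.A_t
  have h2 := A_two (L := L)
  have e1 : (h.u1 : 𝓞 L) = h.imO := rfl
  have e2 : (h.u2 : 𝓞 L) = h.thO + h.imO := rfl
  have e3 : (h.u3 : 𝓞 L) = 1 + h.thO + h.imO := rfl
  simp only [map_add, map_one] at hE
  rcases Nat.mod_two_eq_zero_or_one p with hp | hp <;> rcases Nat.mod_two_eq_zero_or_one q with hq | hq <;>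
  rcases Nat.mod_two_eq_zero_or_one r with hr | hr <;> rw [hp, hq, hr] at key ⊢
  · simp
  · have := h.SS_odd 1 0 0 _ key 0 1 0 (by
      simp [e1, e2, e3]; ring)
    simp at this
  · have := h.SS_odd 1 0 0 _ key 1 1 0 (by
      simp [e1, e2, e3]; linear_combination (-1) * h2)
    simp at this
  · have := h.SS_odd 1 0 0 _ key 0 1 1 (by
      simp [e1, e2, e3]; linear_combination hE + (ph L h.thO * ph L h.imO - 1 - ph L h.imO) * h2)
    simp at this
  · have := h.SS_odd 1 0 0 _ key 1 0 0 (by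
      simp [e1, e2, e3]; linear_combination -h2)
    simp at this
  · have := h.SS_odd 1 1 0 _ key 0 1 0 (by
      simp [e1, e2, e3]; linear_combination hE + (- 1 - ph L h.imO - ph L h.thO) * h2)
    simp at this
  · have := h.SS_odd 0 1 0 _ key 1 1 0 (by
      simp [e1, e2, e3]; linear_combination hE + (- 1 - ph L h.imO - ph L h.thO) * h2)
    simp at this
  · have := h.SS_odd 1 1 1 _ key 0 1 1 (by
      simp [e1, e2, e3]; linear_combination (ph L h.imO - 1) * hE + (ph L h.imO ^ 2 * ph L h.thO - ph L h.thO - ph L h.thO ^ 2) * h2)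
    simp at this

theorem HH_index (h : Sextic L θ) : (HH L).index ≤ 8 ∧ (HH L).index ≠ 0 := by
  obtain ⟨ζ, hζ⟩ := IsCyclic.exists_generator (α := Units.torsion L)
  let F : Fin 2 × (Fin (Units.rank L) → Fin 2) → (𝓞 L)ˣ ⧸ HH L := fun v =>
    QuotientGroup.mk ((ζ : (𝓞 L)ˣ) ^ (v.1 : ℕ) * ∏ i, (Units.fundSystem L i) ^ ((v.2 i : ℕ)))
  have hF : Function.Surjective F := by
    intro u
    induction u using QuotientGroup.induction_on with | H u => ?_
    obtain ⟨⟨z, e⟩, hu, -⟩ := Units.exist_unique_eq_mul_prod L u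
    obtain ⟨n, hn⟩ := Subgroup.mem_zpowers_iff.1 (hζ z)
    have hdiv : ∀ n : ℤ, n = ((n % 2).toNat : ℕ) + 2 * (n / 2) := by intro n; omega
    have hlt : ∀ n : ℤ, (n % 2).toNat < 2 := by intro n; omega
    refine ⟨(⟨(n % 2).toNat, hlt n⟩, fun i => ⟨(e i % 2).toNat, hlt (e i)⟩), ?_⟩
    simp only [F]
    rw [QuotientGroup.eq, mem_HH]
    refine ⟨(ζ : (𝓞 L)ˣ) ^ (n / 2) * ∏ i, (Units.fundSystem L i) ^ (e i / 2), ?_⟩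
    rw [eq_inv_mul_iff_mul_eq, hu]
    simp only
    rw [← hn, Subgroup.coe_zpow]
    have h1 : ∀ i, (Units.fundSystem L i) ^ (e i) = (Units.fundSystem L i) ^ ((e i % 2).toNat) * ((Units.fundSystem L i) ^ (e i / 2)) ^ 2 := by
      intro i
      conv_lhs => rw [hdiv (e i), zpow_add, zpow_natCast, mul_comm (2 : ℤ), zpow_mul]
      rfl
    have h2 : (ζ : (𝓞 L)ˣ) ^ n = (ζ : (𝓞 L)ˣ) ^ ((n % 2).toNat) * ((ζ : (𝓞 L)ˣ) ^ (n / 2)) ^ 2 := by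
      conv_lhs => rw [hdiv n, zpow_add, zpow_natCast, mul_comm (2 : ℤ), zpow_mul]
      rfl
    rw [h2, Finset.prod_congr rfl (fun i _ => h1 i), Finset.prod_mul_distrib, Finset.prod_pow, mul_pow]
    simp only [mul_assoc, mul_left_comm, mul_comm]
  have hfin : Finite ((𝓞 L)ˣ ⧸ HH L) := Finite.of_surjective F hF
  have hc := Nat.card_le_card_of_surjective F hF
  constructor
  · refine hc.trans ?_
    simp [h.rank2]
  · exact Subgroup.index_ne_zero_of_finite

theorem SS_eq (h : Sextic L θ) : h.SS = HH L := by
  have hle := h.HH_le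
  have hmul := Subgroup.relIndex_mul_index hle
  obtain ⟨h8, h0⟩ := h.HH_index
  have hS0 : h.SS.index ≠ 0 := by intro h'; rw [h', mul_zero] at hmul; exact h0 hmul.symm
  have hfin : Finite ((𝓞 L)ˣ ⧸ h.SS) := by
    have : h.SS.FiniteIndex := ⟨hS0⟩
    exact Subgroup.finite_quotient_of_finiteIndex
  have hS8 : 8 ≤ h.SS.index := by
    let F : Fin 2 × Fin 2 × Fin 2 → (𝓞 L)ˣ ⧸ h.SS := fun v =>
      QuotientGroup.mk (h.u1 ^ (v.1 : ℕ) * h.u2 ^ (v.2.1 : ℕ) * h.u3 ^ (v.2.2 : ℕ))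
    have hF : Function.Injective F := by
      rintro ⟨a, b, c⟩ ⟨a', b', c'⟩ hv
      simp only [F] at hv
      rw [QuotientGroup.eq] at hv
      have hsq : (h.u1 ^ (a : ℕ) * h.u2 ^ (b : ℕ) * h.u3 ^ (c : ℕ)) ^ 2 ∈ h.SS := h.HH_le ⟨_, rfl⟩
      have := h.SS.mul_mem hsq hv
      have h3 := h.SS_exp (a + a') (b + b') (c + c') (by
        convert this using 1
        rw [pow_two, mul_assoc (h.u1 ^ (a : ℕ) * h.u2 ^ (b : ℕ) * h.u3 ^ (c : ℕ)), mul_inv_cancel_left]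
        simp only [pow_add, mul_assoc, mul_left_comm, mul_comm])
      have := a.2; have := b.2; have := c.2; have := a'.2; have := b'.2; have := c'.2
      simp only [Prod.mk.injEq, Fin.ext_iff]
      omega
    have := Nat.card_le_card_of_injective F hF
    rw [Subgroup.index]
    simpa using this
  have h1 : (HH L).relIndex h.SS = 1 := by
    have : (HH L).relIndex h.SS ≠ 0 := by intro h'; rw [h', zero_mul] at hmul; exact h0 hmul.symm
    nlinarith [Nat.pos_of_ne_zero this]
  exact le_antisymm (Subgroup.relIndex_eq_one.1 h1) hle

/-- the main unit lemma -/
theorem unit_sq (h : Sextic L θ) (c0 c1 c2 : ℤ) (hc : ¬ (Even c0 ∧ Even c1 ∧ Even c2)) (u : (𝓞 L)ˣ) (s : 𝓞 L)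
    (hq : (c0 + c1 * h.thO + c2 * h.thO ^ 2 : 𝓞 L) = u * s ^ 2) :
    ∃ r : 𝓞 L, (c0 + c1 * h.thO + c2 * h.thO ^ 2 : 𝓞 L) = r ^ 2 := by
  have hu : u ∈ h.SS := by
    rw [mem_SS]
    have h1 := congrArg (ph L) hq
    simp only [map_add, map_mul, map_pow, map_intCast] at h1
    have h2 := TT_sq A_two h.A_t h.A_e h.A_e0 h.A_card (ph L s)
    have h3 := mem_TT (ph L h.thO) c0 c1 c2
    rcases TT_unit A_two h.A_t h2 with h4 | ⟨y, hy, h4⟩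
    · rw [h4, mul_zero] at h1
      have hnt : Nontrivial (𝓞 L ⧸ I2 L) := ⟨_, _, h.A_e0⟩
      exact absurd (BL A_two h.A_t _ _ _ h1) hc
    · have : ph L u = (c0 + c1 * ph L h.thO + c2 * (ph L h.thO) ^ 2) * y := by
        rw [h1]; linear_combination (-ph L u) * h4
      rw [this]; exact (TT _).mul_mem h3 hy
  rw [h.SS_eq, mem_HH] at hu
  obtain ⟨v, rfl⟩ := hu
  exact ⟨v * s, by rw [hq]; push_cast; ring⟩

end Sextic


/-- the sextic -/
noncomputable def fS : ℤ[X] := X ^ 6 + 2 * X ^ 5 + X ^ 4 + 2 * X ^ 3 + 6 * X ^ 2 + 4 * X + 1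

theorem deg2_form {q : ℤ[X]} (hq : q.natDegree ≤ 2) : q = C (q.coeff 0) + C (q.coeff 1) * X + C (q.coeff 2) * X ^ 2 := by
  have := as_sum_range_C_mul_X_pow' (p := q) (n := 3) (by omega)
  conv_lhs => rw [this]
  simp [Finset.sum_range_succ]

theorem prim_odd {q : ℤ[X]} (hq : q.natDegree ≤ 2) (hp : q.IsPrimitive) :
    ¬ (Even (q.coeff 0) ∧ Even (q.coeff 1) ∧ Even (q.coeff 2)) := by
  rintro ⟨⟨a, ha⟩, ⟨b, hb⟩, ⟨c, hc⟩⟩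
  have h2 : C (2 : ℤ) ∣ q := by
    refine ⟨C a + C b * X + C c * X ^ 2, ?_⟩
    rw [deg2_form hq, ha, hb, hc]
    simp only [map_add, map_ofNat]; ring
  have := hp 2 h2
  rw [Int.isUnit_iff] at this
  omega

theorem modp_dvd {p : ℕ} [Fact p.Prime] {q g M H : (ZMod p)[X]} (hq0 : q ≠ 0) (hq : q.natDegree ≤ 2) (hg : Irreducible g)
    (hgq : g ∣ q) (hgH : g ∣ H) (hM : M ^ 2 = - (q * H)) : q ∣ M := by
  obtain ⟨l, rfl⟩ := hgq
  obtain ⟨r, rfl⟩ := hgH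
  have hgp := hg.prime
  obtain ⟨m, rfl⟩ := hgp.dvd_of_dvd_pow (⟨-(l * (g * r)), by rw [hM]; ring⟩ : g ∣ M ^ 2)
  have hg0 := hg.ne_zero
  have h1 : m ^ 2 = l * (- r) := by
    apply mul_left_cancel₀ (pow_ne_zero 2 hg0)
    linear_combination hM
  have hl0 : l ≠ 0 := right_ne_zero_of_mul hq0
  rw [natDegree_mul hg0 hl0] at hq
  have hgd := hg.natDegree_pos
  apply mul_dvd_mul_left
  rcases Nat.eq_zero_or_pos l.natDegree with h | h
  · rw [natDegree_eq_zero] at h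
    obtain ⟨c, rfl⟩ := h
    have hc : c ≠ 0 := by rintro rfl; simp at hl0
    exact (Polynomial.isUnit_C.2 hc.isUnit).dvd
  · have : l.degree = 1 := by
      rw [degree_eq_natDegree hl0]; norm_cast; omega
    have hl := (irreducible_of_degree_eq_one this).prime
    exact hl.dvd_of_dvd_pow ⟨_, h1⟩

theorem C_dvd_of_map {p : ℕ} {P : ℤ[X]} (h : P.map (Int.castRingHom (ZMod p)) = 0) : C (p : ℤ) ∣ P := by
  rw [C_dvd_iff_dvd_coeff]
  intro i
  have := congrArg (fun Q => Q.coeff i) h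
  simp only [coeff_map, coeff_zero, eq_intCast] at this
  exact (ZMod.intCast_zmod_eq_zero_iff_dvd _ _).1 this

theorem natDegree_of_C_mul {p : ℤ} (hp : p ≠ 0) (P : ℤ[X]) : (C p * P).natDegree = P.natDegree :=
  natDegree_C_mul hp

/-- descent on d when p | d -/
theorem descend {p : ℕ} [hpf : Fact p.Prime] {q M H : ℤ[X]} {d : ℤ} (hq : q.natDegree ≤ 2) (hqp : q.IsPrimitive)
    (hM : M.natDegree ≤ 3) (hH : H.natDegree ≤ 4) (hd : d ≠ 0) (e : C (d ^ 2) * fS = M ^ 2 + q * H) (hpd : (p : ℤ) ∣ d)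
    (g : (ZMod p)[X]) (hg : Irreducible g) (hgq : g ∣ q.map (Int.castRingHom (ZMod p)))
    (hgH : g ∣ H.map (Int.castRingHom (ZMod p))) :
    ∃ (M' H' : ℤ[X]) (d' : ℤ), M'.natDegree ≤ 3 ∧ H'.natDegree ≤ 4 ∧ d' ≠ 0 ∧ d'.natAbs < d.natAbs ∧ C (d' ^ 2) * fS = M' ^ 2 + q * H' := by
  have hp := hpf.out
  obtain ⟨d', rfl⟩ := hpd
  set φ := Int.castRingHom (ZMod p)
  have hpp : Prime (C (p : ℤ) : ℤ[X]) := prime_C_iff.2 (Nat.prime_iff_prime_int.1 hp)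
  have hnq : ¬ C (p : ℤ) ∣ q := fun h => by
    have := hqp _ h
    exact (Nat.prime_iff_prime_int.1 hp).not_isUnit this
  have hq0 : q.map φ ≠ 0 := fun h => hnq (C_dvd_of_map h)
  have hMM : (M.map φ) ^ 2 = - (q.map φ * H.map φ) := by
    have := congrArg (Polynomial.map φ) e
    simp only [Polynomial.map_mul, Polynomial.map_add, Polynomial.map_pow, map_C] at this
    have h0 : φ (((p : ℤ) * d') ^ 2) = 0 := by simp [φ]
    rw [h0, C_0, zero_mul] at this
    linear_combination -this
  obtain ⟨n, hn⟩ := modp_dvd hq0 (natDegree_map_le.trans hq) hg hgq hgH hMM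
  have hnd : n.natDegree ≤ 1 := by
    have h1 : q.map φ * n ^ 2 = - H.map φ := by
      apply mul_left_cancel₀ hq0
      rw [hn] at hMM; linear_combination hMM
    by_cases hn0 : n = 0
    · simp [hn0]
    have h2 := congrArg natDegree h1
    rw [natDegree_mul hq0 (pow_ne_zero 2 hn0), natDegree_pow, natDegree_neg] at h2
    have h3 : (H.map φ).natDegree ≤ 4 := natDegree_map_le.trans hH
    have h4 : 0 < (q.map φ).natDegree := hg.natDegree_pos.trans_le (natDegree_le_of_dvd hgq hq0)
    omega
  obtain ⟨n0, n1, rfl⟩ : ∃ n0 n1 : ZMod p, n = C n0 + C n1 * X := by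
    refine ⟨n.coeff 0, n.coeff 1, ?_⟩
    have := as_sum_range_C_mul_X_pow' (p := n) (n := 2) (by omega)
    conv_lhs => rw [this]
    simp [Finset.sum_range_succ]
  obtain ⟨m0, rfl⟩ := ZMod.intCast_surjective n0
  obtain ⟨m1, rfl⟩ := ZMod.intCast_surjective n1
  set N : ℤ[X] := C m0 + C m1 * X with hN
  have hNd : N.natDegree ≤ 1 := by rw [hN]; compute_degree
  have h1 : (M - q * N).map φ = 0 := by
    simp [hn, hN, φ]
  obtain ⟨M1, hM1⟩ := C_dvd_of_map h1
  have hp0 : (p : ℤ) ≠ 0 := by exact_mod_cast hp.ne_zero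
  have hM1d : M1.natDegree ≤ 3 := by
    rw [← natDegree_C_mul hp0, ← hM1]
    refine (natDegree_sub_le _ _).trans (max_le hM (natDegree_mul_le.trans (by omega)))
  have h2 : C (p : ℤ) ^ 2 ∣ q * (q * N ^ 2 + 2 * C (p : ℤ) * N * M1 + H) := by
    refine ⟨C d' ^ 2 * fS - M1 ^ 2, ?_⟩
    have h3 : M = q * N + C (p : ℤ) * M1 := by linear_combination hM1
    rw [h3] at e
    simp only [map_pow, map_mul] at e
    linear_combination -e
  obtain ⟨H', hH'⟩ := hpp.pow_dvd_of_dvd_mul_left 2 hnq h2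
  have hd' : d' ≠ 0 := right_ne_zero_of_mul hd
  refine ⟨M1, H', d', hM1d, ?_, hd', ?_, ?_⟩
  · rw [← natDegree_C_mul (pow_ne_zero 2 hp0), map_pow, ← hH']
    refine (natDegree_add_le _ _).trans (max_le ((natDegree_add_le _ _).trans (max_le ?_ ?_)) hH)
    · refine natDegree_mul_le.trans ?_
      have := natDegree_pow_le (p := N) (n := 2)
      omega
    · refine natDegree_mul_le.trans ?_
      have : (2 * C (p : ℤ) * N).natDegree ≤ 1 := by
        have : (2 : ℤ[X]) * C (p : ℤ) = C (2 * (p : ℤ)) := by simp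
        rw [this]; exact (natDegree_C_mul_le _ _).trans hNd
      omega
  · rw [Int.natAbs_mul]
    have := hp.two_le
    have : 0 < d'.natAbs := Int.natAbs_pos.2 hd'
    simp only [Int.natAbs_natCast]
    nlinarith
  · apply mul_left_cancel₀ (pow_ne_zero 2 hpp.ne_zero)
    have h3 : M = q * N + C (p : ℤ) * M1 := by linear_combination hM1
    rw [h3] at e
    simp only [map_pow, map_mul] at e ⊢
    linear_combination e + q * hH'

namespace Sextic
variable {L : Type} [Field L] [NumberField L] {θ : L}

theorem aeval_ne (h : Sextic L θ) {q : ℤ[X]} (hq : q.natDegree ≤ 2) (hq0 : q ≠ 0) : aeval h.thO q ≠ 0 := by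
  intro h0
  rw [deg2_form hq] at h0
  have h1 := congrArg (algebraMap (𝓞 L) L) h0
  simp [thO_coe] at h1
  have := h.indep (q.coeff 0) (q.coeff 1) (q.coeff 2) 0 0 0 (by push_cast; linear_combination h1)
  apply hq0
  rw [deg2_form hq]
  obtain ⟨a, b, c, -⟩ := this
  norm_cast at a b c
  rw [a, b, c]; simp

theorem step_prime (h : Sextic L θ) {q M H : ℤ[X]} {d : ℤ} (hq : q.natDegree ≤ 2) (hqp : q.IsPrimitive)
    (hM : M.natDegree ≤ 3) (hH : H.natDegree ≤ 4) (hd : d ≠ 0) (e : C (d ^ 2) * fS = M ^ 2 + q * H)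
    (π : 𝓞 L) (hπ : Prime π) (h1 : π ∣ aeval h.thO q) (h2 : π ∣ aeval h.thO H) :
    ∃ (M' H' : ℤ[X]) (d' : ℤ), M'.natDegree ≤ 3 ∧ H'.natDegree ≤ 4 ∧ d' ≠ 0 ∧ d'.natAbs < d.natAbs ∧ C (d' ^ 2) * fS = M' ^ 2 + q * H' := by
  let I : Ideal (𝓞 L) := Ideal.span {π}
  have hI : I.IsPrime := (Ideal.span_singleton_prime hπ.ne_zero).2 hπ
  have hI0 : I ≠ ⊥ := by simpa [I] using hπ.ne_zero
  have hfin : Finite (𝓞 L ⧸ I) := Ideal.finiteQuotientOfFreeOfNeBot I hI0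
  obtain ⟨p, hpc⟩ := CharP.exists (𝓞 L ⧸ I)
  have hp : p.Prime := by
    rcases CharP.char_is_prime_or_zero (𝓞 L ⧸ I) p with hp | hp
    · exact hp
    · exact absurd hp (CharP.char_ne_zero_of_finite (𝓞 L ⧸ I) p)
  have hpf : Fact p.Prime := ⟨hp⟩
  letI : Algebra (ZMod p) (𝓞 L ⧸ I) := ZMod.algebra _ p
  set ψ := Ideal.Quotient.mk I with hψ
  set t := ψ h.thO with ht
  have hev : ∀ P : ℤ[X], aeval t (P.map (Int.castRingHom (ZMod p))) = ψ (aeval h.thO P) := by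
    intro P
    induction P using Polynomial.induction_on' with
    | add a b ha hb => simp only [Polynomial.map_add, map_add, ha, hb]
    | monomial n a => simp [ht]
  have hdv : ∀ P : ℤ[X], π ∣ aeval h.thO P → aeval t (P.map (Int.castRingHom (ZMod p))) = 0 := by
    intro P hP
    rw [hev, hψ, Ideal.Quotient.eq_zero_iff_mem, Ideal.mem_span_singleton]; exact hP
  have hdz : ∀ P : ℤ[X], π ∣ aeval h.thO P → aeval t P = 0 := by
    intro P hP
    have : aeval t P = ψ (aeval h.thO P) := by
      induction P using Polynomial.induction_on' with
      | add a b ha hb =>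
        have ha' : aeval t (a : ℤ[X]) = ψ (aeval h.thO a) := by
          simp [aeval_def, eval₂_eq_sum, Polynomial.sum, ht]
        have hb' : aeval t (b : ℤ[X]) = ψ (aeval h.thO b) := by
          simp [aeval_def, eval₂_eq_sum, Polynomial.sum, ht]
        simp only [map_add, ha', hb']
      | monomial n a => simp [ht]
    rw [this, hψ, Ideal.Quotient.eq_zero_iff_mem, Ideal.mem_span_singleton]; exact hP
  have hint : IsIntegral (ZMod p) t := Algebra.IsIntegral.isIntegral t
  by_cases hpd : (p : ℤ) ∣ d
  · exact descend hq hqp hM hH hd e hpd (minpoly (ZMod p) t) (minpoly.irreducible hint) (minpoly.dvd _ _ (hdv _ h1)) (minpoly.dvd _ _ (hdv _ h2))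
  exfalso
  have hr := congrArg ψ h.rootO
  simp only [map_add, map_mul, map_pow, map_ofNat, map_one, map_zero, ← ht] at hr
  have hdk : ((d : ℤ) : 𝓞 L ⧸ I) ≠ 0 := fun h0 => hpd ((CharP.intCast_eq_zero_iff _ p d).1 h0)
  have hq0 : aeval t q = 0 := hdz _ h1
  have hH0 : aeval t H = 0 := hdz _ h2
  have hf0 : aeval t fS = 0 := by simpa [fS, map_ofNat] using hr
  have hM0 : aeval t M = 0 := by
    have := congrArg (aeval t) e
    simp only [map_add, map_mul, map_pow, hf0, hq0, zero_mul, mul_zero, add_zero] at this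
    exact pow_eq_zero_iff (two_ne_zero) |>.1 this.symm
  have hf1 : 6 * t ^ 5 + 10 * t ^ 4 + 4 * t ^ 3 + 6 * t ^ 2 + 12 * t + 4 = 0 := by
    have := congrArg (fun P => aeval t (derivative P)) e
    simp only [derivative_add, derivative_mul, derivative_C, derivative_pow, map_add, map_mul, map_pow, hq0, hH0, hM0] at this
    simp [fS, map_ofNat] at this
    rcases this with h | h
    · exact absurd h hdk
    · linear_combination h
  have h104 : ((104 : ℤ) : 𝓞 L ⧸ I) = 0 := by
    push_cast
    linear_combination (548 + 252 * t + 54 * t ^ 2 + 416 * t ^ 3 + 300 * t ^ 4) * hr + (-111 - 278 * t - 87 * t ^ 2 - 21 * t ^ 3 - 86 * t ^ 4 - 50 * t ^ 5) * hf1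
  have hp104 : (p : ℤ) ∣ 104 := (CharP.intCast_eq_zero_iff _ p _).1 h104
  have hp2 : p = 2 ∨ p = 13 := by
    have : p ∣ 2 ^ 3 * 13 := by exact_mod_cast hp104
    rcases (hp.dvd_mul).1 this with h | h
    · left; exact (Nat.prime_dvd_prime_iff_eq hp Nat.prime_two).1 (hp.dvd_of_dvd_pow h)
    · right; exact (Nat.prime_dvd_prime_iff_eq hp (by norm_num)).1 h
  rcases hp2 with rfl | rfl
  · have h20 : (2 : 𝓞 L ⧸ I) = 0 := by simpa using CharP.cast_eq_zero (𝓞 L ⧸ I) 2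
    have hc := congrArg ψ h.cubO
    simp only [map_add, map_sub, map_mul, map_pow, map_ofNat, map_one, map_zero, ← ht, h20] at hc
    have ht3 : t ^ 3 = t ^ 2 + 1 := by linear_combination hc - t ^ 2 * h20
    rw [deg2_form hq] at hq0
    simp at hq0
    exact prim_odd hq hqp (BL h20 ht3 _ _ _ hq0)
  · have h13 : (13 : 𝓞 L ⧸ I) = 0 := by simpa using CharP.cast_eq_zero (𝓞 L ⧸ I) 13
    have h9 : (t - 3) ^ 2 = 0 := by
      linear_combination 3 * (11 * t + 11 * t ^ 2) * hr + 3 * (4 + t + 12 * t ^ 2 + 9 * t ^ 3) * hf1 + (-3 - t * 15 - t ^ 2 * 32 - t ^ 3 * 72 - t ^ 4 * 72 - t ^ 5 * 39 - t ^ 6 * 45 - t ^ 7 * 45 - t ^ 8 * 15) * h13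
    have ht3 : t = 3 := by
      have := pow_eq_zero_iff (two_ne_zero) |>.1 h9
      linear_combination this
    have hev3 : ∀ P : ℤ[X], aeval t P = 0 → (13 : ℤ) ∣ P.eval 3 := by
      intro P hP
      have : ((P.eval 3 : ℤ) : 𝓞 L ⧸ I) = 0 := by
        rw [← hP, ht3]
        have := aeval_algebraMap_apply (A := ℤ) (𝓞 L ⧸ I) (3 : ℤ) P
        simpa using this.symm
      exact_mod_cast (CharP.intCast_eq_zero_iff _ 13 _).1 this
    obtain ⟨a, ha⟩ := hev3 _ hq0
    obtain ⟨b, hb⟩ := hev3 _ hH0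
    obtain ⟨c, hc⟩ := hev3 _ hM0
    have := congrArg (eval 3) e
    simp [fS, ha, hb, hc] at this
    have h5 : (13 : ℤ) ∣ d ^ 2 * 109 := ⟨c ^ 2 + a * b, by linarith⟩
    have h6 : Prime (13 : ℤ) := by norm_num
    rcases h6.dvd_or_dvd h5 with h7 | h7
    · exact hpd (by exact_mod_cast h6.dvd_of_dvd_pow h7)
    · omega

theorem coprime_part (h : Sextic L θ) {q : ℤ[X]} (hq : q.natDegree ≤ 2) (hqp : q.IsPrimitive) :
    ∀ (n : ℕ) (M H : ℤ[X]) (d : ℤ), d.natAbs = n → M.natDegree ≤ 3 → H.natDegree ≤ 4 → d ≠ 0 → C (d ^ 2) * fS = M ^ 2 + q * H →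
    ∃ (u : (𝓞 L)ˣ) (s : 𝓞 L), aeval h.thO q = u * s ^ 2 := by
  intro n
  induction n using Nat.strong_induction_on with | _ n ih => ?_
  intro M H d hn hM hH hd e
  have hpid := h.pid
  by_cases hc : ∃ π : 𝓞 L, Prime π ∧ π ∣ aeval h.thO q ∧ π ∣ aeval h.thO H
  · obtain ⟨π, hπ, h1, h2⟩ := hc
    obtain ⟨M', H', d', a, b, c, hlt, e'⟩ := h.step_prime hq hqp hM hH hd e π hπ h1 h2
    exact ih _ (hn ▸ hlt) M' H' d' rfl a b c e'
  · push Not at hc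
    have hq0 : aeval h.thO q ≠ 0 := h.aeval_ne hq hqp.ne_zero
    have hcop : IsCoprime (aeval h.thO q) (- aeval h.thO H) :=
      (isCoprime_of_prime_dvd (fun h => hq0 h.1) hc).neg_right
    have hmul : aeval h.thO q * (- aeval h.thO H) = (aeval h.thO M) ^ 2 := by
      have := congrArg (aeval h.thO) e
      have hf : aeval h.thO fS = 0 := by simpa [fS, map_ofNat] using h.rootO
      simp only [map_add, map_mul, map_pow, hf, mul_zero] at this
      linear_combination this
    obtain ⟨s, u, hs⟩ := exists_associated_pow_of_mul_eq_pow' hcop hmul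
    exact ⟨u, s, by rw [← hs]; ring⟩

theorem sq_part (h : Sextic L θ) {q M H : ℤ[X]} {d : ℤ} (hq : q.natDegree ≤ 2) (hqp : q.IsPrimitive)
    (hM : M.natDegree ≤ 3) (hH : H.natDegree ≤ 4) (hd : d ≠ 0) (e : C (d ^ 2) * fS = M ^ 2 + q * H) :
    ∃ s : 𝓞 L, aeval h.thO q = s ^ 2 := by
  obtain ⟨u, s, hs⟩ := h.coprime_part hq hqp _ M H d rfl hM hH hd e
  have h1 : aeval h.thO q = (q.coeff 0 + q.coeff 1 * h.thO + q.coeff 2 * h.thO ^ 2 : 𝓞 L) := by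
    conv_lhs => rw [deg2_form hq]
    simp
  rw [h1] at hs ⊢
  exact h.unit_sq _ _ _ (prim_odd hq hqp) u s hs
end Sextic


theorem P6_inj {R : Type*} [CommRing R] {a0 a1 a2 a3 a4 a5 a6 b0 b1 b2 b3 b4 b5 b6 : R}
    (h : C a0 + C a1 * X + C a2 * X ^ 2 + C a3 * X ^ 3 + C a4 * X ^ 4 + C a5 * X ^ 5 + C a6 * X ^ 6 =
      C b0 + C b1 * X + C b2 * X ^ 2 + C b3 * X ^ 3 + C b4 * X ^ 4 + C b5 * X ^ 5 + C b6 * X ^ 6) :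
    a0 = b0 ∧ a1 = b1 ∧ a2 = b2 ∧ a3 = b3 ∧ a4 = b4 ∧ a5 = b5 ∧ a6 = b6 := by
  have h0 := congrArg (fun P => coeff P 0) h
  have h1 := congrArg (fun P => coeff P 1) h
  have h2 := congrArg (fun P => coeff P 2) h
  have h3 := congrArg (fun P => coeff P 3) h
  have h4 := congrArg (fun P => coeff P 4) h
  have h5 := congrArg (fun P => coeff P 5) h
  have h6 := congrArg (fun P => coeff P 6) h
  simp only [coeff_add, coeff_C_mul, coeff_X_pow, coeff_C, coeff_X] at h0 h1 h2 h3 h4 h5 h6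
  norm_num at h0 h1 h2 h3 h4 h5 h6
  exact ⟨h0, h1, h2, h3, h4, h5, h6⟩

theorem monic_form {R : Type*} [CommRing R] {P : R[X]} (hP : P.Monic) (n : ℕ) (hn : P.natDegree = n) :
    P = X ^ n + ∑ i ∈ Finset.range n, C (P.coeff i) * X ^ i := by
  have := hP.as_sum
  rw [hn] at this
  exact this

theorem fS_monic : fS.Monic := by unfold fS; monicity!

theorem fS_natDegree : fS.natDegree = 6 := by unfold fS; compute_degree!

theorem dec33 : ∀ a b c x y z : ZMod 3, ¬ (a * x = 1 ∧ a * y + b * x = 1 ∧ a * z + b * y + c * x = 0 ∧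
   a + b * z + c * y + x = 2 ∧ b + c * z + y = 1 ∧ c + z = 2) := by decide +kernel

theorem dec24 : ∀ a b x y z w : ZMod 3, ¬ (a * x = 1 ∧ a * y + b * x = 1 ∧ a * z + b * y + x = 0 ∧
   a * w + b * z + y = 2 ∧ a + b * w + z = 1 ∧ b + w = 2) := by decide +kernel

theorem dec15 : ∀ a : ZMod 3, a ^ 6 + 2 * a ^ 5 + a ^ 4 + 2 * a ^ 3 + 6 * a ^ 2 + 4 * a + 1 ≠ 0 := by decide +kernel

theorem fS_irr3 : Irreducible (fS.map (Int.castRingHom (ZMod 3))) := by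
  have hm := fS_monic.map (Int.castRingHom (ZMod 3))
  have hd : (fS.map (Int.castRingHom (ZMod 3))).natDegree = 6 := by
    rw [fS_monic.natDegree_map, fS_natDegree]
  have hf : fS.map (Int.castRingHom (ZMod 3)) = X ^ 6 + 2 * X ^ 5 + X ^ 4 + 2 * X ^ 3 + 6 * X ^ 2 + 4 * X + 1 := by
    simp [fS]
  have e3 : (C 3 : (ZMod 3)[X]) = 0 := by
    have : (3 : ZMod 3) = 0 := by decide
    rw [this, C_0]
  have e3' : (3 : (ZMod 3)[X]) = 0 := by rw [← e3, map_ofNat]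
  rw [hm.irreducible_iff_natDegree']
  refine ⟨fun h => by rw [h] at hd; simp at hd, ?_⟩
  intro g h hg hh hgh hmem
  rw [hd, Finset.mem_Ioc] at hmem
  have hsum : g.natDegree + h.natDegree = 6 := by rw [← hg.natDegree_mul hh, hgh, hd]
  obtain ⟨k, hk⟩ : ∃ k, h.natDegree = k := ⟨_, rfl⟩
  have hk1 : 0 < k := by omega
  have hk2 : k ≤ 3 := by omega
  have hgk : g.natDegree = 6 - k := by omega
  have fh := monic_form hh k hk
  have fg := monic_form hg _ hgk
  rw [hf] at hgh
  generalize h.coeff = b at fh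
  generalize g.coeff = a at fg
  interval_cases k
  · rw [fh] at hgh
    have := congrArg (eval (-b 0)) hgh
    simp only [eval_mul, eval_add, eval_pow, eval_X, eval_ofNat, eval_one, Finset.sum_range_one, eval_C] at this
    exact dec15 (-b 0) (by rw [← this]; ring)
  · simp [Finset.sum_range_succ] at fh fg
    rw [fh, fg] at hgh
    have := P6_inj (a0 := b 0 * a 0) (a1 := b 0 * a 1 + b 1 * a 0) (a2 := b 0 * a 2 + b 1 * a 1 + a 0)
      (a3 := b 0 * a 3 + b 1 * a 2 + a 1) (a4 := b 0 + b 1 * a 3 + a 2) (a5 := b 1 + a 3) (a6 := 1)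
      (b0 := 1) (b1 := 1) (b2 := 0) (b3 := 2) (b4 := 1) (b5 := 2) (b6 := 1) (by
        simp only [map_add, map_mul, map_one, map_ofNat, map_zero]; linear_combination hgh + (X + 2 * X ^ 2) * e3')
    exact dec24 _ _ _ _ _ _ ⟨this.1, this.2.1, this.2.2.1, this.2.2.2.1, this.2.2.2.2.1, this.2.2.2.2.2.1⟩
  · simp [Finset.sum_range_succ] at fh fg
    rw [fh, fg] at hgh
    have := P6_inj (a0 := b 0 * a 0) (a1 := b 0 * a 1 + b 1 * a 0) (a2 := b 0 * a 2 + b 1 * a 1 + b 2 * a 0)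
      (a3 := b 0 + b 1 * a 2 + b 2 * a 1 + a 0) (a4 := b 1 + b 2 * a 2 + a 1) (a5 := b 2 + a 2) (a6 := 1)
      (b0 := 1) (b1 := 1) (b2 := 0) (b3 := 2) (b4 := 1) (b5 := 2) (b6 := 1) (by
        simp only [map_add, map_mul, map_one, map_ofNat, map_zero]; linear_combination hgh + (X + 2 * X ^ 2) * e3')
    exact dec33 _ _ _ _ _ _ ⟨this.1, this.2.1, this.2.2.1, this.2.2.2.1, this.2.2.2.2.1, this.2.2.2.2.2.1⟩

/-- rational version of the sextic -/
noncomputable abbrev fQ : ℚ[X] := fS.map (Int.castRingHom ℚ)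

theorem fQ_irr : Irreducible fQ := by
  have := Polynomial.Monic.irreducible_of_irreducible_map _ _ fS_monic fS_irr3
  exact (fS_monic.irreducible_iff_irreducible_map_fraction_map (K := ℚ)).1 this

instance fQ_fact : Fact (Irreducible fQ) := ⟨fQ_irr⟩

theorem fQ_monic : fQ.Monic := fS_monic.map _
theorem fQ_deg : fQ.natDegree = 6 := by rw [fS_monic.natDegree_map, fS_natDegree]

/-- the field -/
abbrev LL : Type := AdjoinRoot fQ

noncomputable instance LL_fd : FiniteDimensional ℚ LL := fQ_monic.finite_adjoinRoot
instance LL_nf : NumberField LL := { to_charZero := inferInstance, to_finiteDimensional := LL_fd }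

theorem LL_sextic : Sextic LL (AdjoinRoot.root fQ) where
  fin := by
    rw [(AdjoinRoot.powerBasis fQ_irr.ne_zero).finrank, AdjoinRoot.powerBasis_dim, fQ_deg]
  root := by
    have hf : (X ^ 6 + 2 * X ^ 5 + X ^ 4 + 2 * X ^ 3 + 6 * X ^ 2 + 4 * X + 1 : ℚ[X]) = fQ := by
      simp [fQ, fS]
    have := (congrArg (AdjoinRoot.mk fQ) hf).trans (AdjoinRoot.mk_self (f := fQ))
    simpa only [map_add, map_mul, map_pow, map_ofNat, map_one, AdjoinRoot.mk_X] using this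
  indep := by
    intro a0 a1 a2 a3 a4 a5 h
    have h1 : AdjoinRoot.mk fQ (C a0 + C a1 * X + C a2 * X ^ 2 + C a3 * X ^ 3 + C a4 * X ^ 4 + C a5 * X ^ 5) = 0 := by
      simpa [map_ofNat] using h
    rw [AdjoinRoot.mk_eq_zero] at h1
    have h2 := Polynomial.eq_zero_of_dvd_of_natDegree_lt h1 (by
      rw [fQ_deg]; refine lt_of_le_of_lt (b := 5) ?_ (by norm_num); compute_degree)
    have h3 := P6_inj (a0 := a0) (a1 := a1) (a2 := a2) (a3 := a3) (a4 := a4) (a5 := a5) (a6 := 0) (b0 := 0) (b1 := 0) (b2 := 0)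
      (b3 := 0) (b4 := 0) (b5 := 0) (b6 := 0) (by simpa using h2)
    exact ⟨h3.1, h3.2.1, h3.2.2.1, h3.2.2.2.1, h3.2.2.2.2.1, h3.2.2.2.2.2.1⟩


theorem degn_form {R : Type*} [CommRing R] {q : R[X]} {n : ℕ} (hq : q.natDegree ≤ n) : q = ∑ i ∈ Finset.range (n + 1), C (q.coeff i) * X ^ i :=
  as_sum_range_C_mul_X_pow' (p := q) (n := n + 1) (by omega)

theorem deg6_form {R : Type*} [CommRing R] {q : R[X]} (hq : q.natDegree ≤ 6) : q = C (q.coeff 0) + C (q.coeff 1) * X + C (q.coeff 2) * X ^ 2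
    + C (q.coeff 3) * X ^ 3 + C (q.coeff 4) * X ^ 4 + C (q.coeff 5) * X ^ 5 + C (q.coeff 6) * X ^ 6 := by
  conv_lhs => rw [degn_form hq]
  simp [Finset.sum_range_succ]

theorem deg3_form {R : Type*} [CommRing R] {q : R[X]} (hq : q.natDegree ≤ 3) : q = C (q.coeff 0) + C (q.coeff 1) * X + C (q.coeff 2) * X ^ 2
    + C (q.coeff 3) * X ^ 3 := by
  conv_lhs => rw [degn_form hq]
  simp [Finset.sum_range_succ]

namespace Sextic
variable {L : Type} [Field L] [NumberField L] {θ : L}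

theorem dvd_fS (h : Sextic L θ) {P : ℤ[X]} (hP : P.natDegree ≤ 6) (h0 : aeval h.thO P = 0) : P = C (P.coeff 6) * fS := by
  have hf := deg6_form hP
  generalize P.coeff = a at hf
  subst hf
  have h1 := congrArg (algebraMap (𝓞 L) L) h0
  have hr := h.root
  simp [thO_coe] at h1
  have := h.indep (a 0 - a 6) (a 1 - 4 * a 6) (a 2 - 6 * a 6) (a 3 - 2 * a 6) (a 4 - a 6) (a 5 - 2 * a 6) (by
    push_cast; linear_combination h1 - (a 6) * hr)
  obtain ⟨b0, b1, b2, b3, b4, b5⟩ := this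
  have c0 : a 0 = a 6 := by exact_mod_cast sub_eq_zero.1 b0
  have c1 : a 1 = 4 * a 6 := by exact_mod_cast sub_eq_zero.1 b1
  have c2 : a 2 = 6 * a 6 := by exact_mod_cast sub_eq_zero.1 b2
  have c3 : a 3 = 2 * a 6 := by exact_mod_cast sub_eq_zero.1 b3
  have c4 : a 4 = a 6 := by exact_mod_cast sub_eq_zero.1 b4
  have c5 : a 5 = 2 * a 6 := by exact_mod_cast sub_eq_zero.1 b5
  rw [c0, c1, c2, c3, c4, c5, fS]
  simp only [map_mul, map_ofNat]
  ring

theorem halve (h : Sextic L θ) {q : ℤ[X]} (hq : q.natDegree ≤ 2) (ρ : ℤ) (hρ : ρ = 1 ∨ ρ = -1) (s0 : 𝓞 L)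
    (hs0 : aeval h.thO q = s0 ^ 2) : ∃ (t m : ℤ[X]) (k : ℤ), t ≠ 0 ∧ t.natDegree ≤ 2 ∧ m.natDegree ≤ 3 ∧
      q * t ^ 2 - C ρ * m ^ 2 = C k * fS := by
  obtain ⟨s, hs⟩ : ∃ s : 𝓞 L, aeval h.thO q = (ρ : 𝓞 L) * s ^ 2 := by
    rcases hρ with rfl | rfl
    · exact ⟨s0, by rw [hs0]; simp⟩
    · exact ⟨h.imO * s0, by rw [hs0]; push_cast; linear_combination (s0 ^ 2) * h.imO_sq⟩
  let F := Fintype.linearCombination ℤ ![s, s * h.thO, s * h.thO ^ 2, -1, -h.thO, -h.thO ^ 2, -h.thO ^ 3]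
  have hF : ¬ Function.Injective F := by
    intro hi
    have := LinearMap.finrank_le_finrank_of_injective hi
    rw [RingOfIntegers.rank, h.fin] at this
    simp at this
  rw [injective_iff_map_eq_zero] at hF
  push Not at hF
  obtain ⟨v, hv, hv0⟩ := hF
  have hv' : s * (v 0 + v 1 * h.thO + v 2 * h.thO ^ 2) = v 3 + v 4 * h.thO + v 5 * h.thO ^ 2 + v 6 * h.thO ^ 3 := by
    simp only [F, Fintype.linearCombination_apply, Fin.sum_univ_succ] at hv
    simp at hv
    linear_combination hv
  set t : ℤ[X] := C (v 0) + C (v 1) * X + C (v 2) * X ^ 2 with ht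
  set m : ℤ[X] := C (v 3) + C (v 4) * X + C (v 5) * X ^ 2 + C (v 6) * X ^ 3 with hm
  have htd : t.natDegree ≤ 2 := by rw [ht]; compute_degree
  have hmd : m.natDegree ≤ 3 := by rw [hm]; compute_degree
  have hst : s * aeval h.thO t = aeval h.thO m := by
    simp [ht, hm]; linear_combination hv'
  refine ⟨t, m, (q * t ^ 2 - C ρ * m ^ 2).coeff 6, ?_, htd, hmd, ?_⟩
  · intro h0
    rw [h0, map_zero, mul_zero] at hst
    have h1 := h.dvd_fS (hmd.trans (by norm_num)) hst.symm
    have h2 : m.coeff 6 = 0 := coeff_eq_zero_of_natDegree_lt (by omega)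
    rw [h2, C_0, zero_mul] at h1
    have e1 := P6_inj (a0 := v 0) (a1 := v 1) (a2 := v 2) (a3 := 0) (a4 := 0) (a5 := 0) (a6 := 0) (b0 := 0) (b1 := 0) (b2 := 0)
      (b3 := 0) (b4 := 0) (b5 := 0) (b6 := 0) (by simpa [ht] using h0)
    have e2 := P6_inj (a0 := v 3) (a1 := v 4) (a2 := v 5) (a3 := v 6) (a4 := 0) (a5 := 0) (a6 := 0) (b0 := 0) (b1 := 0) (b2 := 0)
      (b3 := 0) (b4 := 0) (b5 := 0) (b6 := 0) (by simpa [hm] using h1)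
    apply hv0
    ext i
    fin_cases i
    · exact e1.1
    · exact e1.2.1
    · exact e1.2.2.1
    · exact e2.1
    · exact e2.2.1
    · exact e2.2.2.1
    · exact e2.2.2.2.1
  · apply h.dvd_fS
    · refine (natDegree_sub_le _ _).trans (max_le ?_ ?_)
      · refine natDegree_mul_le.trans ?_
        have := natDegree_pow_le (p := t) (n := 2)
        omega
      · refine (natDegree_C_mul_le _ _).trans ?_
        have := natDegree_pow_le (p := m) (n := 2)
        omega
    · simp only [map_sub, map_mul, map_pow, hs, ← hst]
      simp; ring
end Sextic

theorem halve_core {q M H : ℤ[X]} {d : ℤ} (hq : q.natDegree ≤ 2) (hqp : q.IsPrimitive)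
    (hM : M.natDegree ≤ 3) (hH : H.natDegree ≤ 4) (hd : d ≠ 0) (e : C (d ^ 2) * fS = M ^ 2 + q * H)
    (ρ : ℤ) (hρ : ρ = 1 ∨ ρ = -1) : ∃ (t m : ℤ[X]) (k : ℤ), t ≠ 0 ∧ t.natDegree ≤ 2 ∧ m.natDegree ≤ 3 ∧
      q * t ^ 2 - C ρ * m ^ 2 = C k * fS := by
  obtain ⟨s, hs⟩ := LL_sextic.sq_part hq hqp hM hH hd e
  exact LL_sextic.halve hq ρ hρ s hs


noncomputable def hm {R : Type*} [CommRing R] (n : ℕ) (P : ℤ[X]) (x z : R) : R := MvPolynomial.aeval ![x, z] (P.homogenize n)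

section hm
variable {R : Type*} [CommRing R]
theorem hm_add (n : ℕ) (P Q : ℤ[X]) (x z : R) : hm n (P + Q) x z = hm n P x z + hm n Q x z := by simp [hm]
theorem hm_sub (n : ℕ) (P Q : ℤ[X]) (x z : R) : hm n (P - Q) x z = hm n P x z - hm n Q x z := by simp [hm]
theorem hm_C (n : ℕ) (c : ℤ) (Q : ℤ[X]) (x z : R) : hm n (C c * Q) x z = c * hm n Q x z := by
  rw [hm, homogenize_C_mul]; simp [hm]
theorem hm_mul (m n : ℕ) (P Q : ℤ[X]) (hP : P.natDegree ≤ m) (hQ : Q.natDegree ≤ n) (x z : R) :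
    hm (m + n) (P * Q) x z = hm m P x z * hm n Q x z := by simp [hm, homogenize_mul P Q hP hQ]
theorem hm_sum (n : ℕ) (P : ℤ[X]) (x z : R) : hm n P x z = ∑ i ∈ Finset.range (n + 1), P.coeff i * x ^ i * z ^ (n - i) := by
  rw [hm, homogenize, map_sum, Finset.Nat.sum_antidiagonal_eq_sum_range_succ_mk]
  refine Finset.sum_congr rfl fun i hi => ?_
  rw [Finsupp.update_eq_add_single (by simp), MvPolynomial.aeval_monomial, Finsupp.prod_add_index' (by simp) (by simp [pow_add])]
  simp [mul_assoc]
theorem hm_one (n : ℕ) (P : ℤ[X]) (hP : P.natDegree ≤ n) (x : R) : hm n P x 1 = aeval x P := by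
  rw [hm, aeval_homogenize_of_eq_one hP _ (by simp)]; simp
theorem hm_fS (x z : R) : hm 6 fS x z = (x ^ 3 + x ^ 2 * z - 2 * x * z ^ 2 - z ^ 3) ^ 2 + 4 * (z * (x ^ 2 + x * z)) ^ 2 := by
  have h : fS = C 1 + C 4 * X + C 6 * X ^ 2 + C 2 * X ^ 3 + C 1 * X ^ 4 + C 2 * X ^ 5 + C 1 * X ^ 6 := by
    rw [fS]; simp only [map_ofNat, map_one]; ring
  rw [hm_sum, h]
  simp only [Finset.sum_range_succ, coeff_add, coeff_C_mul, coeff_X_pow, coeff_C, coeff_X]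
  norm_num
  ring
theorem hm_cast (n : ℕ) (P : ℤ[X]) (x z : ℤ) : hm n P (x : R) (z : R) = ((hm n P x z : ℤ) : R) := by
  simp [hm_sum]
end hm

theorem fhat_pos (x z : ℝ) (h : x ≠ 0 ∨ z ≠ 0) : 0 < hm 6 fS x z := by
  rw [hm_fS]
  by_contra hc
  have h1 : x ^ 3 + x ^ 2 * z - 2 * x * z ^ 2 - z ^ 3 = 0 := by nlinarith [sq_nonneg (x ^ 3 + x ^ 2 * z - 2 * x * z ^ 2 - z ^ 3), sq_nonneg (z * (x ^ 2 + x * z))]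
  have h2 : z * (x * (x + z)) = 0 := by nlinarith [sq_nonneg (x ^ 3 + x ^ 2 * z - 2 * x * z ^ 2 - z ^ 3), sq_nonneg (z * (x ^ 2 + x * z))]
  rcases mul_eq_zero.1 h2 with h2 | h2
  · subst h2; simp_all
  rcases mul_eq_zero.1 h2 with h2 | h2
  · subst h2; simp_all
  · have : x = -z := by linarith
    subst this
    have : z ^ 3 = 0 := by linarith
    simp_all

theorem hm_ids {q M H t m : ℤ[X]} {d k ρ : ℤ} (hq : q.natDegree ≤ 2) (hM : M.natDegree ≤ 3) (hH : H.natDegree ≤ 4)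
    (ht : t.natDegree ≤ 2) (hm' : m.natDegree ≤ 3)
    (e : C (d ^ 2) * fS = M ^ 2 + q * H) (e2 : q * t ^ 2 - C ρ * m ^ 2 = C k * fS) {R : Type*} [CommRing R] (x z : R) :
    d ^ 2 * hm 6 fS x z = hm 3 M x z ^ 2 + hm 2 q x z * hm 4 H x z ∧
    hm 2 q x z * hm 2 t x z ^ 2 - ρ * hm 3 m x z ^ 2 = k * hm 6 fS x z := by
  have a1 := congrArg (fun P => hm 6 P x z) e
  have a2 := congrArg (fun P => hm 6 P x z) e2
  simp only [hm_add, hm_sub, hm_C] at a1 a2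
  simp only [pow_two, ← mul_assoc] at a1 a2
  rw [show 6 = 3 + 3 by rfl, hm_mul 3 3 _ _ hM hM, show 3 + 3 = 2 + 4 by rfl, hm_mul 2 4 _ _ hq hH] at a1
  rw [show 6 = (2 + 2) + 2 by rfl, hm_mul (2 + 2) 2 _ _ (natDegree_mul_le.trans (add_le_add hq ht)) ht, hm_mul 2 2 _ _ hq ht,
     show 2 + 2 + 2 = 3 + 3 by rfl, hm_mul 3 3 _ _ hm' hm'] at a2
  push_cast at a1 a2
  exact ⟨by linear_combination a1, by linear_combination a2⟩

theorem sq_iso {q M H t m : ℤ[X]} {d k ρ : ℤ} (hq : q.natDegree ≤ 2) (hM : M.natDegree ≤ 3) (hH : H.natDegree ≤ 4) (hd : d ≠ 0)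
    (ht : t.natDegree ≤ 2) (hm' : m.natDegree ≤ 3)
    (e : C (d ^ 2) * fS = M ^ 2 + q * H) (e2 : q * t ^ 2 - C ρ * m ^ 2 = C k * fS) (hρ : ρ = 1 ∨ ρ = -1) (x z : ℤ) (hxz : x ≠ 0 ∨ z ≠ 0)
    (h0 : hm 2 q x z = 0) : ∃ κ, -(k * ρ) = κ ^ 2 := by
  obtain ⟨a1, a2⟩ := hm_ids hq hM hH ht hm' e e2 x z
  rw [h0] at a1 a2
  have hp : hm 6 fS x z ≠ 0 := by
    have := fhat_pos x z (by exact_mod_cast hxz)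
    rw [hm_cast] at this
    intro h; simp [h] at this
  have hρ2 : ρ ^ 2 = 1 := by rcases hρ with rfl | rfl <;> rfl
  have hM0 : hm 3 M x z ≠ 0 := by
    intro h
    rw [h] at a1
    have : d ^ 2 * hm 6 fS x z ≠ 0 := mul_ne_zero (pow_ne_zero _ hd) hp
    apply this; push_cast at a1; linear_combination a1
  have key : -(k * ρ) * hm 3 M x z ^ 2 = (d * hm 3 m x z) ^ 2 := by
    push_cast at a1 a2
    linear_combination (k * ρ) * a1 + (d ^ 2 * ρ) * a2 + (d ^ 2 * hm 3 m x z ^ 2) * hρ2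
  have : hm 3 M x z ∣ d * hm 3 m x z := by
    rw [← Int.pow_dvd_pow_iff (n := 2) (by norm_num)]
    exact ⟨-(k * ρ), by rw [← key]; ring⟩
  obtain ⟨κ, hκ⟩ := this
  refine ⟨κ, ?_⟩
  rw [hκ] at key
  have h2 := pow_ne_zero 2 hM0
  apply mul_right_cancel₀ h2
  rw [key]; ring


theorem fS_aeval_ne {q : ℤ[X]} (hq : q.natDegree ≤ 2) (hq0 : q ≠ 0) (α : ℂ) (h : aeval α q = 0) : aeval α fS ≠ 0 := by
  intro h0
  have h1 : minpoly ℚ α = fQ := by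
    refine (minpoly.eq_of_irreducible_of_monic fQ_irr ?_ fQ_monic).symm
    rw [show fQ = fS.map (algebraMap ℤ ℚ) from rfl, aeval_map_algebraMap, h0]
  have h3 : q.map (algebraMap ℤ ℚ) ≠ 0 := by rwa [Ne, Polynomial.map_eq_zero_iff (algebraMap ℤ ℚ).injective_int]
  have h2 := natDegree_le_of_dvd (minpoly.dvd ℚ α (p := q.map (algebraMap ℤ ℚ)) (by rw [aeval_map_algebraMap, h])) h3
  rw [h1, fQ_deg] at h2
  have := natDegree_map_le (f := algebraMap ℤ ℚ) (p := q)
  omega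

theorem hm2 {R : Type*} [CommRing R] (q : ℤ[X]) (x z : R) : hm 2 q x z = q.coeff 0 * z ^ 2 + q.coeff 1 * x * z + q.coeff 2 * x ^ 2 := by
  rw [hm_sum]; simp [Finset.sum_range_succ]
theorem hm3 {R : Type*} [CommRing R] (q : ℤ[X]) (x z : R) : hm 3 q x z = q.coeff 0 * z ^ 3 + q.coeff 1 * x * z ^ 2 + q.coeff 2 * x ^ 2 * z
    + q.coeff 3 * x ^ 3 := by
  rw [hm_sum]; simp [Finset.sum_range_succ]

theorem int_sq_of_rat {K : ℤ} {r : ℚ} (h : (K : ℂ) = (r : ℂ) ^ 2) : ∃ κ : ℤ, K = κ ^ 2 := by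
  have h1 : (K : ℚ) = r ^ 2 := by exact_mod_cast h
  have h2 : IsSquare (K : ℚ) := ⟨r, by rw [h1]; ring⟩
  rw [Rat.isSquare_intCast_iff] at h2
  obtain ⟨κ, h⟩ := h2
  exact ⟨κ, by rw [h]; ring⟩

theorem kappa_rat {q M m : ℤ[X]} {d K : ℤ} (hq2 : q.coeff 2 ≠ 0) (x1 x2 κ : ℂ) (hx : x1 ≠ x2) (h1 : hm 2 q x1 1 = 0) (h2 : hm 2 q x2 1 = 0)
    (hM : hm 3 M x1 1 ≠ 0) (e1 : d * hm 3 m x1 1 = κ * hm 3 M x1 1) (e2 : d * hm 3 m x2 1 = κ * hm 3 M x2 1) (hκ : (K : ℂ) = κ ^ 2) :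
    ∃ κ : ℤ, K = κ ^ 2 := by
  rw [hm2] at h1 h2
  simp only [hm3] at hM e1 e2
  have hc : (q.coeff 2 : ℂ) ≠ 0 := by exact_mod_cast hq2
  have hs : x1 + x2 = ((-q.coeff 1 / q.coeff 2 : ℚ) : ℂ) := by
    have : (x1 - x2) * (q.coeff 2 * (x1 + x2) + q.coeff 1) = 0 := by linear_combination h1 - h2
    rcases mul_eq_zero.1 this with h | h
    · exact absurd (sub_eq_zero.1 h) hx
    · push_cast; field_simp; linear_combination h
  generalize (-q.coeff 1 / q.coeff 2 : ℚ) = σ at hs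
  have hp : x1 * x2 = ((-(q.coeff 1 / q.coeff 2 * 0 + 0) + (q.coeff 0 / q.coeff 2) : ℚ) : ℂ) := by
    have : (x1 - x2) * (q.coeff 2 * (x1 * x2) - q.coeff 0) = 0 := by linear_combination x2 * h1 - x1 * h2
    rcases mul_eq_zero.1 this with h | h
    · exact absurd (sub_eq_zero.1 h) hx
    · push_cast; field_simp; linear_combination h
  generalize (-(q.coeff 1 / q.coeff 2 * 0 + 0) + (q.coeff 0 / q.coeff 2) : ℚ) = π at hp
  have hx' := sub_ne_zero.2 hx
  let S : ℤ[X] → ℚ := fun P => 2 * P.coeff 0 + P.coeff 1 * σ + P.coeff 2 * (σ ^ 2 - 2 * π) + P.coeff 3 * (σ ^ 3 - 3 * σ * π)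
  let T : ℤ[X] → ℚ := fun P => P.coeff 1 + P.coeff 2 * σ + P.coeff 3 * (σ ^ 2 - π)
  have hS : (d : ℂ) * S m = κ * S M := by
    simp only [S]; push_cast; rw [← hs, ← hp]; linear_combination e1 + e2
  have hT : (d : ℂ) * T m = κ * T M := by
    simp only [T]; push_cast; rw [← hs, ← hp]
    apply mul_left_cancel₀ hx'
    linear_combination e1 - e2
  by_cases s0 : S M = 0
  · by_cases t0 : T M = 0
    · exfalso; apply hM
      have s0' : (S M : ℂ) = 0 := by simp [s0]
      have t0' : (T M : ℂ) = 0 := by simp [t0]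
      simp only [S, T] at s0' t0'
      push_cast at s0' t0'
      rw [← hs, ← hp] at s0' t0'
      linear_combination (s0' + (x1 - x2) * t0') / 2
    · have t0' : (T M : ℂ) ≠ 0 := by exact_mod_cast t0
      refine int_sq_of_rat (r := d * T m / T M) ?_
      rw [hκ]; push_cast; rw [hT]; field_simp
  · have s0' : (S M : ℂ) ≠ 0 := by exact_mod_cast s0
    refine int_sq_of_rat (r := d * S m / S M) ?_
    rw [hκ]; push_cast; rw [hS]; field_simp

theorem hm_ofReal (n : ℕ) (P : ℤ[X]) (x z : ℝ) : hm n P (x : ℂ) (z : ℂ) = ((hm n P x z : ℝ) : ℂ) := by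
  simp [hm_sum]

/-- core of real case -/
theorem real_bad {a x1 x2 η ρ k : ℝ} (hη : η = 1 ∨ η = -1) (hx : x1 ≠ x2) (hρa : ρ * (η * a) < 0) (hk : 0 < -(k * ρ)) (q t m : ℤ[X])
    (hq : ∀ x z : ℝ, hm 2 q x z = a * (x - x1 * z) * (x - x2 * z))
    (hid : ∀ x z : ℝ, hm 2 q x z * hm 2 t x z ^ 2 - ρ * hm 3 m x z ^ 2 = k * hm 6 fS x z)
    (hneg : hm 3 m x1 1 * (η * hm 3 m x2 1) < 0) : False := by
  let F : ℝ → ℝ := fun s => hm 3 m ((1 - s) * x1 + s * (η * x2)) ((1 - s) + s * η)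
  have hη3 : η ^ 3 = η := by rcases hη with rfl | rfl <;> norm_num
  have hη2 : η ^ 2 = 1 := by rcases hη with rfl | rfl <;> norm_num
  have F0 : F 0 = hm 3 m x1 1 := by simp [F]
  have F1 : F 1 = η * hm 3 m x2 1 := by
    simp only [F, hm3]; linear_combination (m.coeff 0 + m.coeff 1 * x2 + m.coeff 2 * x2 ^ 2 + m.coeff 3 * x2 ^ 3) * hη3
  have hF : Continuous F := by simp only [F, hm3]; fun_prop
  obtain ⟨s, hs, hs0⟩ : ∃ s ∈ Set.Ioo (0 : ℝ) 1, F s = 0 := by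
    rcases mul_neg_iff.1 hneg with h | h
    · exact intermediate_value_Ioo' zero_le_one hF.continuousOn ⟨by rw [F1]; exact h.2, by rw [F0]; exact h.1⟩
    · exact intermediate_value_Ioo zero_le_one hF.continuousOn ⟨by rw [F0]; exact h.1, by rw [F1]; exact h.2⟩
  have h1 := hid ((1 - s) * x1 + s * (η * x2)) ((1 - s) + s * η)
  have h2 : hm 3 m ((1 - s) * x1 + s * (η * x2)) ((1 - s) + s * η) = 0 := hs0
  have h3 := fhat_pos ((1 - s) * x1 + s * (η * x2)) ((1 - s) + s * η) (by
    by_contra hc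
    push Not at hc
    have : (1 - s) * (x1 - x2) = 0 := by linear_combination hc.1 - x2 * hc.2
    rcases mul_eq_zero.1 this with h | h
    · linarith [hs.2]
    · exact hx (sub_eq_zero.1 h))
  rw [h2, hq] at h1
  generalize hm (R := ℝ) 2 t _ _ = T at h1
  generalize hm (R := ℝ) 6 fS _ _ = f at h1 h3
  have h4 : (-(k * ρ)) * f = (ρ * (η * a)) * (s * (1 - s) * ((x1 - x2) * T) ^ 2) := by
    linear_combination ρ * h1
  have h5 : 0 ≤ s * (1 - s) * ((x1 - x2) * T) ^ 2 := mul_nonneg (mul_nonneg hs.1.le (by linarith [hs.2])) (sq_nonneg _)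
  have h6 : 0 < (-(k * ρ)) * f := mul_pos hk h3
  nlinarith

theorem sq_aniso {q M H : ℤ[X]} {d : ℤ} (hq : q.natDegree ≤ 2) (hM : M.natDegree ≤ 3) (hH : H.natDegree ≤ 4) (hd : d ≠ 0)
    (e : C (d ^ 2) * fS = M ^ 2 + q * H) (han : ∀ x z : ℤ, hm 2 q x z = 0 → x = 0 ∧ z = 0) :
    ∃ ρ : ℤ, (ρ = 1 ∨ ρ = -1) ∧ ∀ (t m : ℤ[X]) (k : ℤ), t.natDegree ≤ 2 → m.natDegree ≤ 3 → q * t ^ 2 - C ρ * m ^ 2 = C k * fS →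
      ∃ κ, -(k * ρ) = κ ^ 2 := by
  have hq2 : q.coeff 2 ≠ 0 := by
    intro h
    have := han 1 0 (by rw [hm2, h]; simp)
    simp at this
  have hq0 : q ≠ 0 := by rintro rfl; simp at hq2
  have hMne : ∀ α : ℂ, hm 2 q α 1 = 0 → hm 3 M α 1 ≠ 0 := by
    intro α hα h0
    have a1 := (hm_ids (t := 0) (m := 0) (k := 0) (ρ := 0) hq hM hH (by simp) (by simp) e (by simp) α 1).1
    rw [hα, h0, hm_one 6 _ fS_natDegree.le] at a1
    rw [hm_one 2 _ hq] at hα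
    have := fS_aeval_ne hq hq0 α hα
    simp [this, hd] at a1
  have hids : ∀ (ρ : ℤ) (t m : ℤ[X]) (k : ℤ), (ρ = 1 ∨ ρ = -1) → t.natDegree ≤ 2 → m.natDegree ≤ 3 → q * t ^ 2 - C ρ * m ^ 2 = C k * fS →
      ∀ α : ℂ, hm 2 q α 1 = 0 → (d * hm 3 m α 1) ^ 2 = ((-(k * ρ) : ℤ) : ℂ) * hm 3 M α 1 ^ 2 := by
    intro ρ t m k hρ ht hm' e2 α hα
    obtain ⟨a1, a2⟩ := hm_ids hq hM hH ht hm' e e2 α 1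
    rw [hα] at a1 a2
    have hρ2 : (ρ : ℂ) ^ 2 = 1 := by rcases hρ with rfl | rfl <;> norm_num
    push_cast
    linear_combination -((k * ρ) * a1 + (d ^ 2 * ρ) * a2 + (d ^ 2 * hm 3 m α 1 ^ 2) * hρ2)
  have hD0 : q.coeff 1 ^ 2 - 4 * q.coeff 2 * q.coeff 0 ≠ 0 := by
    intro h
    have := han (-q.coeff 1) (2 * q.coeff 2) (by rw [hm2]; push_cast; linear_combination (-q.coeff 2) * h)
    apply hq2; omega
  rcases lt_or_gt_of_ne hD0 with hD | hD
  · -- negative discriminant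
    obtain ⟨ρ, hρ, hρa⟩ : ∃ ρ : ℤ, (ρ = 1 ∨ ρ = -1) ∧ ρ * q.coeff 2 < 0 := by
      rcases lt_or_gt_of_ne hq2 with h | h
      · exact ⟨1, Or.inl rfl, by omega⟩
      · exact ⟨-1, Or.inr rfl, by omega⟩
    refine ⟨ρ, hρ, fun t m k ht hm' e2 => ?_⟩
    have hK : 0 ≤ -(k * ρ) := by
      have a2 := (hm_ids hq hM hH ht hm' e e2 (0 : ℤ) 1).2
      rw [hm_fS, hm2 q] at a2
      have h4 : ρ * q.coeff 0 ≤ 0 := by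
        by_contra hc
        push Not at hc
        have h6 : (ρ * q.coeff 0) * (ρ * q.coeff 2) < 0 := mul_neg_of_pos_of_neg hc hρa
        have h7 : ρ * ρ = 1 := by rcases hρ with rfl | rfl <;> rfl
        have h8 : q.coeff 0 * q.coeff 2 < 0 := by
          calc q.coeff 0 * q.coeff 2 = (ρ * q.coeff 0) * (ρ * q.coeff 2) := by linear_combination (-q.coeff 0 * q.coeff 2) * h7
            _ < 0 := h6
        nlinarith [sq_nonneg (q.coeff 1)]
      have h7 : ρ * ρ = 1 := by rcases hρ with rfl | rfl <;> rfl
      have h9 : -(k * ρ) = -((ρ * q.coeff 0) * hm 2 t (0 : ℤ) 1 ^ 2) + hm 3 m (0 : ℤ) 1 ^ 2 := by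
        push_cast at a2
        linear_combination ρ * a2 + hm 3 m (0 : ℤ) 1 ^ 2 * h7
      rw [h9]
      nlinarith [sq_nonneg (hm 3 m (0 : ℤ) 1), mul_nonneg (neg_nonneg.2 h4) (sq_nonneg (hm 2 t (0 : ℤ) 1))]
    obtain ⟨α, hα⟩ : ∃ α : ℂ, hm 2 q α 1 = 0 := by
      have hc : (q.coeff 2 : ℂ) ≠ 0 := by exact_mod_cast hq2
      obtain ⟨s, hs⟩ := IsAlgClosed.exists_pow_nat_eq ((q.coeff 1 : ℂ) ^ 2 - 4 * q.coeff 2 * q.coeff 0) (n := 2) (by norm_num)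
      refine ⟨(-q.coeff 1 + s) / (2 * q.coeff 2), ?_⟩
      rw [hm2]; field_simp; linear_combination hs
    have hconj : ∀ n (P : ℤ[X]), hm n P ((starRingEnd ℂ) α) 1 = (starRingEnd ℂ) (hm n P α 1) := by
      intro n P; simp [hm_sum]
    have hne : α ≠ (starRingEnd ℂ) α := by
      intro h
      obtain ⟨r, hr⟩ := Complex.conj_eq_iff_real.1 h.symm
      rw [hr, ← Complex.ofReal_one, hm_ofReal, Complex.ofReal_eq_zero, hm2] at hα
      have hD' : (q.coeff 1 : ℝ) ^ 2 - 4 * q.coeff 2 * q.coeff 0 < 0 := by exact_mod_cast hD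
      have : (2 * q.coeff 2 * r + q.coeff 1) ^ 2 = (q.coeff 1 : ℝ) ^ 2 - 4 * q.coeff 2 * q.coeff 0 := by
        linear_combination (4 * q.coeff 2) * hα
      nlinarith [sq_nonneg (2 * q.coeff 2 * r + q.coeff 1)]
    have h1 := hids ρ t m k hρ ht hm' e2 α hα
    generalize -(k * ρ) = K at hK h1 ⊢
    have hK' : (K : ℂ) = ((Real.sqrt K : ℝ) : ℂ) ^ 2 := by
      norm_cast
      rw [Real.sq_sqrt (by exact_mod_cast hK)]
    generalize Real.sqrt K = κ at hK'
    obtain ⟨κ, hK', h2⟩ : ∃ κ : ℝ, (K : ℂ) = (κ : ℂ) ^ 2 ∧ d * hm 3 m α 1 = κ * hm 3 M α 1 := by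
      rw [hK', ← mul_pow] at h1
      rcases sq_eq_sq_iff_eq_or_eq_neg.1 h1 with h | h
      · exact ⟨κ, hK', h⟩
      · exact ⟨-κ, by rw [hK']; push_cast; ring, by rw [h]; push_cast; ring⟩
    refine kappa_rat hq2 α _ κ hne hα (by rw [hconj, hα, map_zero]) (hMne α hα) h2 ?_ hK'
    have := congrArg (starRingEnd ℂ) h2
    simpa [hconj] using this
  · -- positive discriminant
    have hc : (q.coeff 2 : ℝ) ≠ 0 := by exact_mod_cast hq2
    have hD' : 0 < (q.coeff 1 : ℝ) ^ 2 - 4 * q.coeff 2 * q.coeff 0 := by exact_mod_cast hD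
    obtain ⟨x1, x2, hx, hfac⟩ : ∃ x1 x2 : ℝ, x1 ≠ x2 ∧ ∀ x z : ℝ, hm 2 q x z = q.coeff 2 * (x - x1 * z) * (x - x2 * z) := by
      have hs := Real.sq_sqrt hD'.le
      have hs0 := Real.sqrt_pos.2 hD'
      generalize Real.sqrt _ = s at hs hs0
      refine ⟨(-q.coeff 1 + s) / (2 * q.coeff 2), (-q.coeff 1 - s) / (2 * q.coeff 2), ?_, ?_⟩
      · intro h
        field_simp at h
        linarith
      · intro x z
        rw [hm2]; field_simp; linear_combination (z ^ 2) * hs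
    have r1 : hm 2 q x1 1 = 0 := by rw [hfac]; ring
    have r2 : hm 2 q x2 1 = 0 := by rw [hfac]; ring
    have c1 : hm 2 q (x1 : ℂ) 1 = 0 := by rw [← Complex.ofReal_one, hm_ofReal, r1]; simp
    have c2 : hm 2 q (x2 : ℂ) 1 = 0 := by rw [← Complex.ofReal_one, hm_ofReal, r2]; simp
    have m1 : hm 3 M x1 1 ≠ 0 := by
      have := hMne x1 c1
      rw [← Complex.ofReal_one, hm_ofReal] at this
      exact_mod_cast this
    have m2 : hm 3 M x2 1 ≠ 0 := by
      have := hMne x2 c2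
      rw [← Complex.ofReal_one, hm_ofReal] at this
      exact_mod_cast this
    obtain ⟨η, hη, hη0⟩ : ∃ η : ℤ, (η = 1 ∨ η = -1) ∧ 0 < (η : ℝ) * (hm 3 M x1 1 * hm 3 M x2 1) := by
      rcases lt_or_gt_of_ne (mul_ne_zero m1 m2) with h | h
      · exact ⟨-1, Or.inr rfl, by push_cast; linarith⟩
      · exact ⟨1, Or.inl rfl, by push_cast; linarith⟩
    obtain ⟨ρ, hρ, hρa⟩ : ∃ ρ : ℤ, (ρ = 1 ∨ ρ = -1) ∧ ρ * (η * q.coeff 2) < 0 := by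
      have : η * q.coeff 2 ≠ 0 := mul_ne_zero (by rcases hη with rfl | rfl <;> norm_num) hq2
      rcases lt_or_gt_of_ne this with h | h
      · exact ⟨1, Or.inl rfl, by omega⟩
      · exact ⟨-1, Or.inr rfl, by omega⟩
    refine ⟨ρ, hρ, fun t m k ht hm' e2 => ?_⟩
    have h1 := hids ρ t m k hρ ht hm' e2 x1 c1
    have h2 := hids ρ t m k hρ ht hm' e2 x2 c2
    rw [← Complex.ofReal_one, hm_ofReal, hm_ofReal] at h1 h2
    have h1' : (d * hm 3 m x1 1) ^ 2 = ((-(k * ρ) : ℤ) : ℝ) * hm 3 M x1 1 ^ 2 := by exact_mod_cast h1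
    have h2' : (d * hm 3 m x2 1) ^ 2 = ((-(k * ρ) : ℤ) : ℝ) * hm 3 M x2 1 ^ 2 := by exact_mod_cast h2
    clear h1 h2
    have hK : 0 ≤ ((-(k * ρ) : ℤ) : ℝ) := by
      have h3 : 0 < hm 3 M x1 1 ^ 2 := by positivity
      by_contra hc
      push Not at hc
      nlinarith [sq_nonneg (d * hm 3 m x1 1), mul_neg_of_neg_of_pos hc h3]
    have hK' := (Real.sq_sqrt hK).symm
    generalize Real.sqrt _ = κ at hK'
    have hKC : ((-(k * ρ) : ℤ) : ℂ) = (κ : ℂ) ^ 2 := by exact_mod_cast hK'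
    rw [hK', ← mul_pow] at h1' h2'
    have fin : ∀ κ : ℝ, ((-(k * ρ) : ℤ) : ℂ) = (κ : ℂ) ^ 2 → d * hm 3 m x1 1 = κ * hm 3 M x1 1 → d * hm 3 m x2 1 = κ * hm 3 M x2 1 →
        ∃ κ, -(k * ρ) = κ ^ 2 := by
      intro κ hκ g1 g2
      refine kappa_rat (d := d) (m := m) hq2 x1 x2 κ (by exact_mod_cast hx) c1 c2 (hMne _ c1) ?_ ?_ hκ
      · rw [← Complex.ofReal_one, hm_ofReal, hm_ofReal]; exact_mod_cast g1
      · rw [← Complex.ofReal_one, hm_ofReal, hm_ofReal]; exact_mod_cast g2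
    have bad : (d * hm 3 m x1 1) * (d * hm 3 m x2 1) = -(κ ^ 2 * (hm 3 M x1 1 * hm 3 M x2 1)) → κ ≠ 0 → False := by
      intro hb hκ0
      refine real_bad (a := q.coeff 2) (x1 := x1) (x2 := x2) (η := η) (ρ := ρ) (k := k) (by exact_mod_cast hη) hx
        (by exact_mod_cast hρa) ?_ q t m hfac (fun x z => ?_) ?_
      · have : 0 < κ ^ 2 := by positivity
        rw [← hK'] at this
        exact_mod_cast this
      · exact (hm_ids hq hM hH ht hm' e e2 x z).2
      · have h5 : 0 < κ ^ 2 := by positivity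
        have h6 := mul_pos h5 hη0
        have h7 : (d : ℝ) ^ 2 * (hm 3 m x1 1 * (η * hm 3 m x2 1)) < 0 := by
          have : (d : ℝ) ^ 2 * (hm 3 m x1 1 * (η * hm 3 m x2 1)) = - (κ ^ 2 * (η * (hm 3 M x1 1 * hm 3 M x2 1))) := by
            linear_combination η * hb
          linarith
        have h8 : 0 < (d : ℝ) ^ 2 := by
          have : (d : ℝ) ≠ 0 := by exact_mod_cast hd
          positivity
        by_contra hc
        push Not at hc
        linarith [mul_nonneg h8.le hc]
    by_cases hκ0 : κ = 0
    · refine fin κ hKC ?_ ?_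
      · rw [hκ0] at h1' ⊢; simpa using h1'
      · rw [hκ0] at h2' ⊢; simpa using h2'
    rcases sq_eq_sq_iff_eq_or_eq_neg.1 h1' with g1 | g1 <;> rcases sq_eq_sq_iff_eq_or_eq_neg.1 h2' with g2 | g2
    · exact fin κ hKC g1 g2
    · exact (bad (by rw [g1, g2]; ring) hκ0).elim
    · exact (bad (by rw [g1, g2]; ring) hκ0).elim
    · exact fin (-κ) (by rw [hKC]; push_cast; ring) (by rw [g1]; ring) (by rw [g2]; ring)


noncomputable def GS : ℤ[X] := X ^ 3 + X ^ 2 - 2 * X - 1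
noncomputable def BS : ℤ[X] := X ^ 2 + X
noncomputable def NN (u : ℤ[X]) (w : ℤ) : ℤ[X] := u ^ 2 - C w * GS * u - C (w ^ 2) * BS ^ 2

noncomputable abbrev r2 (P : ℤ[X]) : (ZMod 2)[X] := P.map (Int.castRingHom (ZMod 2))

theorem GS_deg : GS.natDegree ≤ 3 := by unfold GS; compute_degree
theorem fS_GB : fS = GS ^ 2 + 4 * BS ^ 2 := by unfold fS GS BS; ring

noncomputable def G2 : (ZMod 2)[X] := X ^ 3 + X ^ 2 + 1
noncomputable def B2 : (ZMod 2)[X] := X ^ 2 + X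
theorem z2 : (2 : (ZMod 2)[X]) = 0 := by
  have : (2 : ZMod 2) = 0 := rfl
  rw [← map_ofNat C, this, C_0]
theorem r2_GS : r2 GS = G2 := by
  simp only [r2, GS, G2, Polynomial.map_sub, Polynomial.map_add, Polynomial.map_mul, Polynomial.map_pow, map_X, Polynomial.map_ofNat, Polynomial.map_one]
  linear_combination (-X - 1) * z2
theorem r2_BS : r2 BS = B2 := by simp [r2, BS, B2]
theorem r2_deg {P : ℤ[X]} {n : ℕ} (h : P.natDegree ≤ n) : (r2 P).natDegree ≤ n := natDegree_map_le.trans h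
theorem r2_zero_iff {P : ℤ[X]} : r2 P = 0 ↔ C 2 ∣ P := by
  constructor
  · intro h; exact_mod_cast C_dvd_of_map (p := 2) h
  · rintro ⟨Q, rfl⟩
    have : (2 : ZMod 2) = 0 := rfl
    simp [r2, this, z2]
theorem r2_even {w : ℤ} (h : Even w) : (Int.castRingHom (ZMod 2)) w = 0 := by
  simpa using (ZMod.intCast_eq_zero_iff_even).2 h
theorem r2_odd {w : ℤ} (h : Odd w) : (Int.castRingHom (ZMod 2)) w = 1 := by
  simpa using (ZMod.intCast_eq_one_iff_odd).2 h

theorem deg2_formR {R : Type*} [CommRing R] {q : R[X]} (hq : q.natDegree ≤ 2) : q = C (q.coeff 0) + C (q.coeff 1) * X + C (q.coeff 2) * X ^ 2 := by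
  conv_lhs => rw [degn_form hq]
  simp [Finset.sum_range_succ]

theorem dL1 : ∀ a b c d : ZMod 2, ¬ (a ^ 2 + a = 0 ∧ b = 0 ∧ a + c + b ^ 2 + 1 = 0 ∧ a + b + d = 0 ∧ b + c + c ^ 2 + 1 = 0 ∧ c + d = 0 ∧ d + d ^ 2 = 0) := by
  decide +kernel
theorem L1 {u : (ZMod 2)[X]} (hu : u.natDegree ≤ 3) : u ^ 2 + G2 * u + B2 ^ 2 ≠ 0 := by
  intro h
  rw [deg3_form hu, G2, B2] at h
  generalize u.coeff 0 = a, u.coeff 1 = b, u.coeff 2 = c, u.coeff 3 = d at h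
  have := P6_inj (a0 := a ^ 2 + a) (a1 := b) (a2 := a + c + b ^ 2 + 1) (a3 := a + b + d) (a4 := b + c + c ^ 2 + 1) (a5 := c + d) (a6 := d + d ^ 2)
    (b0 := 0) (b1 := 0) (b2 := 0) (b3 := 0) (b4 := 0) (b5 := 0) (b6 := 0) (by
      simp only [map_add, map_pow, map_one, map_zero]
      linear_combination h - (X ^ 3 + C a * C b * X + C a * C c * X ^ 2 + C a * C d * X ^ 3 + C b * C c * X ^ 3 + C b * C d * X ^ 4 + C c * C d * X ^ 5) * z2)
  exact dL1 a b c d this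

theorem L2 {q t u : (ZMod 2)[X]} (hq : q.natDegree ≤ 2) (ht : t.natDegree ≤ 2) (hu : u.natDegree ≤ 3) (h1 : q.coeff 1 = 1) (h : q * t ^ 2 = u ^ 2) :
    t = 0 := by
  rw [deg3_form hu, deg2_formR hq, deg2_formR ht, h1] at h
  rw [deg2_formR ht]
  generalize u.coeff 0 = u0, u.coeff 1 = u1, u.coeff 2 = u2, u.coeff 3 = u3, t.coeff 0 = t0, t.coeff 1 = t1, t.coeff 2 = t2,
    q.coeff 0 = q0, q.coeff 2 = q2 at h
  have := P6_inj (a0 := q0 * t0 ^ 2) (a1 := t0 ^ 2) (a2 := q0 * t1 ^ 2 + q2 * t0 ^ 2) (a3 := t1 ^ 2) (a4 := q0 * t2 ^ 2 + q2 * t1 ^ 2) (a5 := t2 ^ 2) (a6 := q2 * t2 ^ 2)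
    (b0 := u0 ^ 2) (b1 := 0) (b2 := u1 ^ 2) (b3 := 0) (b4 := u2 ^ 2) (b5 := 0) (b6 := u3 ^ 2) (by
      simp only [map_add, map_pow, map_one, map_zero, map_mul]
      simp only [map_one] at h
      linear_combination h + ((C u0 * C u1 * X + C u0 * C u2 * X ^ 2 + C u0 * C u3 * X ^ 3 + C u1 * C u2 * X ^ 3 + C u1 * C u3 * X ^ 4 + C u2 * C u3 * X ^ 5)
        - (C q0 + X + C q2 * X ^ 2) * (C t0 * C t1 * X + C t0 * C t2 * X ^ 2 + C t1 * C t2 * X ^ 3)) * z2)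
  obtain ⟨e0, e1, e2, e3, e4, e5, e6⟩ := this
  have f0 : t0 = 0 := by simpa using e1
  have f1 : t1 = 0 := by simpa using e3
  have f2 : t2 = 0 := by simpa using e5
  simp [f0, f1, f2]

theorem G2_irr : Irreducible G2 := by
  have hd : G2.natDegree = 3 := by unfold G2; compute_degree!
  rw [Polynomial.irreducible_iff_roots_eq_zero_of_degree_le_three (by omega) (by omega)]
  rw [Multiset.eq_zero_iff_forall_notMem]
  intro a ha
  have := isRoot_of_mem_roots ha
  clear ha
  revert this
  simp only [IsRoot, G2, eval_add, eval_pow, eval_X, eval_one]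
  revert a; decide +kernel
theorem G2_prime : Prime G2 := G2_irr.prime
theorem G2_deg : G2.natDegree = 3 := by unfold G2; compute_degree!
theorem G2_ndvd {t : (ZMod 2)[X]} (ht : t.natDegree ≤ 2) (h : G2 ∣ t) : t = 0 := by
  by_contra h0
  have := natDegree_le_of_dvd h h0
  rw [G2_deg] at this; omega


theorem map_NN {u : ℤ[X]} {w : ℤ} : r2 (NN u w) = r2 u ^ 2 - C ((Int.castRingHom (ZMod 2)) w) * G2 * r2 u - C ((Int.castRingHom (ZMod 2)) w) ^ 2 * B2 ^ 2 := by
  rw [← r2_GS, ← r2_BS]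
  simp [r2, NN]

theorem map_NN_even {u : ℤ[X]} {w : ℤ} (hw : Even w) : r2 (NN u w) = r2 u ^ 2 := by
  rw [map_NN, r2_even hw]; simp
theorem map_NN_odd {u : ℤ[X]} {w : ℤ} (hw : Odd w) : r2 (NN u w) = r2 u ^ 2 + G2 * r2 u + B2 ^ 2 := by
  rw [map_NN, r2_odd hw]; simp only [map_one]; linear_combination (-G2 * r2 u - B2 ^ 2) * z2

theorem deg_of_C_mul {a : ℤ} (ha : a ≠ 0) (P : ℤ[X]) : (C a * P).natDegree = P.natDegree := natDegree_C_mul ha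

theorem norm2 (q t : ℤ[X]) (ρ : ℤ) : ∀ (n : ℕ) (e : ℤ) (u : ℤ[X]) (w : ℤ), e.natAbs ≤ n → e ≠ 0 → u.natDegree ≤ 3 → NN u w = C (ρ * e ^ 2) * q * t ^ 2 →
    ∃ (u' : ℤ[X]) (w' n : ℤ), u'.natDegree ≤ 3 ∧ Odd n ∧ NN u' w' = C (ρ * n ^ 2) * q * t ^ 2 := by
  intro n
  induction n with
  | zero => intro e u w h h0; omega
  | succ n ih =>
    intro e u w h h0 hu heq
    rcases Int.even_or_odd e with he | he
    swap
    · exact ⟨u, w, e, hu, he, heq⟩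
    have h2 : r2 (NN u w) = 0 := by
      rw [heq]; simp only [r2, Polynomial.map_mul, map_C]
      rw [r2_even (by simp [he, parity_simps])]; simp
    rcases Int.even_or_odd w with hw | hw
    swap
    · rw [map_NN_odd hw] at h2
      exact (L1 (r2_deg hu) h2).elim
    rw [map_NN_even hw] at h2
    obtain ⟨u', rfl⟩ := r2_zero_iff.1 (pow_eq_zero_iff (two_ne_zero) |>.1 h2)
    obtain ⟨w', rfl⟩ := hw.two_dvd
    obtain ⟨e', rfl⟩ := he.two_dvd
    refine ih e' u' w' (by omega) (by omega) (by rwa [deg_of_C_mul two_ne_zero] at hu) ?_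
    have h4 : (C 4 : ℤ[X]) ≠ 0 := by simp
    apply mul_left_cancel₀ h4
    simp only [NN, map_mul, map_pow, map_ofNat] at heq ⊢
    linear_combination heq

theorem even_of_dvd {q : ℤ[X]} (h : C 2 ∣ q) (i : ℕ) : Even (q.coeff i) := by
  obtain ⟨s, rfl⟩ := h
  rw [coeff_C_mul]; simp

theorem r2_prim {q : ℤ[X]} (h : q.IsPrimitive) : r2 q ≠ 0 := by
  intro h0
  have := h 2 (r2_zero_iff.1 h0)
  rw [Int.isUnit_iff] at this; omega

theorem pre {q U h : ℤ[X]} {W ρ : ℤ} (hq : q.natDegree ≤ 2) (hqp : q.IsPrimitive) (hU : U.natDegree ≤ 3) (hW : W ≠ 0) (hh : h.natDegree ≤ 4)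
    (e : NN U W = q * h) (hρ : ρ = 1 ∨ ρ = -1)
    (hsq : ∀ (t m : ℤ[X]) (k : ℤ), t.natDegree ≤ 2 → m.natDegree ≤ 3 → q * t ^ 2 - C ρ * m ^ 2 = C k * fS → ∃ κ, -(k * ρ) = κ ^ 2) :
    ∃ (t u : ℤ[X]) (w n : ℤ), t.natDegree ≤ 2 ∧ t.IsPrimitive ∧ u.natDegree ≤ 3 ∧ Odd n ∧ NN u w = C (ρ * n ^ 2) * q * t ^ 2 := by
  obtain ⟨t, m, k, ht0, ht, hm', e2⟩ := halve_core (M := C 2 * U - C W * GS) (H := C (-4) * h) (d := W) hq hqp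
    ((natDegree_sub_le _ _).trans (max_le ((natDegree_C_mul_le _ _).trans hU) ((natDegree_C_mul_le _ _).trans GS_deg)))
    ((natDegree_C_mul_le _ _).trans hh) hW (by
      rw [NN] at e
      rw [fS_GB]; simp only [map_neg, map_ofNat, map_pow] at e ⊢; linear_combination -4 * e) ρ hρ
  obtain ⟨κ, hκ⟩ := hsq t m k ht hm' e2
  have hρ2 : ρ ^ 2 = 1 := by rcases hρ with rfl | rfl <;> rfl
  have e3 : NN (m + C κ * GS) (2 * κ) = C (ρ * t.content ^ 2) * q * t.primPart ^ 2 := by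
    have h1 : NN (m + C κ * GS) (2 * κ) = m ^ 2 - C (κ ^ 2) * fS := by
      rw [NN, fS_GB]; simp only [map_mul, map_ofNat, map_pow]; ring
    rw [h1, ← hκ]
    have h2 := congrArg (C : ℤ → ℤ[X]) hρ2
    have h3 := t.eq_C_content_mul_primPart
    have h4 : q * (C t.content * t.primPart) ^ 2 - C ρ * m ^ 2 = C k * fS := by rw [← h3]; exact e2
    simp only [map_neg, map_mul, map_pow, map_one] at h2 ⊢
    linear_combination (-C ρ) * h4 - m ^ 2 * h2
  obtain ⟨u, w, n, hu, hn, e4⟩ := norm2 q t.primPart ρ _ _ _ _ le_rfl (by rwa [Ne, content_eq_zero_iff])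
    ((natDegree_add_le _ _).trans (max_le hm' ((natDegree_C_mul_le _ _).trans GS_deg))) e3
  exact ⟨t.primPart, u, w, n, by rwa [natDegree_primPart], t.isPrimitive_primPart, hu, hn, e4⟩


def Good (q : ℤ[X]) : Prop := q.natDegree ≤ 2 ∧ q.IsPrimitive ∧ ∃ (U : ℤ[X]) (W : ℤ) (h : ℤ[X]), U.natDegree ≤ 3 ∧ W ≠ 0 ∧ h.natDegree ≤ 4 ∧
  NN U W = q * h ∧ (Odd (q.coeff 1) ∨ Odd W)

theorem iso_even {q t u : ℤ[X]} {w c : ℤ} (hq : q.natDegree ≤ 2) (hq1 : Even (q.coeff 1)) (ht : t.natDegree ≤ 2) (htp : t.IsPrimitive)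
    (hc : Odd c) (hw : Even w) (e : NN u w = C c * q * t ^ 2) :
    4 ∣ c * q.coeff 0 - q.coeff 0 ^ 2 ∧ 4 ∣ c * q.coeff 1 - 2 * (q.coeff 0 * q.coeff 2) ∧ 4 ∣ c * q.coeff 2 - q.coeff 2 ^ 2 := by
  have hqf := deg2_form hq
  generalize q.coeff 0 = q0 at *
  generalize q.coeff 1 = q1 at *
  generalize q.coeff 2 = q2 at *
  have par : ∀ x : ℤ, Even (c * x - x ^ 2) := by
    intro x; rcases Int.even_or_odd x with h | h <;> simp [h, hc, parity_simps]
  obtain ⟨j0, hj0⟩ := (par q0).two_dvd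
  obtain ⟨j2, hj2⟩ := (par q2).two_dvd
  obtain ⟨s1, hs1⟩ := hq1.two_dvd
  have hj1 : c * q1 - 2 * (q0 * q2) = 2 * (c * s1 - q0 * q2) := by rw [hs1]; ring
  generalize c * s1 - q0 * q2 = j1 at hj1
  set l : ℤ[X] := C q0 + C q2 * X with hl
  set j : ℤ[X] := C j0 + C j1 * X + C j2 * X ^ 2 with hj
  have hcq : C c * q = l ^ 2 + 2 * j := by
    have a0 := congrArg (C : ℤ → ℤ[X]) hj0
    have a1 := congrArg (C : ℤ → ℤ[X]) hj1
    have a2 := congrArg (C : ℤ → ℤ[X]) hj2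
    simp only [map_sub, map_mul, map_pow, map_ofNat] at a0 a1 a2
    rw [hqf, hl, hj]; linear_combination a0 + a1 * X + a2 * X ^ 2
  have hsq : (r2 u - r2 l * r2 t) ^ 2 = 0 := by
    have h1 := map_NN_even (u := u) hw
    rw [e, hcq] at h1
    simp only [r2, Polynomial.map_mul, Polynomial.map_pow, Polynomial.map_add, Polynomial.map_ofNat] at h1 ⊢
    rw [z2] at h1
    have h2 := z2
    linear_combination -h1 + (Polynomial.map (Int.castRingHom (ZMod 2)) l * Polynomial.map (Int.castRingHom (ZMod 2)) t * (Polynomial.map (Int.castRingHom (ZMod 2)) l * Polynomial.map (Int.castRingHom (ZMod 2)) t - Polynomial.map (Int.castRingHom (ZMod 2)) u)) * h2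
  have hsq' : r2 (u - l * t) = 0 := by
    have := pow_eq_zero_iff (two_ne_zero) |>.1 hsq
    simpa [r2] using this
  obtain ⟨u', hu'⟩ := r2_zero_iff.1 hsq'
  obtain ⟨w', rfl⟩ := hw.two_dvd
  have hu : u = l * t + 2 * u' := by
    rw [map_ofNat] at hu'; linear_combination hu'
  have key : t * (t * j + C w' * GS * l) = C 2 * (l * t * u' + u' ^ 2 - C w' * GS * u' - C (w' ^ 2) * BS ^ 2) := by
    rw [hcq, NN, hu] at e
    have h2 : (2 : ℤ[X]) ≠ 0 := two_ne_zero
    apply mul_left_cancel₀ h2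
    simp only [map_mul, map_pow, map_ofNat] at e ⊢
    linear_combination -e
  have k2 : r2 (t * (t * j + C w' * GS * l)) = 0 := r2_zero_iff.2 ⟨_, key⟩
  have k3 : r2 t * (r2 t * r2 j + C ((Int.castRingHom (ZMod 2)) w') * G2 * r2 l) = 0 := by
    rw [← r2_GS]
    simpa [r2] using k2
  have k4 := (mul_eq_zero.1 k3).resolve_left (r2_prim htp)
  have k5 : G2 ∣ r2 t * r2 j := ⟨-C ((Int.castRingHom (ZMod 2)) w') * r2 l, by linear_combination k4⟩
  have hjd : j.natDegree ≤ 2 := by rw [hj]; compute_degree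
  have k6 : r2 j = 0 := by
    rcases G2_prime.dvd_or_dvd k5 with h | h
    · exact absurd (G2_ndvd (r2_deg ht) h) (r2_prim htp)
    · exact G2_ndvd (r2_deg hjd) h
  have k7 := even_of_dvd (r2_zero_iff.1 k6)
  have f0 := k7 0
  have f1 := k7 1
  have f2 := k7 2
  simp only [hj, coeff_add, coeff_C_mul, coeff_X_pow, coeff_C, coeff_X] at f0 f1 f2
  norm_num at f0 f1 f2
  rw [hj0, hj1, hj2]
  obtain ⟨a, rfl⟩ := f0.two_dvd
  obtain ⟨b, rfl⟩ := f1.two_dvd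
  obtain ⟨d, rfl⟩ := f2.two_dvd
  omega

theorem odd_G {n0 n1 : ℤ} (hn : Odd n0 ∨ Odd n1) : Odd (n0 ^ 3 - n0 ^ 2 * n1 - 2 * n0 * n1 ^ 2 + n1 ^ 3) := by
  rw [← ZMod.intCast_eq_one_iff_odd] at *
  rw [← ZMod.intCast_eq_one_iff_odd] at *
  push_cast
  generalize (n0 : ZMod 2) = a at *
  generalize (n1 : ZMod 2) = b at *
  revert a b; decide +kernel

theorem aniso_num {a0 a1 a2 n0 n1 U0 U1 U2 U3 h0 h1 h2 h3 h4 t0 t1 t2 w W c : ℤ} (hW : Odd W) (hc : Odd c) (hw0 : w ≠ 0) (hw : Even w)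
    (hn : Odd n0 ∨ Odd n1)
    (e0 : a0 * n0 ^ 2 + n0 * w * (2 * U0 + W) + w ^ 2 * h0 = W ^ 2 * c * t0 ^ 2)
    (e1 : a1 * n0 ^ 2 + 2 * a0 * n0 * n1 + w * (n0 * (2 * U1 + 2 * W) + n1 * (2 * U0 + W)) + w ^ 2 * h1 = W ^ 2 * c * (2 * t0 * t1))
    (e2 : a2 * n0 ^ 2 + 2 * a1 * n0 * n1 + a0 * n1 ^ 2 + w * (n0 * (2 * U2 - W) + n1 * (2 * U1 + 2 * W)) + w ^ 2 * h2 = W ^ 2 * c * (2 * t0 * t2 + t1 ^ 2))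
    (e3 : 2 * a2 * n0 * n1 + a1 * n1 ^ 2 + w * (n0 * (2 * U3 - W) + n1 * (2 * U2 - W)) + w ^ 2 * h3 = W ^ 2 * c * (2 * t1 * t2))
    (e4 : a2 * n1 ^ 2 + w * (n1 * (2 * U3 - W)) + w ^ 2 * h4 = W ^ 2 * c * t2 ^ 2) : False := by
  -- valuation of w
  obtain ⟨v, w1, hw1, hwv⟩ : ∃ (v : ℕ) (w1 : ℤ), Odd w1 ∧ w = 2 ^ v * w1 := by
    have hf : FiniteMultiplicity (2 : ℤ) w := Int.finiteMultiplicity_iff.2 ⟨by norm_num, hw0⟩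
    obtain ⟨w1, h1, h2⟩ := hf.exists_eq_pow_mul_and_not_dvd
    exact ⟨_, w1, by rwa [← Int.not_even_iff_odd, even_iff_two_dvd], h1⟩
  have hv : v ≠ 0 := by
    rintro rfl
    rw [pow_zero, one_mul] at hwv
    rw [hwv] at hw; exact (Int.not_even_iff_odd.2 hw1) hw
  set T := t0 * n1 ^ 2 - t1 * n0 * n1 + t2 * n0 ^ 2 with hT
  set h := h0 * n1 ^ 4 - h1 * n0 * n1 ^ 3 + h2 * n0 ^ 2 * n1 ^ 2 - h3 * n0 ^ 3 * n1 + h4 * n0 ^ 4 with hh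
  have E : w ^ 2 * h = W ^ 2 * c * T ^ 2 := by
    rw [hT, hh]
    linear_combination n1 ^ 4 * e0 - n0 * n1 ^ 3 * e1 + n0 ^ 2 * n1 ^ 2 * e2 - n0 ^ 3 * n1 * e3 + n0 ^ 4 * e4
  have hcop : IsCoprime ((2 : ℤ) ^ (2 * v)) (W ^ 2 * c) := by
    apply IsCoprime.pow_left
    have : Odd (W ^ 2 * c) := (hW.pow).mul hc
    obtain ⟨s, hs⟩ := this
    exact ⟨-s, 1, by rw [hs]; ring⟩
  have hTd : (2 : ℤ) ^ v ∣ T := by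
    have : (2 : ℤ) ^ (2 * v) ∣ W ^ 2 * c * T ^ 2 := ⟨w1 ^ 2 * h, by rw [← E, hwv]; ring⟩
    have := hcop.dvd_of_dvd_mul_left this
    rw [mul_comm, pow_mul] at this
    exact (Int.pow_dvd_pow_iff two_ne_zero).1 this
  obtain ⟨T', hT'⟩ := hTd
  obtain ⟨v', rfl⟩ := Nat.exists_eq_succ_of_ne_zero hv
  set Gh := n0 ^ 3 - n0 ^ 2 * n1 - 2 * n0 * n1 ^ 2 + n1 ^ 3 with hGh
  have hGo : Odd Gh := by
    exact odd_G hn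
  have hp : (2 : ℤ) ^ (v' + 1) ≠ 0 := by positivity
  set Uh := -U0 * n1 ^ 3 + U1 * n0 * n1 ^ 2 - U2 * n0 ^ 2 * n1 + U3 * n0 ^ 3 with hUh
  have F1 : ∃ s, n1 * (w1 * (W * Gh)) = 2 * s := by
    refine ⟨n1 * w1 * Uh + 2 ^ v' * w1 ^ 2 * (-h1 * n1 ^ 3 + 2 * h2 * n0 * n1 ^ 2 - 3 * h3 * n0 ^ 2 * n1 + 4 * h4 * n0 ^ 3) - W ^ 2 * c * T' * (- t1 * n1 + 2 * t2 * n0), ?_⟩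
    apply mul_left_cancel₀ hp
    have D : n1 * w * (2 * Uh - W * Gh) + w ^ 2 * (-h1 * n1 ^ 3 + 2 * h2 * n0 * n1 ^ 2 - 3 * h3 * n0 ^ 2 * n1 + 4 * h4 * n0 ^ 3) =
        2 * W ^ 2 * c * T * (- t1 * n1 + 2 * t2 * n0) := by
      rw [hUh, hGh, hT]
      linear_combination (-n1 ^ 3) * e1 + 2 * n0 * n1 ^ 2 * e2 - 3 * n0 ^ 2 * n1 * e3 + 4 * n0 ^ 3 * e4
    rw [hT', hwv] at D
    rw [Nat.succ_eq_add_one] at D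
    linear_combination -D
  have F0 : ∃ s, n0 * (w1 * (W * Gh)) = 2 * s := by
    refine ⟨n0 * w1 * Uh + 2 ^ v' * w1 ^ 2 * (- 4 * h0 * n1 ^ 3 + 3 * h1 * n0 * n1 ^ 2 - 2 * h2 * n0 ^ 2 * n1 + h3 * n0 ^ 3) - W ^ 2 * c * T' * (- 2 * t0 * n1 + t1 * n0), ?_⟩
    apply mul_left_cancel₀ hp
    have D : n0 * w * (2 * Uh - W * Gh) + w ^ 2 * (- 4 * h0 * n1 ^ 3 + 3 * h1 * n0 * n1 ^ 2 - 2 * h2 * n0 ^ 2 * n1 + h3 * n0 ^ 3) =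
        2 * W ^ 2 * c * T * (- 2 * t0 * n1 + t1 * n0) := by
      rw [hUh, hGh, hT]
      linear_combination (-4 * n1 ^ 3) * e0 + 3 * n0 * n1 ^ 2 * e1 - 2 * n0 ^ 2 * n1 * e2 + n0 ^ 3 * e3
    rw [hT', hwv] at D
    rw [Nat.succ_eq_add_one] at D
    linear_combination -D
  have ho : Odd (w1 * (W * Gh)) := hw1.mul (hW.mul hGo)
  rcases hn with hn | hn
  · obtain ⟨s, hs⟩ := F0
    have := hn.mul ho
    rw [hs] at this
    exact (Int.not_even_iff_odd.2 this) (even_two_mul s)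
  · obtain ⟨s, hs⟩ := F1
    have := hn.mul ho
    rw [hs] at this
    exact (Int.not_even_iff_odd.2 this) (even_two_mul s)


theorem aniso_deg {q : ℤ[X]} (hq : q.natDegree ≤ 2) (han : ∀ x z : ℤ, hm 2 q x z = 0 → x = 0 ∧ z = 0) : q.natDegree = 2 := by
  have hq2 : q.coeff 2 ≠ 0 := by
    intro h
    have := han 1 0 (by rw [hm2, h]; simp)
    simp at this
  exact le_antisymm hq (le_natDegree_of_ne_zero hq2)

theorem aniso_prime {q : ℤ[X]} (hq : q.natDegree ≤ 2) (hqp : q.IsPrimitive) (han : ∀ x z : ℤ, hm 2 q x z = 0 → x = 0 ∧ z = 0) : Prime q := by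
  have hd := aniso_deg hq han
  apply Irreducible.prime
  rw [IsPrimitive.Int.irreducible_iff_irreducible_map_cast hqp]
  have hd' : (q.map (Int.castRingHom ℚ)).natDegree = 2 := by
    rw [natDegree_map_eq_of_injective (Int.castRingHom ℚ).injective_int, hd]
  rw [Polynomial.irreducible_iff_roots_eq_zero_of_degree_le_three (by omega) (by omega), Multiset.eq_zero_iff_forall_notMem]
  intro a ha
  have h1 := isRoot_of_mem_roots ha
  rw [IsRoot, eval_map, ← algebraMap_int_eq, ← aeval_def, ← hm_one 2 _ hq, hm2] at h1
  have h2 := han a.num a.den (by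
    have hden : (a.den : ℚ) ≠ 0 := by simp
    have h3 : hm 2 q (a.num : ℚ) ((a.den : ℤ) : ℚ) = 0 := by
      have h4 : (a.num : ℚ) = a * a.den := (Rat.mul_den_eq_num a).symm
      rw [hm2, h4]; push_cast; linear_combination (a.den : ℚ) ^ 2 * h1
    rw [hm_cast] at h3
    exact_mod_cast h3)
  exact a.den_nz (by exact_mod_cast h2.2)

theorem aniso_odd {q U h t u : ℤ[X]} {W w c : ℤ} (hq : q.natDegree ≤ 2) (hqp : q.IsPrimitive) (han : ∀ x z : ℤ, hm 2 q x z = 0 → x = 0 ∧ z = 0)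
    (hU : U.natDegree ≤ 3) (hh : h.natDegree ≤ 4) (hW : Odd W) (e : NN U W = q * h)
    (ht : t.natDegree ≤ 2) (htp : t.IsPrimitive) (hu : u.natDegree ≤ 3) (hc : Odd c) (e2 : NN u w = C c * q * t ^ 2) : Odd w := by
  have hpr := aniso_prime hq hqp han
  have hd := aniso_deg hq han
  have hq0 := hpr.ne_zero
  have ht0 : t ≠ 0 := htp.ne_zero
  have hc0 : c ≠ 0 := by rintro rfl; simp at hc
  have hW0 : W ≠ 0 := by rintro rfl; simp at hW
  -- flip
  obtain ⟨u, hu, e2, n, hn⟩ : ∃ u : ℤ[X], u.natDegree ≤ 3 ∧ NN u w = C c * q * t ^ 2 ∧ q ∣ C W * u - C w * U := by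
    have hprod : q ∣ (C W * u - C w * U) * (C W * u - C w * (C W * GS - U)) := by
      refine ⟨C (W ^ 2) * C c * t ^ 2 - C (w ^ 2) * h, ?_⟩
      simp only [NN, map_pow] at e e2 ⊢
      linear_combination C W ^ 2 * e2 - C w ^ 2 * e
    rcases hpr.dvd_or_dvd hprod with h | h
    · exact ⟨u, hu, e2, h⟩
    · refine ⟨C w * GS - u, (natDegree_sub_le _ _).trans (max_le ((natDegree_C_mul_le _ _).trans GS_deg) hu), ?_, ?_⟩
      · rw [← e2, NN, NN]; simp only [map_pow]; ring
      · rw [← dvd_neg]; convert h using 1; ring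
  have hnd : n.natDegree ≤ 1 := by
    by_cases h0 : n = 0
    · simp [h0]
    have h1 : (q * n).natDegree ≤ 3 := by
      rw [← hn]
      exact (natDegree_sub_le _ _).trans (max_le ((natDegree_C_mul_le _ _).trans hu) ((natDegree_C_mul_le _ _).trans hU))
    rw [natDegree_mul hq0 h0, hd] at h1
    omega
  have Φ : q * n ^ 2 + n * C w * (2 * U - C W * GS) + C w ^ 2 * h = C W ^ 2 * C c * t ^ 2 := by
    apply mul_left_cancel₀ hq0
    simp only [NN, map_pow] at e e2
    linear_combination C W ^ 2 * e2 - C w ^ 2 * e - (C W * u + C w * U + q * n - C w * C W * GS) * hn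
  have hw0 : w ≠ 0 := by
    rintro rfl
    simp only [map_zero] at Φ
    have h1 : q ∣ t := by
      have h2 : q ∣ C W ^ 2 * C c * t ^ 2 := ⟨n ^ 2, by rw [← Φ]; ring⟩
      rw [← map_pow, ← map_mul] at h2
      rcases hpr.dvd_or_dvd h2 with h | h
      · have := natDegree_le_of_dvd h (by simp [hW0, hc0])
        rw [natDegree_C] at this; omega
      · exact hpr.dvd_of_dvd_pow h
    obtain ⟨s, rfl⟩ := h1
    have h3 : q ∣ n := by
      apply hpr.dvd_of_dvd_pow (n := 2)
      refine ⟨C W ^ 2 * C c * s ^ 2, mul_left_cancel₀ hq0 ?_⟩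
      linear_combination Φ
    have h4 : n = 0 := by
      by_contra h0
      have := natDegree_le_of_dvd h3 h0
      omega
    rw [h4] at Φ
    have : C W ^ 2 * C c * (q * s) ^ 2 ≠ 0 := by simp [hW0, hc0, ht0]
    apply this
    rw [← Φ]; ring
  by_contra hwe
  rw [Int.not_odd_iff_even] at hwe
  have hno : ¬ (r2 n = 0) := by
    intro h0
    have h1 := congrArg r2 Φ
    simp only [r2, Polynomial.map_add, Polynomial.map_mul, Polynomial.map_pow, map_C] at h1
    rw [r2_even hwe, r2_odd hW, r2_odd hc] at h1
    rw [r2] at h0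
    rw [h0] at h1
    simp at h1
    exact r2_prim htp (pow_eq_zero_iff two_ne_zero |>.1 h1.symm)
  have hqf := deg2_form hq
  have htf := deg2_form ht
  have hUf := deg3_form hU
  have hnf : n = C (n.coeff 0) + C (n.coeff 1) * X := by
    conv_lhs => rw [degn_form hnd]
    simp [Finset.sum_range_succ]
  have hhf : h = C (h.coeff 0) + C (h.coeff 1) * X + C (h.coeff 2) * X ^ 2 + C (h.coeff 3) * X ^ 3 + C (h.coeff 4) * X ^ 4 := by
    conv_lhs => rw [degn_form hh]
    simp [Finset.sum_range_succ]
  have hn' : Odd (n.coeff 0) ∨ Odd (n.coeff 1) := by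
    by_contra hcon
    rw [not_or, Int.not_odd_iff_even, Int.not_odd_iff_even] at hcon
    apply hno
    rw [hnf]
    simp only [r2, Polynomial.map_add, Polynomial.map_mul, map_C]
    rw [r2_even hcon.1, r2_even hcon.2]; simp
  generalize q.coeff 0 = a0, q.coeff 1 = a1, q.coeff 2 = a2 at hqf
  generalize t.coeff 0 = t0, t.coeff 1 = t1, t.coeff 2 = t2 at htf
  generalize U.coeff 0 = U0, U.coeff 1 = U1, U.coeff 2 = U2, U.coeff 3 = U3 at hUf
  generalize n.coeff 0 = n0, n.coeff 1 = n1 at hnf hn'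
  generalize h.coeff 0 = h0, h.coeff 1 = h1, h.coeff 2 = h2, h.coeff 3 = h3, h.coeff 4 = h4 at hhf
  rw [hqf, htf, hUf, hnf, hhf, GS] at Φ
  have := P6_inj (a0 := a0 * n0 ^ 2 + n0 * w * (2 * U0 + W) + w ^ 2 * h0)
    (a1 := a1 * n0 ^ 2 + 2 * a0 * n0 * n1 + w * (n0 * (2 * U1 + 2 * W) + n1 * (2 * U0 + W)) + w ^ 2 * h1)
    (a2 := a2 * n0 ^ 2 + 2 * a1 * n0 * n1 + a0 * n1 ^ 2 + w * (n0 * (2 * U2 - W) + n1 * (2 * U1 + 2 * W)) + w ^ 2 * h2)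
    (a3 := 2 * a2 * n0 * n1 + a1 * n1 ^ 2 + w * (n0 * (2 * U3 - W) + n1 * (2 * U2 - W)) + w ^ 2 * h3)
    (a4 := a2 * n1 ^ 2 + w * (n1 * (2 * U3 - W)) + w ^ 2 * h4) (a5 := 0) (a6 := 0)
    (b0 := W ^ 2 * c * t0 ^ 2) (b1 := W ^ 2 * c * (2 * t0 * t1)) (b2 := W ^ 2 * c * (2 * t0 * t2 + t1 ^ 2))
    (b3 := W ^ 2 * c * (2 * t1 * t2)) (b4 := W ^ 2 * c * t2 ^ 2) (b5 := 0) (b6 := 0) (by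
      simp only [map_add, map_sub, map_mul, map_pow, map_ofNat, map_zero]
      linear_combination Φ)
  exact aniso_num hW hc hw0 hwe hn' this.1 this.2.1 this.2.2.1 this.2.2.2.1 this.2.2.2.2.1

theorem partC {q : ℤ[X]} (hg : Good q) : ∃ (t u : ℤ[X]) (w c : ℤ), t.natDegree ≤ 2 ∧ t.IsPrimitive ∧ u.natDegree ≤ 3 ∧ Odd w ∧ Odd c ∧
    NN u w = C c * q * t ^ 2 := by
  obtain ⟨hq, hqp, U, W, h, hU, hW, hh, e, hodd⟩ := hg
  have hρo : ∀ {ρ n : ℤ}, (ρ = 1 ∨ ρ = -1) → Odd n → Odd (ρ * n ^ 2) := by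
    intro ρ n hρ hn
    rcases hρ with rfl | rfl
    · simpa using hn.pow
    · simpa using (hn.pow (n := 2)).neg
  have hdeg : (C 2 * U - C W * GS).natDegree ≤ 3 :=
    (natDegree_sub_le _ _).trans (max_le ((natDegree_C_mul_le _ _).trans hU) ((natDegree_C_mul_le _ _).trans GS_deg))
  have hHd : (C (-4) * h).natDegree ≤ 4 := (natDegree_C_mul_le _ _).trans hh
  have e' : C (W ^ 2) * fS = (C 2 * U - C W * GS) ^ 2 + q * (C (-4) * h) := by
    have e := e
    rw [NN] at e
    rw [fS_GB]; simp only [map_neg, map_ofNat, map_pow] at e ⊢; linear_combination -4 * e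
  by_cases h1 : Odd (q.coeff 1)
  · -- middle coefficient odd
    obtain ⟨ρ, hρ, hsq⟩ : ∃ ρ : ℤ, (ρ = 1 ∨ ρ = -1) ∧ ∀ (t m : ℤ[X]) (k : ℤ), t.natDegree ≤ 2 → m.natDegree ≤ 3 →
        q * t ^ 2 - C ρ * m ^ 2 = C k * fS → ∃ κ, -(k * ρ) = κ ^ 2 := by
      by_cases han : ∀ x z : ℤ, hm 2 q x z = 0 → x = 0 ∧ z = 0
      · exact sq_aniso hq hdeg hHd hW e' han
      · push Not at han
        obtain ⟨x, z, h0, hxz⟩ := han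
        refine ⟨1, Or.inl rfl, fun t m k ht hm' e2 => sq_iso hq hdeg hHd hW ht hm' e' e2 (Or.inl rfl) x z ?_ h0⟩
        by_cases hx : x = 0
        · exact Or.inr (hxz hx)
        · exact Or.inl hx
    obtain ⟨t, u, w, n, ht, htp, hu, hn, e4⟩ := pre hq hqp hU hW hh e hρ hsq
    refine ⟨t, u, w, ρ * n ^ 2, ht, htp, hu, ?_, hρo hρ hn, e4⟩
    by_contra hw
    rw [Int.not_odd_iff_even] at hw
    have h2 := congrArg r2 e4
    rw [map_NN_even hw] at h2
    simp only [r2, Polynomial.map_mul, Polynomial.map_pow, map_C, r2_odd (hρo hρ hn)] at h2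
    refine r2_prim htp (L2 (r2_deg hq) (r2_deg ht) (r2_deg hu) ?_ (by rw [h2]; simp))
    rw [r2, coeff_map, r2_odd h1]
  have hWo := hodd.resolve_left h1
  have h1e := Int.not_odd_iff_even.1 h1
  by_cases han : ∀ x z : ℤ, hm 2 q x z = 0 → x = 0 ∧ z = 0
  · obtain ⟨ρ, hρ, hsq⟩ := sq_aniso hq hdeg hHd hW e' han
    obtain ⟨t, u, w, n, ht, htp, hu, hn, e4⟩ := pre hq hqp hU hW hh e hρ hsq
    exact ⟨t, u, w, ρ * n ^ 2, ht, htp, hu, aniso_odd hq hqp han hU hh hWo e ht htp hu (hρo hρ hn) e4, hρo hρ hn, e4⟩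
  · push Not at han
    obtain ⟨x, z, h0, hxz⟩ := han
    have hxz' : x ≠ 0 ∨ z ≠ 0 := by
      by_cases hx : x = 0
      · exact Or.inr (hxz hx)
      · exact Or.inl hx
    obtain ⟨ρ, hρ, hbad⟩ : ∃ ρ : ℤ, (ρ = 1 ∨ ρ = -1) ∧ ¬ (4 ∣ ρ * q.coeff 0 - q.coeff 0 ^ 2 ∧ 4 ∣ ρ * q.coeff 1 - 2 * (q.coeff 0 * q.coeff 2) ∧
        4 ∣ ρ * q.coeff 2 - q.coeff 2 ^ 2) := by
      by_contra hcon
      push Not at hcon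
      have a1 := hcon 1 (Or.inl rfl)
      have a2 := hcon (-1) (Or.inr rfl)
      apply prim_odd hq hqp
      have b0 := dvd_sub a1.1 a2.1
      have b2 := dvd_sub a1.2.2 a2.2.2
      refine ⟨?_, h1e, ?_⟩
      · rw [even_iff_two_dvd]; omega
      · rw [even_iff_two_dvd]; omega
    obtain ⟨t, u, w, n, ht, htp, hu, hn, e4⟩ := pre hq hqp hU hW hh e hρ
      (fun t m k ht hm' e2 => sq_iso hq hdeg hHd hW ht hm' e' e2 hρ x z hxz' h0)
    refine ⟨t, u, w, ρ * n ^ 2, ht, htp, hu, ?_, hρo hρ hn, e4⟩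
    by_contra hw
    rw [Int.not_odd_iff_even] at hw
    have h5 := iso_even hq h1e ht htp (hρo hρ hn) hw e4
    apply hbad
    obtain ⟨s, hs⟩ : ∃ s, n ^ 2 = 4 * s + 1 := by
      obtain ⟨s, rfl⟩ := hn; exact ⟨s ^ 2 + s, by ring⟩
    rw [hs] at h5
    have conv : ∀ y z : ℤ, 4 ∣ ρ * (4 * s + 1) * y - z → 4 ∣ ρ * y - z := by
      intro y z hyz
      have : ρ * y - z = (ρ * (4 * s + 1) * y - z) - 4 * (ρ * s * y) := by ring
      rw [this]; exact dvd_sub hyz (dvd_mul_right _ _)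
    exact ⟨conv _ _ h5.1, conv _ _ h5.2.1, conv _ _ h5.2.2⟩

theorem good_t {q t u : ℤ[X]} {w c : ℤ} (hq : q.natDegree ≤ 2) (ht : t.natDegree ≤ 2) (htp : t.IsPrimitive) (hu : u.natDegree ≤ 3) (hw : Odd w)
    (e : NN u w = C c * q * t ^ 2) : Good t := by
  refine ⟨ht, htp, u, w, C c * q * t, hu, ?_, ?_, by rw [e]; ring, Or.inr hw⟩
  · rintro rfl; simp at hw
  · refine natDegree_mul_le.trans ?_
    have := natDegree_C_mul_le c q
    omega


set_option synthInstance.maxHeartbeats 400000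
set_option synthInstance.maxSize 1000
theorem dT0 : ∀ u0 u1 u2 u3 q0 q1 q2 : ZMod 2, (u0 ^ 2 + u0 = q0 * 1 ∧ u1 = q1 * 1 ∧ u0 + u2 + u1 ^ 2 + 1 = q2 * 1 + q0 * 0 ∧ u0 + u1 + u3 = q1 * 0 ∧ u1 + u2 + u2 ^ 2 + 1 = q2 * 0 + q0 * 0 ∧ u2 + u3 = q1 * 0 ∧ u3 + u3 ^ 2 = q2 * 0) →
    (u0 = 0 ∧ u1 = 1 ∧ u2 = 1 ∧ u3 = 1) ∨ (u0 = 1 ∧ u1 = 1 ∧ u2 = 0 ∧ u3 = 0) := by decide +kernel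
theorem dT1 : ∀ u0 u1 u2 u3 q0 q1 q2 : ZMod 2, (u0 ^ 2 + u0 = q0 * 0 ∧ u1 = q1 * 0 ∧ u0 + u2 + u1 ^ 2 + 1 = q2 * 0 + q0 * 1 ∧ u0 + u1 + u3 = q1 * 1 ∧ u1 + u2 + u2 ^ 2 + 1 = q2 * 1 + q0 * 0 ∧ u2 + u3 = q1 * 0 ∧ u3 + u3 ^ 2 = q2 * 0) →
    (u0 = 0 ∧ u1 = 0 ∧ u2 = 0 ∧ u3 = 0) ∨ (u0 = 0 ∧ u1 = 0 ∧ u2 = 1 ∧ u3 = 1) ∨ (u0 = 1 ∧ u1 = 0 ∧ u2 = 0 ∧ u3 = 0) ∨ (u0 = 1 ∧ u1 = 0 ∧ u2 = 1 ∧ u3 = 1) := by decide +kernel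
theorem dT2 : ∀ u0 u1 u2 u3 q0 q1 q2 : ZMod 2, (u0 ^ 2 + u0 = q0 * 1 ∧ u1 = q1 * 1 ∧ u0 + u2 + u1 ^ 2 + 1 = q2 * 1 + q0 * 1 ∧ u0 + u1 + u3 = q1 * 1 ∧ u1 + u2 + u2 ^ 2 + 1 = q2 * 1 + q0 * 0 ∧ u2 + u3 = q1 * 0 ∧ u3 + u3 ^ 2 = q2 * 0) →
    (u0 = 0 ∧ u1 = 0 ∧ u2 = 0 ∧ u3 = 0) ∨ (u0 = 0 ∧ u1 = 1 ∧ u2 = 0 ∧ u3 = 0) ∨ (u0 = 1 ∧ u1 = 0 ∧ u2 = 1 ∧ u3 = 1) ∨ (u0 = 1 ∧ u1 = 1 ∧ u2 = 1 ∧ u3 = 1) := by decide +kernel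
theorem dT3 : ∀ u0 u1 u2 u3 q0 q1 q2 : ZMod 2, (u0 ^ 2 + u0 = q0 * 0 ∧ u1 = q1 * 0 ∧ u0 + u2 + u1 ^ 2 + 1 = q2 * 0 + q0 * 0 ∧ u0 + u1 + u3 = q1 * 0 ∧ u1 + u2 + u2 ^ 2 + 1 = q2 * 0 + q0 * 1 ∧ u2 + u3 = q1 * 1 ∧ u3 + u3 ^ 2 = q2 * 1) →
    (u0 = 0 ∧ u1 = 0 ∧ u2 = 1 ∧ u3 = 0) ∨ (u0 = 1 ∧ u1 = 0 ∧ u2 = 0 ∧ u3 = 1) := by decide +kernel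
theorem dT4 : ∀ u0 u1 u2 u3 q0 q1 q2 : ZMod 2, (u0 ^ 2 + u0 = q0 * 1 ∧ u1 = q1 * 1 ∧ u0 + u2 + u1 ^ 2 + 1 = q2 * 1 + q0 * 0 ∧ u0 + u1 + u3 = q1 * 0 ∧ u1 + u2 + u2 ^ 2 + 1 = q2 * 0 + q0 * 1 ∧ u2 + u3 = q1 * 1 ∧ u3 + u3 ^ 2 = q2 * 1) →
    (u0 = 0 ∧ u1 = 1 ∧ u2 = 0 ∧ u3 = 1) ∨ (u0 = 1 ∧ u1 = 1 ∧ u2 = 1 ∧ u3 = 0) := by decide +kernel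
theorem dT5 : ∀ u0 u1 u2 u3 q0 q1 q2 : ZMod 2, (u0 ^ 2 + u0 = q0 * 0 ∧ u1 = q1 * 0 ∧ u0 + u2 + u1 ^ 2 + 1 = q2 * 0 + q0 * 1 ∧ u0 + u1 + u3 = q1 * 1 ∧ u1 + u2 + u2 ^ 2 + 1 = q2 * 1 + q0 * 1 ∧ u2 + u3 = q1 * 1 ∧ u3 + u3 ^ 2 = q2 * 1) →
    (u0 = 0 ∧ u1 = 0 ∧ u2 = 0 ∧ u3 = 0) ∨ (u0 = 0 ∧ u1 = 0 ∧ u2 = 0 ∧ u3 = 1) ∨ (u0 = 1 ∧ u1 = 0 ∧ u2 = 1 ∧ u3 = 0) ∨ (u0 = 1 ∧ u1 = 0 ∧ u2 = 1 ∧ u3 = 1) := by decide +kernel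
theorem dT6 : ∀ u0 u1 u2 u3 q0 q1 q2 : ZMod 2, ¬ (u0 ^ 2 + u0 = q0 * 1 ∧ u1 = q1 * 1 ∧ u0 + u2 + u1 ^ 2 + 1 = q2 * 1 + q0 * 1 ∧ u0 + u1 + u3 = q1 * 1 ∧ u1 + u2 + u2 ^ 2 + 1 = q2 * 1 + q0 * 1 ∧ u2 + u3 = q1 * 1 ∧ u3 + u3 ^ 2 = q2 * 1) := by decide +kernel

def IsT (τ : ℤ[X]) : Prop := τ = 1 ∨ τ = X ∨ τ = X + 1 ∨ τ = X ^ 2 ∨ τ = (X + 1) ^ 2 ∨ τ = X * (X + 1)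

theorem IsT.deg {τ : ℤ[X]} (h : IsT τ) : τ.natDegree ≤ 2 := by
  rcases h with rfl | rfl | rfl | rfl | rfl | rfl
  · simp
  · simp
  · compute_degree <;> norm_num
  · simp
  · compute_degree
  · compute_degree

theorem eqs_of {u q t : (ZMod 2)[X]} (hu : u.natDegree ≤ 3) (hq : q.natDegree ≤ 2) (s0 s1 s2 : ZMod 2)
    (ht : t = C s0 + C s1 * X + C s2 * X ^ 2) (h : u ^ 2 + G2 * u + B2 ^ 2 = q * t ^ 2) :
    u.coeff 0 ^ 2 + u.coeff 0 = q.coeff 0 * s0 ∧ u.coeff 1 = q.coeff 1 * s0 ∧ u.coeff 0 + u.coeff 2 + u.coeff 1 ^ 2 + 1 = q.coeff 2 * s0 + q.coeff 0 * s1 ∧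
     u.coeff 0 + u.coeff 1 + u.coeff 3 = q.coeff 1 * s1 ∧ u.coeff 1 + u.coeff 2 + u.coeff 2 ^ 2 + 1 = q.coeff 2 * s1 + q.coeff 0 * s2 ∧
     u.coeff 2 + u.coeff 3 = q.coeff 1 * s2 ∧ u.coeff 3 + u.coeff 3 ^ 2 = q.coeff 2 * s2 := by
  have sq : ∀ s : ZMod 2, s ^ 2 = s := by decide +kernel
  have e0 := congrArg (C : ZMod 2 → (ZMod 2)[X]) (sq s0)
  have e1 := congrArg (C : ZMod 2 → (ZMod 2)[X]) (sq s1)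
  have e2 := congrArg (C : ZMod 2 → (ZMod 2)[X]) (sq s2)
  rw [ht] at h
  have hu' := deg3_form hu
  have hq' := deg2_formR hq
  generalize u.coeff 0 = a, u.coeff 1 = b, u.coeff 2 = c, u.coeff 3 = d at *
  generalize q.coeff 0 = q0, q.coeff 1 = q1, q.coeff 2 = q2 at *
  rw [hu', hq', G2, B2] at h
  apply P6_inj
  simp only [map_add, map_pow, map_one, map_mul] at e0 e1 e2 ⊢
  linear_combination h - (X ^ 3 + C a * C b * X + C a * C c * X ^ 2 + C a * C d * X ^ 3 + C b * C c * X ^ 3 + C b * C d * X ^ 4 + C c * C d * X ^ 5) * z2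
    + (C q0 + C q1 * X + C q2 * X ^ 2) * (C s0 * C s1 * X + C s0 * C s2 * X ^ 2 + C s1 * C s2 * X ^ 3) * z2
    + (C q0 + C q1 * X + C q2 * X ^ 2) * (e0 + e1 * X ^ 2 + e2 * X ^ 4)

theorem r2_eq_of {u v : ℤ[X]} (hu : u.natDegree ≤ 3) (v0 v1 v2 v3 : ℤ) (hv : v = C v0 + C v1 * X + C v2 * X ^ 2 + C v3 * X ^ 3)
    {w0 w1 w2 w3 : ZMod 2} (h0 : (r2 u).coeff 0 = w0) (h1 : (r2 u).coeff 1 = w1) (h2 : (r2 u).coeff 2 = w2) (h3 : (r2 u).coeff 3 = w3)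
    (hw : w0 = v0 ∧ w1 = v1 ∧ w2 = v2 ∧ w3 = v3) : r2 v = r2 u := by
  obtain ⟨rfl, rfl, rfl, rfl⟩ := hw
  rw [deg3_form (r2_deg hu), h0, h1, h2, h3, hv]
  simp [r2]

theorem TBL {u q τ : ℤ[X]} (hu : u.natDegree ≤ 3) (hq : q.natDegree ≤ 2) (hτ : IsT τ) (h : r2 u ^ 2 + G2 * r2 u + B2 ^ 2 = r2 q * r2 τ ^ 2) :
    ∃ (v : ℤ[X]) (k : ℤ) (p : ℤ[X]), v.natDegree ≤ 3 ∧ Odd k ∧ IsT p ∧ NN v 1 = C k * p * τ ^ 2 ∧ r2 v = r2 u := by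
  rcases hτ with rfl | rfl | rfl | rfl | rfl | rfl
  · have := dT0 _ _ _ _ _ _ _ (eqs_of (r2_deg hu) (r2_deg hq) 1 0 0 (by
      simp [r2]) h)
    rcases this with ⟨h0, h1, h2, h3⟩ | ⟨h0, h1, h2, h3⟩
    · refine ⟨C (0) + C (-1) * X + C (1) * X ^ 2 + C (1) * X ^ 3, -1, X * (X + 1), by compute_degree, by decide, Or.inr (Or.inr (Or.inr (Or.inr (Or.inr rfl)))), ?_, r2_eq_of hu _ _ _ _ rfl h0 h1 h2 h3 (by decide)⟩
      simp only [NN, GS, BS, map_neg, map_one, map_zero, map_ofNat, one_pow]; ring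
    · refine ⟨C (-1) + C (-1) * X + C (0) * X ^ 2 + C (0) * X ^ 3, -1, X * (X + 1), by compute_degree, by decide, Or.inr (Or.inr (Or.inr (Or.inr (Or.inr rfl)))), ?_, r2_eq_of hu _ _ _ _ rfl h0 h1 h2 h3 (by decide)⟩
      simp only [NN, GS, BS, map_neg, map_one, map_zero, map_ofNat, one_pow]; ring
  · have := dT1 _ _ _ _ _ _ _ (eqs_of (r2_deg hu) (r2_deg hq) 0 1 0 (by
      simp [r2]) h)
    rcases this with ⟨h0, h1, h2, h3⟩ | ⟨h0, h1, h2, h3⟩ | ⟨h0, h1, h2, h3⟩ | ⟨h0, h1, h2, h3⟩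
    · refine ⟨C (0) + C (0) * X + C (0) * X ^ 2 + C (0) * X ^ 3, -1, (X + 1) ^ 2, by compute_degree, by decide, Or.inr (Or.inr (Or.inr (Or.inr (Or.inl rfl)))), ?_, r2_eq_of hu _ _ _ _ rfl h0 h1 h2 h3 (by decide)⟩
      simp only [NN, GS, BS, map_neg, map_one, map_zero, map_ofNat, one_pow]; ring
    · refine ⟨C (0) + C (0) * X + C (1) * X ^ 2 + C (1) * X ^ 3, 1, X * (X + 1), by compute_degree, by decide, Or.inr (Or.inr (Or.inr (Or.inr (Or.inr rfl)))), ?_, r2_eq_of hu _ _ _ _ rfl h0 h1 h2 h3 (by decide)⟩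
      simp only [NN, GS, BS, map_neg, map_one, map_zero, map_ofNat, one_pow]; ring
    · refine ⟨C (-1) + C (-2) * X + C (0) * X ^ 2 + C (0) * X ^ 3, 1, X * (X + 1), by compute_degree, by decide, Or.inr (Or.inr (Or.inr (Or.inr (Or.inr rfl)))), ?_, r2_eq_of hu _ _ _ _ rfl h0 h1 h2 h3 (by decide)⟩
      simp only [NN, GS, BS, map_neg, map_one, map_zero, map_ofNat, one_pow]; ring
    · refine ⟨C (-1) + C (-2) * X + C (1) * X ^ 2 + C (1) * X ^ 3, -1, (X + 1) ^ 2, by compute_degree, by decide, Or.inr (Or.inr (Or.inr (Or.inr (Or.inl rfl)))), ?_, r2_eq_of hu _ _ _ _ rfl h0 h1 h2 h3 (by decide)⟩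
      simp only [NN, GS, BS, map_neg, map_one, map_zero, map_ofNat, one_pow]; ring
  · have := dT2 _ _ _ _ _ _ _ (eqs_of (r2_deg hu) (r2_deg hq) 1 1 0 (by
      simp [r2]; try ring) h)
    rcases this with ⟨h0, h1, h2, h3⟩ | ⟨h0, h1, h2, h3⟩ | ⟨h0, h1, h2, h3⟩ | ⟨h0, h1, h2, h3⟩
    · refine ⟨C (0) + C (0) * X + C (0) * X ^ 2 + C (0) * X ^ 3, -1, X ^ 2, by compute_degree, by decide, Or.inr (Or.inr (Or.inr (Or.inl rfl))), ?_, r2_eq_of hu _ _ _ _ rfl h0 h1 h2 h3 (by decide)⟩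
      simp only [NN, GS, BS, map_neg, map_one, map_zero, map_ofNat, one_pow]; ring
    · refine ⟨C (0) + C (-1) * X + C (0) * X ^ 2 + C (0) * X ^ 3, -1, X, by compute_degree, by decide, Or.inr (Or.inl rfl), ?_, r2_eq_of hu _ _ _ _ rfl h0 h1 h2 h3 (by decide)⟩
      simp only [NN, GS, BS, map_neg, map_one, map_zero, map_ofNat, one_pow]; ring
    · refine ⟨C (-1) + C (-2) * X + C (1) * X ^ 2 + C (1) * X ^ 3, -1, X ^ 2, by compute_degree, by decide, Or.inr (Or.inr (Or.inr (Or.inl rfl))), ?_, r2_eq_of hu _ _ _ _ rfl h0 h1 h2 h3 (by decide)⟩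
      simp only [NN, GS, BS, map_neg, map_one, map_zero, map_ofNat, one_pow]; ring
    · refine ⟨C (-1) + C (-1) * X + C (1) * X ^ 2 + C (1) * X ^ 3, -1, X, by compute_degree, by decide, Or.inr (Or.inl rfl), ?_, r2_eq_of hu _ _ _ _ rfl h0 h1 h2 h3 (by decide)⟩
      simp only [NN, GS, BS, map_neg, map_one, map_zero, map_ofNat, one_pow]; ring
  · have := dT3 _ _ _ _ _ _ _ (eqs_of (r2_deg hu) (r2_deg hq) 0 0 1 (by
      simp [r2]) h)
    rcases this with ⟨h0, h1, h2, h3⟩ | ⟨h0, h1, h2, h3⟩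
    · refine ⟨C (0) + C (0) * X + C (1) * X ^ 2 + C (0) * X ^ 3, -1, (X + 1), by compute_degree, by decide, Or.inr (Or.inr (Or.inl rfl)), ?_, r2_eq_of hu _ _ _ _ rfl h0 h1 h2 h3 (by decide)⟩
      simp only [NN, GS, BS, map_neg, map_one, map_zero, map_ofNat, one_pow]; ring
    · refine ⟨C (-1) + C (-2) * X + C (0) * X ^ 2 + C (1) * X ^ 3, -1, (X + 1), by compute_degree, by decide, Or.inr (Or.inr (Or.inl rfl)), ?_, r2_eq_of hu _ _ _ _ rfl h0 h1 h2 h3 (by decide)⟩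
      simp only [NN, GS, BS, map_neg, map_one, map_zero, map_ofNat, one_pow]; ring
  · have := dT4 _ _ _ _ _ _ _ (eqs_of (r2_deg hu) (r2_deg hq) 1 0 1 (by
      simp [r2]; try linear_combination X * z2) h)
    rcases this with ⟨h0, h1, h2, h3⟩ | ⟨h0, h1, h2, h3⟩
    · refine ⟨C (0) + C (1) * X + C (2) * X ^ 2 + C (1) * X ^ 3, 1, X, by compute_degree, by decide, Or.inr (Or.inl rfl), ?_, r2_eq_of hu _ _ _ _ rfl h0 h1 h2 h3 (by decide)⟩
      simp only [NN, GS, BS, map_neg, map_one, map_zero, map_ofNat, one_pow]; ring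
    · refine ⟨C (-1) + C (-3) * X + C (-1) * X ^ 2 + C (0) * X ^ 3, 1, X, by compute_degree, by decide, Or.inr (Or.inl rfl), ?_, r2_eq_of hu _ _ _ _ rfl h0 h1 h2 h3 (by decide)⟩
      simp only [NN, GS, BS, map_neg, map_one, map_zero, map_ofNat, one_pow]; ring
  · have := dT5 _ _ _ _ _ _ _ (eqs_of (r2_deg hu) (r2_deg hq) 0 1 1 (by
      simp [r2]; try ring) h)
    rcases this with ⟨h0, h1, h2, h3⟩ | ⟨h0, h1, h2, h3⟩ | ⟨h0, h1, h2, h3⟩ | ⟨h0, h1, h2, h3⟩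
    · refine ⟨C (0) + C (0) * X + C (0) * X ^ 2 + C (0) * X ^ 3, -1, 1, by compute_degree, by decide, Or.inl rfl, ?_, r2_eq_of hu _ _ _ _ rfl h0 h1 h2 h3 (by decide)⟩
      simp only [NN, GS, BS, map_neg, map_one, map_zero, map_ofNat, one_pow]; ring
    · refine ⟨C (0) + C (0) * X + C (2) * X ^ 2 + C (1) * X ^ 3, 1, (X + 1), by compute_degree, by decide, Or.inr (Or.inr (Or.inl rfl)), ?_, r2_eq_of hu _ _ _ _ rfl h0 h1 h2 h3 (by decide)⟩
      simp only [NN, GS, BS, map_neg, map_one, map_zero, map_ofNat, one_pow]; ring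
    · refine ⟨C (-1) + C (-2) * X + C (-1) * X ^ 2 + C (0) * X ^ 3, 1, (X + 1), by compute_degree, by decide, Or.inr (Or.inr (Or.inl rfl)), ?_, r2_eq_of hu _ _ _ _ rfl h0 h1 h2 h3 (by decide)⟩
      simp only [NN, GS, BS, map_neg, map_one, map_zero, map_ofNat, one_pow]; ring
    · refine ⟨C (-1) + C (-2) * X + C (1) * X ^ 2 + C (1) * X ^ 3, -1, 1, by compute_degree, by decide, Or.inl rfl, ?_, r2_eq_of hu _ _ _ _ rfl h0 h1 h2 h3 (by decide)⟩
      simp only [NN, GS, BS, map_neg, map_one, map_zero, map_ofNat, one_pow]; ring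


theorem IsT.r2_ne {τ : ℤ[X]} (h : IsT τ) : r2 τ ≠ 0 := by
  rcases h with rfl | rfl | rfl | rfl | rfl | rfl
  · simp [r2]
  · simp [r2]
  · have := (monic_X_add_C (1 : ZMod 2)).ne_zero
    simpa [r2] using this
  · simp [r2]
  · have := (monic_X_add_C (1 : ZMod 2)).ne_zero
    simpa [r2] using this
  · have := (monic_X_add_C (1 : ZMod 2)).ne_zero
    simpa [r2] using this

theorem lift2 {n : ℕ} {μ δ v τ R : ℤ[X]} {w : ℤ} (hw : Odd w) (hδ : δ.natDegree ≤ 2) (hτ : r2 τ ≠ 0) (hτd : τ.natDegree ≤ 2)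
    (h : μ * (C w * (2 * v - GS) + μ) = δ * τ ^ 2 + C (2 ^ n) * R) (h0 : C 2 ∣ μ) :
    ∀ j ≤ n, C (2 ^ j) ∣ μ ∧ C (2 ^ j) ∣ δ := by
  intro j
  induction j with
  | zero => intro _; simp
  | succ j ih =>
    intro hj
    obtain ⟨⟨μ', hμ⟩, ⟨δ', hδ'⟩⟩ := ih (by omega)
    have h2 : (C (2 ^ j) : ℤ[X]) ≠ 0 := by simp
    have hδd : δ'.natDegree ≤ 2 := by
      rw [hδ', deg_of_C_mul (by positivity)] at hδ; exact hδ
    obtain ⟨m, hm⟩ : ∃ m, n = j + 1 + m := ⟨n - (j + 1), by omega⟩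
    have e1 : μ' * (C w * (2 * v - GS) + μ) = δ' * τ ^ 2 + C 2 * (C (2 ^ m) * R) := by
      apply mul_left_cancel₀ h2
      have : (C (2 ^ n) : ℤ[X]) = C (2 ^ j) * (C 2 * C (2 ^ m)) := by
        rw [← C_mul, ← C_mul, hm]; ring_nf
      rw [this] at h
      nth_rewrite 1 [hμ] at h
      rw [hδ'] at h
      linear_combination h
    have e2 := congrArg r2 e1
    have hμ0 : r2 μ = 0 := r2_zero_iff.2 h0
    have hC : r2 (C 2 * (C (2 ^ m) * R)) = 0 := r2_zero_iff.2 ⟨_, rfl⟩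
    have e3 : r2 μ' * G2 = r2 δ' * r2 τ ^ 2 := by
      have t1 : r2 (μ' * (C w * (2 * v - GS) + μ)) = r2 μ' * (C ((Int.castRingHom (ZMod 2)) w) * (2 * r2 v - G2) + r2 μ) := by
        rw [← r2_GS]; simp [r2]
      have t2 : r2 (δ' * τ ^ 2 + C 2 * (C (2 ^ m) * R)) = r2 δ' * r2 τ ^ 2 + r2 (C 2 * (C (2 ^ m) * R)) := by
        simp only [r2, Polynomial.map_add, Polynomial.map_mul, Polynomial.map_pow]
      rw [t1, t2, hμ0, hC, r2_odd hw, C_1] at e2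
      linear_combination e2 + (r2 μ' * G2 - r2 μ' * r2 v) * z2
    have d0 : r2 δ' = 0 := by
      have : G2 ∣ r2 δ' * r2 τ ^ 2 := ⟨r2 μ', by rw [← e3]; ring⟩
      rcases G2_prime.dvd_or_dvd this with h | h
      · exact G2_ndvd (r2_deg hδd) h
      · exact absurd (G2_ndvd (r2_deg hτd) (G2_prime.dvd_of_dvd_pow h)) hτ
    have m0 : r2 μ' = 0 := by
      rw [d0, zero_mul] at e3
      exact (mul_eq_zero.1 e3).resolve_right G2_prime.ne_zero
    obtain ⟨a, ha⟩ := r2_zero_iff.1 d0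
    obtain ⟨b, hb⟩ := r2_zero_iff.1 m0
    have hp : (C (2 ^ (j + 1)) : ℤ[X]) = C (2 ^ j) * C 2 := by rw [← C_mul]; ring_nf
    exact ⟨⟨b, by rw [hμ, hb, hp]; ring⟩, ⟨a, by rw [hδ', ha, hp]; ring⟩⟩

def EE (e : ℕ) (q : ℤ[X]) : Prop := ∃ τ, IsT τ ∧ ∃ α β : ℤ, Odd α ∧ Odd β ∧ C (2 ^ e) ∣ C α * q - C β * τ

theorem EE_step {e : ℕ} (he : 1 ≤ e) {q t u : ℤ[X]} {w c : ℤ} (hq : q.natDegree ≤ 2) (hu : u.natDegree ≤ 3) (hw : Odd w) (hc : Odd c)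
    (h : NN u w = C c * q * t ^ 2) (ht : EE e t) : EE (e + 1) q := by
  obtain ⟨τ, hτ, α, β, hα, hβ, s, hs⟩ := ht
  obtain ⟨e', rfl⟩ : ∃ e', e = e' + 1 := ⟨e - 1, by omega⟩
  set R : ℤ[X] := C c * q * (C β * τ * s + C (2 ^ e') * s ^ 2) with hR
  have h1 : NN (C α * u) (α * w) = C (c * β ^ 2) * q * τ ^ 2 + C (2 ^ (e' + 2)) * R := by
    have : NN (C α * u) (α * w) = C α ^ 2 * NN u w := by
      simp only [NN, map_mul, map_pow]; ring
    rw [this, h, show C α ^ 2 * (C c * q * t ^ 2) = C c * q * (C α * t) ^ 2 by ring, show C α * t = C β * τ + C (2 ^ (e' + 1)) * s by linear_combination hs, hR]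
    simp only [map_mul, map_pow, pow_succ]; simp only [map_ofNat]; ring
  have hu' : (C α * u).natDegree ≤ 3 := (natDegree_C_mul_le _ _).trans hu
  have hw' : Odd (α * w) := hα.mul hw
  have hc' : Odd (c * β ^ 2) := hc.mul hβ.pow
  generalize C α * u = u1 at *
  generalize α * w = w1 at *
  generalize c * β ^ 2 = c1 at *
  have h2 : r2 u1 ^ 2 + G2 * r2 u1 + B2 ^ 2 = r2 q * r2 τ ^ 2 := by
    rw [← map_NN_odd hw', h1]
    have : r2 (C (2 ^ (e' + 2)) * R) = 0 := r2_zero_iff.2 ⟨C (2 ^ (e' + 1)) * R, by rw [← mul_assoc (C 2), ← C_mul]; ring_nf⟩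
    have h3 : r2 (C c1 * q * τ ^ 2 + C (2 ^ (e' + 2)) * R) = C ((Int.castRingHom (ZMod 2)) c1) * r2 q * r2 τ ^ 2 + r2 (C (2 ^ (e' + 2)) * R) := by
      simp only [r2, Polynomial.map_add, Polynomial.map_mul, Polynomial.map_pow, map_C]
    rw [h3, this, r2_odd hc']; simp
  obtain ⟨v, k, p, hv, hk, hp, hN, hr⟩ := TBL hu' hq hτ h2
  have hpd := hp.deg
  have key := lift2 (n := e' + 2) (μ := u1 - C w1 * v) (δ := C c1 * q - C (w1 ^ 2 * k) * p) (v := v) (τ := τ) (R := R) (w := w1) hw' ?_ hτ.r2_ne hτ.deg ?_ ?_ (e' + 2) le_rfl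
  · exact ⟨p, hp, c1, w1 ^ 2 * k, hc', hw'.pow.mul hk, key.2⟩
  · refine (natDegree_sub_le _ _).trans (max_le ?_ ?_)
    · exact (natDegree_C_mul_le _ _).trans hq
    · exact (natDegree_C_mul_le _ _).trans hpd
  · simp only [NN, map_one, one_pow] at h1 hN
    simp only [map_mul, map_pow] at h1 hN ⊢
    linear_combination h1 - C w1 ^ 2 * hN
  · rw [← r2_zero_iff]
    have : r2 (u1 - C w1 * v) = r2 u1 - C ((Int.castRingHom (ZMod 2)) w1) * r2 v := by simp [r2]
    rw [this, hr, r2_odd hw']; simp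

theorem z01 : ∀ s : ZMod 2, s = 0 ∨ s = 1 := by decide

theorem EE_base {q t u : ℤ[X]} {w c : ℤ} (hq : q.natDegree ≤ 2) (ht : t.natDegree ≤ 2) (htp : t.IsPrimitive) (hu : u.natDegree ≤ 3) (hw : Odd w) (hc : Odd c)
    (h : NN u w = C c * q * t ^ 2) : EE 1 t := by
  have h2 : r2 u ^ 2 + G2 * r2 u + B2 ^ 2 = r2 q * r2 t ^ 2 := by
    rw [← map_NN_odd hw, h]
    have h3 : r2 (C c * q * t ^ 2) = C ((Int.castRingHom (ZMod 2)) c) * r2 q * r2 t ^ 2 := by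
      simp only [r2, Polynomial.map_mul, Polynomial.map_pow, map_C]
    rw [h3, r2_odd hc]; simp
  have hf := deg2_formR (r2_deg ht)
  have h0 := r2_prim htp
  suffices ∃ τ, IsT τ ∧ r2 t = r2 τ by
    obtain ⟨τ, hτ, he⟩ := this
    refine ⟨τ, hτ, 1, 1, odd_one, odd_one, ?_⟩
    rw [pow_one, ← r2_zero_iff]
    have : r2 (C 1 * t - C 1 * τ) = r2 t - r2 τ := by simp [r2]
    rw [this, he, sub_self]
  have key := eqs_of (r2_deg hu) (r2_deg hq) _ _ _ hf h2
  rcases z01 ((r2 t).coeff 0) with a | a <;> rcases z01 ((r2 t).coeff 1) with b | b <;> rcases z01 ((r2 t).coeff 2) with d | d <;> rw [a, b, d] at hf key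
  · simp at hf; exact absurd hf h0
  · exact ⟨X ^ 2, by simp [IsT], by rw [hf]; simp [r2]⟩
  · exact ⟨X, by simp [IsT], by rw [hf]; simp [r2]⟩
  · exact ⟨X * (X + 1), by simp [IsT], by rw [hf]; simp [r2]; ring⟩
  · exact ⟨1, by simp [IsT], by rw [hf]; simp [r2]⟩
  · exact ⟨(X + 1) ^ 2, by simp [IsT], by rw [hf]; simp [r2]; linear_combination -X * z2⟩
  · exact ⟨X + 1, by simp [IsT], by rw [hf]; simp [r2]; ring⟩
  · exact absurd key (dT6 _ _ _ _ _ _ _)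

theorem EE_all (n : ℕ) : ∀ q, Good q → EE (n + 2) q := by
  induction n with
  | zero =>
    intro q hg
    obtain ⟨t, u, w, c, ht, htp, hu, hw, hc, h⟩ := partC hg
    exact EE_step le_rfl hg.1 hu hw hc h (EE_base hg.1 ht htp hu hw hc h)
  | succ n ih =>
    intro q hg
    obtain ⟨t, u, w, c, ht, htp, hu, hw, hc, h⟩ := partC hg
    exact EE_step (by omega) hg.1 hu hw hc h (ih t (good_t hg.1 ht htp hu hw h))

theorem IsT.co {τ : ℤ[X]} (h : IsT τ) : (∀ i, |τ.coeff i| ≤ 2) ∧ ∃ i, τ.coeff i = 1 := by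
  suffices h : ∃ a b c : ℤ, τ = C a + C b * X + C c * X ^ 2 ∧ |a| ≤ 2 ∧ |b| ≤ 2 ∧ |c| ≤ 2 ∧ (a = 1 ∨ b = 1 ∨ c = 1) by
    obtain ⟨a, b, c, rfl, ha, hb, hc, h1⟩ := h
    have c0 : (C a + C b * X + C c * X ^ 2 : ℤ[X]).coeff 0 = a := by simp
    have c1 : (C a + C b * X + C c * X ^ 2 : ℤ[X]).coeff 1 = b := by simp [-eq_intCast, coeff_X, coeff_C]
    have c2 : (C a + C b * X + C c * X ^ 2 : ℤ[X]).coeff 2 = c := by simp [-eq_intCast, coeff_X, coeff_C]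
    constructor
    · intro i
      rcases i with _ | _ | _ | i
      · rwa [c0]
      · rwa [c1]
      · rwa [c2]
      · have : (C a + C b * X + C c * X ^ 2 : ℤ[X]).natDegree ≤ 2 := by compute_degree
        rw [coeff_eq_zero_of_natDegree_lt (by omega)]; simp
    · rcases h1 with h1 | h1 | h1
      · exact ⟨0, by rw [c0, h1]⟩
      · exact ⟨1, by rw [c1, h1]⟩
      · exact ⟨2, by rw [c2, h1]⟩
  rcases h with rfl | rfl | rfl | rfl | rfl | rfl
  · exact ⟨1, 0, 0, by simp, by decide⟩
  · exact ⟨0, 1, 0, by simp, by decide⟩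
  · exact ⟨1, 1, 0, by simp [add_comm], by decide⟩
  · exact ⟨0, 0, 1, by simp, by decide⟩
  · exact ⟨1, 2, 1, by simp only [map_one, map_ofNat]; ring, by decide⟩
  · exact ⟨0, 1, 1, by simp only [map_one, map_zero]; ring, by decide⟩

theorem partD {q : ℤ[X]} (hg : Good q) : ∃ τ, IsT τ ∧ (q = τ ∨ q = -τ) := by
  obtain ⟨n, hn⟩ : ∃ n : ℕ, ∀ i, 4 * |q.coeff i| < 2 ^ (n + 2) := by
    refine ⟨(q.coeff 0).natAbs + (q.coeff 1).natAbs + (q.coeff 2).natAbs, fun i => ?_⟩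
    set N := (q.coeff 0).natAbs + (q.coeff 1).natAbs + (q.coeff 2).natAbs with hN
    have h1 : |q.coeff i| ≤ N := by
      rcases i with _ | _ | _ | i
      · rw [Int.abs_eq_natAbs]; omega
      · rw [Int.abs_eq_natAbs]; simp only [zero_add, Nat.reduceAdd]; omega
      · rw [Int.abs_eq_natAbs]; simp only [zero_add, Nat.reduceAdd]; omega
      · rw [coeff_eq_zero_of_natDegree_lt (by have := hg.1; omega)]; simp
    have h2 : (N : ℤ) < 2 ^ N := by exact_mod_cast Nat.lt_two_pow_self
    rw [pow_add]; linarith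
  obtain ⟨τ, hτ, α, β, hα, hβ, s, hs⟩ := EE_all n q hg
  obtain ⟨hb, i, hi⟩ := hτ.co
  have hc : ∀ j, α * q.coeff j - β * τ.coeff j = 2 ^ (n + 2) * s.coeff j := by
    intro j
    have := congrArg (fun P => coeff P j) hs
    simpa only [coeff_sub, coeff_C_mul] using this
  have hcr : ∀ j, q.coeff j = q.coeff i * τ.coeff j := by
    intro j
    have h1 := hc j
    have h2 := hc i
    rw [hi] at h2
    have h3 : α * (q.coeff j - q.coeff i * τ.coeff j) = 2 ^ (n + 2) * (s.coeff j - τ.coeff j * s.coeff i) := by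
      linear_combination h1 - τ.coeff j * h2
    have h4 : (2 : ℤ) ^ (n + 2) ∣ q.coeff j - q.coeff i * τ.coeff j := by
      refine IsCoprime.dvd_of_dvd_mul_left (x := 2 ^ (n + 2)) (z := q.coeff j - q.coeff i * τ.coeff j) (y := α) ?_ ⟨_, h3⟩
      refine IsCoprime.pow_left ?_
      exact Int.isCoprime_two_left.2 hα
    have h5 := Int.eq_zero_of_abs_lt_dvd h4 (by
      have e1 := hn j
      have e2 := hn i
      have e3 := abs_sub (q.coeff j) (q.coeff i * τ.coeff j)
      rw [abs_mul] at e3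
      have e4 := mul_le_mul_of_nonneg_left (hb j) (abs_nonneg (q.coeff i))
      have e5 : (0 : ℤ) < 2 ^ (n + 2) := by positivity
      linarith)
    linarith
  have hq : q = C (q.coeff i) * τ := by
    ext j; rw [coeff_C_mul]; exact hcr j
  have hu := hg.2.1 (q.coeff i) ⟨_, hq⟩
  refine ⟨τ, hτ, ?_⟩
  rcases Int.isUnit_iff.1 hu with h | h <;> rw [h] at hq
  · left; rw [hq]; simp
  · right; rw [hq]; simp


theorem NN_UW (M : ℤ[X]) (d : ℤ) : NN (M + C d * GS) (2 * d) = M ^ 2 - C (d ^ 2) * fS := by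
  rw [fS_GB, NN]; simp only [map_mul, map_pow, map_ofNat]; ring

theorem UW_deg {M : ℤ[X]} (hM : M.natDegree ≤ 3) (d : ℤ) : (M + C d * GS).natDegree ≤ 3 :=
  (natDegree_add_le _ _).trans (max_le hM ((natDegree_C_mul_le _ _).trans GS_deg))

theorem IsT.root {F : Type*} [Field F] {τ : ℤ[X]} (h : IsT τ) {x : F} (hx : aeval x τ = 0) : x = 0 ∨ x = -1 := by
  have key : ∀ y : F, y + 1 = 0 → y = -1 := fun y hy => by linear_combination hy
  rcases h with rfl | rfl | rfl | rfl | rfl | rfl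
  · simp at hx
  · left; simpa using hx
  · right; exact key _ (by simpa using hx)
  · left; simpa using hx
  · right; exact key _ (by simpa using hx)
  · simp at hx
    rcases hx with h | h
    · exact Or.inl h
    · exact Or.inr (key _ h)

theorem good_root {F : Type*} [Field F] {q : ℤ[X]} (h : Good q) {x : F} (hx : aeval x q = 0) : x = 0 ∨ x = -1 := by
  obtain ⟨τ, hτ, rfl | rfl⟩ := partD h
  · exact hτ.root hx
  · exact hτ.root (by simpa using hx)

theorem prim_of_coprime {q : ℤ[X]} {a b : ℤ} (hab : IsCoprime a b) (i j : ℕ) (hi : a = q.coeff i ∨ a = - q.coeff i) (hj : b = q.coeff j ∨ b = -q.coeff j) : q.IsPrimitive := by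
  intro r hr
  rw [C_dvd_iff_dvd_coeff] at hr
  refine hab.isUnit_of_dvd' ?_ ?_
  · rcases hi with h | h <;> rw [h] <;> simp [hr i]
  · rcases hj with h | h <;> rw [h] <;> simp [hr j]

theorem rat_int (a b Y : ℤ) (hb : b ≠ 0) (hab : IsCoprime a b)
    (hY : Y ^ 2 = a ^ 6 + 2 * a ^ 5 * b + a ^ 4 * b ^ 2 + 2 * a ^ 3 * b ^ 3 + 6 * a ^ 2 * b ^ 4 + 4 * a * b ^ 5 + b ^ 6) (ha : a ≠ 0) :
    ∃ q, Good q ∧ aeval ((a : ℚ) / b) q = 0 := by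
  have hb' : (b : ℚ) ≠ 0 := by exact_mod_cast hb
  have hYC := congrArg (C : ℤ → ℤ[X]) hY
  simp only [map_add, map_mul, map_pow, map_ofNat] at hYC
  by_cases hbo : Odd b
  · refine ⟨C b * X - C a, ⟨by compute_degree; norm_num, ?_, C (b ^ 3) * X ^ 3 + C (Y - a ^ 3) + C (b ^ 3) * GS, 2 * b ^ 3,
      -(((C b * X) ^ 2 + (C b * X) * C a + C a ^ 2) * C (2 * a ^ 3 - 2 * Y)
        + 2 * C b * ((C b * X) ^ 4 + (C b * X) ^ 3 * C a + (C b * X) ^ 2 * C a ^ 2 + (C b * X) * C a ^ 3 + C a ^ 4)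
        + C b ^ 2 * ((C b * X) ^ 3 + (C b * X) ^ 2 * C a + (C b * X) * C a ^ 2 + C a ^ 3)
        + 2 * C b ^ 3 * ((C b * X) ^ 2 + (C b * X) * C a + C a ^ 2) + 6 * C b ^ 4 * (C b * X + C a) + 4 * C b ^ 5), UW_deg (by compute_degree) _, by positivity, ?_, ?_, Or.inl ?_⟩, ?_⟩
    · exact prim_of_coprime hab 0 1 (Or.inr (by simp)) (Or.inl (by simp [-eq_intCast, coeff_C]))
    · compute_degree
    · rw [NN_UW, fS]
      simp only [map_add, map_sub, map_mul, map_pow, map_ofNat]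
      linear_combination hYC
    · simpa [-eq_intCast, coeff_C] using hbo
    · simp; field_simp; simp
  · have hao : Odd a := by
      rw [← Int.not_even_iff_odd]
      rw [Int.not_odd_iff_even] at hbo
      intro hae
      have := hab.isUnit_of_dvd' hae.two_dvd hbo.two_dvd
      rw [Int.isUnit_iff] at this; omega
    refine ⟨(C b * X - C a) * X, ⟨by compute_degree, ?_, C (a * b ^ 3) + C (b * Y - b ^ 4) * X + C (a * b ^ 3) * GS, 2 * (a * b ^ 3),
      -(C b * (C a ^ 2 * (((C b * X) ^ 4 + (C b * X) ^ 3 * C a + (C b * X) ^ 2 * C a ^ 2 + (C b * X) * C a ^ 3 + C a ^ 4)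
        + 2 * C b * ((C b * X) ^ 3 + (C b * X) ^ 2 * C a + (C b * X) * C a ^ 2 + C a ^ 3)
        + C b ^ 2 * ((C b * X) ^ 2 + (C b * X) * C a + C a ^ 2) + 2 * C b ^ 3 * (C b * X + C a) + 6 * C b ^ 4) - C ((Y - b ^ 3) ^ 2))), UW_deg (by compute_degree; norm_num) _, by positivity, ?_, ?_, Or.inl ?_⟩, ?_⟩
    · exact prim_of_coprime hab 1 2 (Or.inr (by simp)) (Or.inl (by simp [-eq_intCast, coeff_C]))
    · compute_degree
    · rw [NN_UW, fS]
      simp only [map_add, map_sub, map_mul, map_pow, map_ofNat]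
      linear_combination X * C b * C a * hYC
    · simpa [-eq_intCast, coeff_C] using hao
    · simp; left; field_simp; simp

theorem E1 {x y : ℚ} (h : y ^ 2 = x ^ 6 + 2 * x ^ 5 + x ^ 4 + 2 * x ^ 3 + 6 * x ^ 2 + 4 * x + 1) : x = 0 ∨ x = -1 := by
  by_cases hx : x = 0
  · exact Or.inl hx
  have hd : (x.den : ℚ) ≠ 0 := by exact_mod_cast x.den_nz
  have hxe : x = x.num / x.den := (Rat.num_div_den x).symm
  obtain ⟨Y, hY⟩ : ∃ Y : ℤ, x.num ^ 6 + 2 * x.num ^ 5 * x.den + x.num ^ 4 * x.den ^ 2 + 2 * x.num ^ 3 * x.den ^ 3 + 6 * x.num ^ 2 * x.den ^ 4 + 4 * x.num * x.den ^ 5 + x.den ^ 6 = Y ^ 2 := by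
    apply int_sq_of_rat (r := y * x.den ^ 3)
    have : (((x.num ^ 6 + 2 * x.num ^ 5 * x.den + x.num ^ 4 * x.den ^ 2 + 2 * x.num ^ 3 * x.den ^ 3 + 6 * x.num ^ 2 * x.den ^ 4 + 4 * x.num * x.den ^ 5 + x.den ^ 6 : ℤ)) : ℚ) = (y * x.den ^ 3) ^ 2 := by
      rw [mul_pow, h]
      generalize x.den = D at *
      generalize x.num = N at *
      subst hxe
      push_cast
      field_simp
    exact_mod_cast this
  obtain ⟨q, hq, h0⟩ := rat_int x.num x.den Y (by exact_mod_cast x.den_nz) (Rat.isCoprime_num_den x) hY.symm (Rat.num_ne_zero.2 hx)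
  have := good_root hq h0
  rw [← show x = (x.num : ℚ) / ((x.den : ℤ) : ℚ) by simpa using hxe] at this
  exact this


theorem exists_q0 {α : ℂ} (hα : ∀ r : ℚ, α ≠ r) {r s : ℚ} (h : α ^ 2 = r * α + s) :
    ∃ q : ℤ[X], q.natDegree = 2 ∧ q.IsPrimitive ∧ aeval α q = 0 ∧ ∀ P : ℤ[X], aeval α P = 0 → q ∣ P := by
  set n : ℤ := r.den * s.den with hn
  have hr : (r.den : ℂ) ≠ 0 := by exact_mod_cast r.den_nz
  have hs : (s.den : ℂ) ≠ 0 := by exact_mod_cast s.den_nz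
  have hn0 : n ≠ 0 := by simp [hn]
  set p : ℤ[X] := C n * X ^ 2 - C (r.num * s.den) * X - C (s.num * r.den) with hp
  have hpd : p.natDegree ≤ 2 := by rw [hp]; compute_degree
  have hp2 : p.coeff 2 = n := by rw [hp]; simp [-eq_intCast, coeff_X, coeff_C]
  have hp0 : p ≠ 0 := by rintro h0; rw [h0] at hp2; simp at hp2; exact hn0 hp2.symm
  have hre : (r : ℂ) = r.num / r.den := by exact_mod_cast (Rat.num_div_den r).symm
  have hse : (s : ℂ) = s.num / s.den := by exact_mod_cast (Rat.num_div_den s).symm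
  have hpα : aeval α p = 0 := by
    rw [hre, hse] at h
    simp only [hp, hn, map_sub, map_mul, map_pow, aeval_X, aeval_C]
    simp
    rw [h]; field_simp; ring
  have hcp := p.eq_C_content_mul_primPart
  have hc0 : p.content ≠ 0 := by rwa [Ne, content_eq_zero_iff]
  have hqα : aeval α p.primPart = 0 := by
    have := hpα
    rw [hcp, map_mul] at this
    simpa [hc0] using this
  refine ⟨p.primPart, by rw [natDegree_primPart]; exact le_antisymm hpd (le_natDegree_of_ne_zero (by rwa [hp2])), p.isPrimitive_primPart, hqα, fun P hP => ?_⟩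
  rw [p.isPrimitive_primPart.dvd_iff_fraction_map_dvd_fraction_map ℚ]
  set Q := p.primPart.map (algebraMap ℤ ℚ) with hQ
  have hq0 : p.primPart ≠ 0 := p.primPart_ne_zero
  have hQ0 : Q ≠ 0 := by rwa [hQ, Ne, Polynomial.map_eq_zero_iff (algebraMap ℤ ℚ).injective_int]
  have hQα : aeval α Q = 0 := by rw [hQ, aeval_map_algebraMap, hqα]
  have hint : IsIntegral ℚ α := by
    rw [← isAlgebraic_iff_isIntegral]; exact ⟨Q, hQ0, hQα⟩
  have h2 : 2 ≤ (minpoly ℚ α).natDegree := by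
    rw [minpoly.two_le_natDegree_iff hint]
    rintro ⟨r, hr⟩
    exact hα r (by rw [← hr]; simp)
  obtain ⟨D, hD⟩ := minpoly.dvd ℚ α hQα
  have hD0 : D ≠ 0 := by rintro rfl; simp at hD; exact hQ0 hD
  have hQd : Q.natDegree ≤ 2 := natDegree_map_le.trans (by rwa [natDegree_primPart])
  have hDd : D.natDegree = 0 := by
    rw [hD, natDegree_mul (minpoly.ne_zero hint) hD0] at hQd; omega
  have hDu : IsUnit D := by
    rw [eq_C_of_natDegree_eq_zero hDd] at hD0 ⊢
    rw [isUnit_C]; exact isUnit_iff_ne_zero.2 (by simpa using hD0)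
  rw [hD, hDu.mul_right_dvd]
  exact minpoly.dvd ℚ α (by rw [aeval_map_algebraMap, hP])

theorem coef_eqs {l0 l1 w c a0 a1 a2 s0 s1 s2 : ℤ}
    (h : BS * ((C l0 + C l1 * X) ^ 2 - C w ^ 2) - C w * GS * (C l0 + C l1 * X) = C c * (C a0 + C a1 * X + C a2 * X ^ 2) * (C s0 + C s1 * X + C s2 * X ^ 2)) :
    w * l0 = c * (a0 * s0) ∧ l0 ^ 2 - w ^ 2 + 2 * w * l0 + w * l1 = c * (a0 * s1 + a1 * s0) ∧
    l0 ^ 2 + 2 * l0 * l1 - w ^ 2 - w * l0 + 2 * w * l1 = c * (a0 * s2 + a1 * s1 + a2 * s0) ∧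
    2 * l0 * l1 + l1 ^ 2 - w * (l0 + l1) = c * (a1 * s2 + a2 * s1) ∧ l1 ^ 2 - w * l1 = c * (a2 * s2) := by
  have := P6_inj (a0 := w * l0) (a1 := l0 ^ 2 - w ^ 2 + 2 * w * l0 + w * l1) (a2 := l0 ^ 2 + 2 * l0 * l1 - w ^ 2 - w * l0 + 2 * w * l1)
    (a3 := 2 * l0 * l1 + l1 ^ 2 - w * (l0 + l1)) (a4 := l1 ^ 2 - w * l1) (a5 := 0) (a6 := 0)
    (b0 := c * (a0 * s0)) (b1 := c * (a0 * s1 + a1 * s0)) (b2 := c * (a0 * s2 + a1 * s1 + a2 * s0)) (b3 := c * (a1 * s2 + a2 * s1)) (b4 := c * (a2 * s2)) (b5 := 0) (b6 := 0) (by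
      rw [BS, GS] at h
      simp only [map_add, map_sub, map_mul, map_pow, map_ofNat, map_zero]
      linear_combination h)
  tauto

theorem IsT.form {τ : ℤ[X]} (h : IsT τ) : ∃ a b c : ℤ, τ = C a + C b * X + C c * X ^ 2 ∧
    ((a = 1 ∧ b = 0 ∧ c = 0) ∨ (a = 0 ∧ b = 1 ∧ c = 0) ∨ (a = 1 ∧ b = 1 ∧ c = 0) ∨ (a = 0 ∧ b = 0 ∧ c = 1) ∨ (a = 1 ∧ b = 2 ∧ c = 1) ∨ (a = 0 ∧ b = 1 ∧ c = 1)) := by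
  rcases h with rfl | rfl | rfl | rfl | rfl | rfl
  · exact ⟨1, 0, 0, by simp, by decide⟩
  · exact ⟨0, 1, 0, by simp, by decide⟩
  · exact ⟨1, 1, 0, by simp [add_comm], by decide⟩
  · exact ⟨0, 0, 1, by simp, by decide⟩
  · exact ⟨1, 2, 1, by simp only [map_one, map_ofNat]; ring, by decide⟩
  · exact ⟨0, 1, 1, by simp only [map_one, map_zero]; ring, by decide⟩

theorem six {l0 l1 w c a0 a1 a2 s0 s1 s2 : ℤ} (hw : w ≠ 0)
    (hs : (s0 = 1 ∧ s1 = 0 ∧ s2 = 0) ∨ (s0 = 0 ∧ s1 = 1 ∧ s2 = 0) ∨ (s0 = 1 ∧ s1 = 1 ∧ s2 = 0) ∨ (s0 = 0 ∧ s1 = 0 ∧ s2 = 1) ∨ (s0 = 1 ∧ s1 = 2 ∧ s2 = 1) ∨ (s0 = 0 ∧ s1 = 1 ∧ s2 = 1))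
    (e0 : w * l0 = c * (a0 * s0)) (e1 : l0 ^ 2 - w ^ 2 + 2 * w * l0 + w * l1 = c * (a0 * s1 + a1 * s0))
    (e2 : l0 ^ 2 + 2 * l0 * l1 - w ^ 2 - w * l0 + 2 * w * l1 = c * (a0 * s2 + a1 * s1 + a2 * s0))
    (e3 : 2 * l0 * l1 + l1 ^ 2 - w * (l0 + l1) = c * (a1 * s2 + a2 * s1)) (e4 : l1 ^ 2 - w * l1 = c * (a2 * s2)) :
    (l0 = 0 ∧ l1 = 0) ∨ (l0 = 0 ∧ l1 = w) ∨ (l0 = w ∧ l1 = w) := by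
  have k0 : ∀ z, w * z = 0 → z = 0 := fun z hz => (mul_eq_zero.1 hz).resolve_left hw
  have k1 : l1 ^ 2 - w * l1 = 0 → l1 = 0 ∨ l1 = w := by
    intro h
    have : l1 * (l1 - w) = 0 := by linear_combination h
    rcases mul_eq_zero.1 this with h | h
    · exact Or.inl h
    · exact Or.inr (by linarith)
  rcases hs with ⟨rfl, rfl, rfl⟩ | ⟨rfl, rfl, rfl⟩ | ⟨rfl, rfl, rfl⟩ | ⟨rfl, rfl, rfl⟩ | ⟨rfl, rfl, rfl⟩ | ⟨rfl, rfl, rfl⟩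
  · rcases k1 (by linear_combination e4) with rfl | rfl
    · exact Or.inl ⟨k0 _ (by linear_combination -e3), rfl⟩
    · exact Or.inr (Or.inl ⟨k0 _ (by linear_combination e3), rfl⟩)
  · have := k0 l0 (by linear_combination e0)
    rcases k1 (by linear_combination e4) with h | h <;> tauto
  · have := k0 (l0 - l1) (by linear_combination -e0 + e1 - e2 + e3 - e4)
    have h0 : l0 = l1 := by linarith
    subst h0
    rcases k1 (by linear_combination e4) with h | h <;> tauto
  · have h0 := k0 l0 (by linear_combination e0)
    subst h0
    have := k0 (l1 - w) (by linear_combination e1)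
    exact Or.inr (Or.inl ⟨rfl, by linarith⟩)
  · have := k0 (l0 - l1) (by linear_combination -e0 + e1 - e2 + e3 - e4)
    have h0 : l0 = l1 := by linarith
    subst h0
    have := k0 (w - l0) (by linear_combination e1 - 2 * e2 + 3 * e3 - 4 * e4)
    exact Or.inr (Or.inr ⟨by linarith, by linarith⟩)
  · have h0 := k0 l0 (by linear_combination e0)
    have := k0 (l0 - l1) (by linear_combination -e0 + e1 - e2 + e3 - e4)
    exact Or.inl ⟨h0, by linarith⟩


/-- clearing denominators of a pair, coprime -/
theorem clear_den (m n : ℚ) : ∃ a b d : ℤ, d ≠ 0 ∧ (m : ℂ) * d = a ∧ (n : ℂ) * d = b ∧ ∀ r : ℤ, r ∣ a → r ∣ b → r ∣ d → IsUnit r := by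
  have hm : (m.den : ℂ) ≠ 0 := by exact_mod_cast m.den_nz
  have hn : (n.den : ℂ) ≠ 0 := by exact_mod_cast n.den_nz
  have hme : (m : ℂ) = m.num / m.den := by exact_mod_cast (Rat.num_div_den m).symm
  have hne : (n : ℂ) = n.num / n.den := by exact_mod_cast (Rat.num_div_den n).symm
  set A : ℤ := m.num * n.den with hA
  set B : ℤ := n.num * m.den with hB
  set D : ℤ := m.den * n.den with hD
  have hD0 : D ≠ 0 := by simp [hD]
  have hAe : (m : ℂ) * D = A := by rw [hme, hD, hA]; push_cast; field_simp
  have hBe : (n : ℂ) * D = B := by rw [hne, hD, hB]; push_cast; field_simp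
  set g : ℤ := gcd A (gcd B D) with hg
  have hg0 : g ≠ 0 := by simp [hg, gcd_eq_zero_iff, hD0]
  obtain ⟨a, ha⟩ : g ∣ A := gcd_dvd_left _ _
  obtain ⟨b, hb⟩ : g ∣ B := (gcd_dvd_right _ _).trans (gcd_dvd_left _ _)
  obtain ⟨d, hd⟩ : g ∣ D := (gcd_dvd_right _ _).trans (gcd_dvd_right _ _)
  have hg0' : (g : ℂ) ≠ 0 := by exact_mod_cast hg0
  refine ⟨a, b, d, ?_, ?_, ?_, ?_⟩
  · rintro rfl; simp [hD0] at hd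
  · apply mul_left_cancel₀ hg0'
    have h1 : (D : ℂ) = g * d := by exact_mod_cast hd
    have h2 : (A : ℂ) = g * a := by exact_mod_cast ha
    rw [h1, h2] at hAe; linear_combination hAe
  · apply mul_left_cancel₀ hg0'
    have h1 : (D : ℂ) = g * d := by exact_mod_cast hd
    have h2 : (B : ℂ) = g * b := by exact_mod_cast hb
    rw [h1, h2] at hBe; linear_combination hBe
  · intro r h1 h2 h3
    have : g * r ∣ g * 1 := by
      rw [mul_one]
      nth_rewrite 2 [hg]
      refine dvd_gcd ?_ (dvd_gcd ?_ ?_)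
      · rw [ha]; exact mul_dvd_mul_left _ h1
      · rw [hb]; exact mul_dvd_mul_left _ h2
      · rw [hd]; exact mul_dvd_mul_left _ h3
    exact isUnit_of_dvd_one ((mul_dvd_mul_iff_left hg0).1 this)

theorem E2 {α y : ℂ} {K : IntermediateField ℚ ℂ} (hα : ∀ r : ℚ, α ≠ r) (hK : ∀ z ∈ K, ∃ m n : ℚ, z = m * α + n) (hαK : α ∈ K) (hyK : y ∈ K)
    (h : y ^ 2 = α ^ 6 + 2 * α ^ 5 + α ^ 4 + 2 * α ^ 3 + 6 * α ^ 2 + 4 * α + 1) : False := by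
  have hα0 : α ≠ 0 := by simpa using hα 0
  have hα1 : α + 1 ≠ 0 := by
    intro h; exact hα (-1) (by push_cast; linear_combination h)
  obtain ⟨r, s, hrs⟩ := hK (α ^ 2) (pow_mem hαK 2)
  obtain ⟨q, hqd2, hqp, hqα, hqdvd⟩ := exists_q0 hα hrs
  have hqd := hqd2.le
  have hq0 : q ≠ 0 := hqp.ne_zero
  have hfS : aeval α fS = y ^ 2 := by rw [h]; simp [fS, map_ofNat]
  have hGS : aeval α GS = α ^ 3 + α ^ 2 - 2 * α - 1 := by simp [GS, map_ofNat]
  have hBS : aeval α BS = α ^ 2 + α := by simp [BS]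
  have notgood : ¬ Good q := by
    intro hg
    rcases good_root hg hqα with h | h
    · exact hα0 h
    · exact hα1 (by rw [h]; ring)
  have hdeg : ∀ P S : ℤ[X], P = q * S → ∀ n, P.natDegree ≤ n + 2 → S.natDegree ≤ n := by
    rintro P S rfl n hn
    by_cases hS0 : S = 0
    · simp [hS0]
    rw [natDegree_mul hq0 hS0] at hn; omega
  have heven : Even (q.coeff 1) := by
    rw [← Int.not_odd_iff_even]
    intro hodd
    apply notgood
    obtain ⟨m1, m0, hm⟩ := hK y hyK
    obtain ⟨M1, M0, d, hd, e1, e0, -⟩ := clear_den m1 m0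
    obtain ⟨H, hH⟩ := hqdvd ((C M1 * X + C M0) ^ 2 - C (d ^ 2) * fS) (by
      simp only [map_sub, map_add, map_mul, map_pow, aeval_X, aeval_C, hfS]
      simp only [algebraMap_int_eq, eq_intCast]
      rw [← e1, ← e0, hm]; ring)
    refine ⟨hqd, hqp, C M1 * X + C M0 + C d * GS, 2 * d, H, UW_deg (by compute_degree; norm_num) _, by simpa using hd, ?_, by rw [NN_UW, hH], Or.inl hodd⟩
    refine hdeg _ _ hH 4 ?_
    rw [fS]
    compute_degree
  obtain ⟨n1, n0, hn⟩ := hK ((α ^ 3 + α ^ 2 - 2 * α - 1 + y) / (2 * (α ^ 2 + α))) (by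
    have k1 : (α ^ 3 + α ^ 2 - 2 * α - 1 + y) ∈ K := by
      have t2 : (2 : ℂ) ∈ K := by exact_mod_cast K.natCast_mem 2
      exact add_mem (sub_mem (sub_mem (add_mem (pow_mem hαK 3) (pow_mem hαK 2)) (mul_mem t2 hαK)) (one_mem K)) hyK
    have k2 : (2 * (α ^ 2 + α)) ∈ K := by
      have t2 : (2 : ℂ) ∈ K := by exact_mod_cast K.natCast_mem 2
      exact mul_mem t2 (add_mem (pow_mem hαK 2) hαK)
    exact div_mem k1 k2)
  obtain ⟨l1, l0, w, hw, e1, e0, hpr⟩ := clear_den n1 n0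
  have hB0 : α ^ 2 + α ≠ 0 := by
    rw [show α ^ 2 + α = α * (α + 1) by ring]; exact mul_ne_zero hα0 hα1
  have hn' : y = 2 * (α ^ 2 + α) * (n1 * α + n0) - (α ^ 3 + α ^ 2 - 2 * α - 1) := by
    rw [← hn]; field_simp; ring
  have hP0 : (α ^ 2 + α) * ((l0 + l1 * α) ^ 2 - w ^ 2) - w * (α ^ 3 + α ^ 2 - 2 * α - 1) * (l0 + l1 * α) = 0 := by
    rw [← e1, ← e0]
    rw [hn'] at h
    have : 4 * (α ^ 2 + α) ≠ 0 := by simpa using hB0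
    refine mul_left_cancel₀ this ?_
    linear_combination (w : ℂ) ^ 2 * h
  obtain ⟨S, hS⟩ := hqdvd (BS * ((C l0 + C l1 * X) ^ 2 - C w ^ 2) - C w * GS * (C l0 + C l1 * X)) (by
    simp only [map_sub, map_add, map_mul, map_pow, aeval_X, aeval_C, hGS, hBS]
    simp only [algebraMap_int_eq, eq_intCast]
    exact hP0)
  have hSd : S.natDegree ≤ 2 := by
    refine hdeg _ _ hS 2 ?_
    rw [BS, GS]; compute_degree
  have fin : ¬ ((l0 = 0 ∧ l1 = 0) ∨ (l0 = 0 ∧ l1 = w) ∨ (l0 = w ∧ l1 = w)) := by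
    have hw' : (w : ℂ) ≠ 0 := by exact_mod_cast hw
    rintro (⟨rfl, rfl⟩ | ⟨rfl, rfl⟩ | ⟨rfl, rfl⟩)
    · have : (w : ℂ) ^ 2 * (α ^ 2 + α) = 0 := by push_cast at hP0; linear_combination -hP0
      simp [hw', hB0] at this
    · have : (l1 : ℂ) ^ 2 * α ^ 2 = 0 := by push_cast at hP0; linear_combination hP0
      simp [hw', hα0] at this
    · have : (l1 : ℂ) ^ 2 * (α + 1) ^ 3 = 0 := by push_cast at hP0; linear_combination hP0
      simp [hw', hα1] at this
  have hSc := S.eq_C_content_mul_primPart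
  set c := S.content with hc
  set t := S.primPart with ht
  have htd : t.natDegree ≤ 2 := by rwa [ht, natDegree_primPart]
  have hqf := deg2_form hqd
  have main : ∀ c' s0 s1 s2 : ℤ, C c * t = C c' * (C s0 + C s1 * X + C s2 * X ^ 2) →
      w * l0 = c' * (q.coeff 0 * s0) ∧ l0 ^ 2 - w ^ 2 + 2 * w * l0 + w * l1 = c' * (q.coeff 0 * s1 + q.coeff 1 * s0) ∧
      l0 ^ 2 + 2 * l0 * l1 - w ^ 2 - w * l0 + 2 * w * l1 = c' * (q.coeff 0 * s2 + q.coeff 1 * s1 + q.coeff 2 * s0) ∧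
      2 * l0 * l1 + l1 ^ 2 - w * (l0 + l1) = c' * (q.coeff 1 * s2 + q.coeff 2 * s1) ∧ l1 ^ 2 - w * l1 = c' * (q.coeff 2 * s2) := by
    intro c' s0 s1 s2 hh
    apply coef_eqs
    rw [hS, ← hqf, hSc, hh]; ring
  have hgood : Good t := by
    refine ⟨htd, S.isPrimitive_primPart, BS * (C l0 + C l1 * X), w, C c * q * BS, ?_, hw, ?_, ?_, ?_⟩
    · rw [BS]; compute_degree
    · have h1 : BS.natDegree ≤ 2 := by rw [BS]; compute_degree
      have h2 := natDegree_C_mul_le c q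
      refine natDegree_mul_le.trans ?_
      omega
    · rw [NN]
      linear_combination BS * hS + BS * q * hSc - (BS ^ 2) * (C_pow (a := w) (n := 2))
    · by_contra hcon
      push Not at hcon
      obtain ⟨h1, h2⟩ := hcon
      rw [Int.not_odd_iff_even] at h1 h2
      obtain ⟨-, k1, -, k3, -⟩ := main c _ _ _ (by rw [← deg2_form htd])
      have l0e : Even l0 := by
        have : Even (l0 ^ 2) := by
          rw [show l0 ^ 2 = c * (q.coeff 0 * t.coeff 1 + q.coeff 1 * t.coeff 0) + w * (w - 2 * l0 - l1) by linear_combination k1]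
          exact (((h1.mul_left _).add (heven.mul_right _)).mul_left _).add (h2.mul_right _)
        exact (Int.even_pow.1 this).1
      have l1e : Even l1 := by
        have : Even (l1 ^ 2) := by
          rw [show l1 ^ 2 = c * (q.coeff 1 * t.coeff 2 + q.coeff 2 * t.coeff 1) + w * (l0 + l1) - l0 * (2 * l1) by linear_combination k3]
          exact ((((heven.mul_right _).add (h1.mul_left _)).mul_left _).add (h2.mul_right _)).sub (l0e.mul_right _)
        exact (Int.even_pow.1 this).1
      have := hpr 2 l1e.two_dvd l0e.two_dvd h2.two_dvd
      rw [Int.isUnit_iff] at this; omega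
  obtain ⟨τ, hτ, hpm⟩ := partD hgood
  obtain ⟨s0, s1, s2, rfl, hs⟩ := hτ.form
  apply fin
  rcases hpm with e | e
  · obtain ⟨k0, k1, k2, k3, k4⟩ := main c s0 s1 s2 (by rw [e])
    exact six hw hs k0 k1 k2 k3 k4
  · obtain ⟨k0, k1, k2, k3, k4⟩ := main (-c) s0 s1 s2 (by rw [e, map_neg]; ring)
    exact six hw hs k0 k1 k2 k3 k4

open IntermediateField

theorem dyn {F : Type*} [Field F] [CharZero F] {a b c q r : F} (hq : q = a^2+c) (hr : r = q^2+c) (ha : r^2+c = a)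
    (h1 : q ≠ a) (h2 : r ≠ a) (hb : (b^2+c)^2+c = b) (hb1 : b^2+c ≠ b) :
    a + q ≠ 0 ∧ a + q ≠ -1 ∧ 4*(a+q)^2*((a+q)+1)^2*c = -((a+q)^6+2*(a+q)^5+4*(a+q)^4+8*(a+q)^3+9*(a+q)^2+4*(a+q)+1) ∧
    ((2*b+1)*(a+q)*(a+q+1))^2 = (a+q)^6+2*(a+q)^5+(a+q)^4+2*(a+q)^3+6*(a+q)^2+4*(a+q)+1 := by
  have h3 : q ≠ r := by
    intro h
    apply h2
    linear_combination ha + hr + (q + r) * h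
  generalize hx : a + q = x
  have e1 : x * (q + r) = -(1 + x) := by
    apply mul_left_cancel₀ (sub_ne_zero.2 h1)
    rw [← hx]
    grind
  have e2 : (r + a) * (1 + x) = -1 := by
    apply mul_left_cancel₀ (sub_ne_zero.2 h1)
    rw [← hx]
    grind
  have hx0 : x ≠ 0 := by
    rintro rfl
    simp at e1
  have hx1 : x ≠ -1 := by
    rintro rfl
    simp at e2
  have U : 2*a*(x*(x+1)) = x^3+2*x^2+x+1 := by
    linear_combination (-(x*(x+1)))* (-hx) - (x+1)*e1 + x * e2
  have V : 2*q*(x*(x+1)) = x^3-x-1 := by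
    linear_combination (x*(x+1))* hx + (x+1)*e1 - x * e2
  have C : 4*x^2*(x+1)^2*c = -(x^6+2*x^5+4*x^4+8*x^3+9*x^2+4*x+1) := by
    have : c = q - a^2 := by rw [hq]; ring
    rw [this]
    linear_combination 2*x*(x+1)*V - (2*a*(x*(x+1)) + (x^3+2*x^2+x+1))*U
  refine ⟨hx0, hx1, C, ?_⟩
  have B : b^2+b+1+c = 0 := by
    apply mul_left_cancel₀ (sub_ne_zero.2 hb1)
    linear_combination hb
  linear_combination 4*x^2*(x+1)^2*B - C

theorem quad_span {K : IntermediateField ℚ ℂ} (hK : Module.finrank ℚ K = 2) {α : ℂ} (hα : ∀ r : ℚ, α ≠ r) (hαK : α ∈ K) :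
    ∀ z ∈ K, ∃ m n : ℚ, z = m * α + n := by
  intro z hz
  have li : LinearIndependent ℚ ![(⟨α, hαK⟩ : K), 1] := by
    rw [LinearIndependent.pair_iff]
    intro s t h
    have h' : (s : ℂ) * α + t = 0 := by
      have := congrArg (fun w : K => (w : ℂ)) h
      simpa [Algebra.smul_def] using this
    have hs : s = 0 := by
      by_contra hs
      apply hα (-t / s)
      have : (s : ℂ) ≠ 0 := by exact_mod_cast hs
      push_cast
      field_simp
      linear_combination h'
    subst hs
    simpa using h'
  have hsp := li.span_eq_top_of_card_eq_finrank (by simp [hK])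
  have hm : (⟨z, hz⟩ : K) ∈ Submodule.span ℚ (Set.range ![(⟨α, hαK⟩ : K), 1]) := by rw [hsp]; trivial
  simp only [Matrix.range_cons, Matrix.range_empty, Set.union_empty, Set.singleton_union] at hm
  rw [Submodule.mem_span_pair] at hm
  obtain ⟨m, n, h⟩ := hm
  refine ⟨m, n, ?_⟩
  have := congrArg (fun w : K => (w : ℂ)) h
  simpa [Algebra.smul_def] using this.symm

theorem graph_10_3_2_classification (K : IntermediateField ℚ ℂ)
    (hK : Module.finrank ℚ K = 2) (c a b : K)
    (ha3 : (fun z : K => z ^ 2 + c)^[3] a = a)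
    (ha3' : ∀ k : ℕ, 1 ≤ k → k < 3 → (fun z : K => z ^ 2 + c)^[k] a ≠ a)
    (hb2 : (fun z : K => z ^ 2 + c)^[2] b = b)
    (hb2' : ∀ k : ℕ, 1 ≤ k → k < 2 → (fun z : K => z ^ 2 + c)^[k] b ≠ b) :
    ∃ x : ℚ, x ≠ 0 ∧ x ≠ -1 ∧
      c = ((-(x ^ 6 + 2 * x ^ 5 + 4 * x ^ 4 + 8 * x ^ 3 + 9 * x ^ 2 + 4 * x + 1) /
          (4 * x ^ 2 * (x + 1) ^ 2) : ℚ) : K) ∧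
      (∃ z : ℂ, z ^ 2 = ((x ^ 6 + 2 * x ^ 5 + x ^ 4 + 2 * x ^ 3 + 6 * x ^ 2 + 4 * x + 1 : ℚ) : ℂ) ∧
        K = ℚ⟮z⟯) ∧
      ∀ w : K, (w : ℂ).im = 0 := by
  obtain ⟨hx0, hx1, hc, hy⟩ := dyn (a := a) (b := b) (c := c) rfl rfl ha3 (ha3' 1 (by norm_num) (by norm_num))
    (ha3' 2 (by norm_num) (by norm_num)) hb2 (hb2' 1 (by norm_num) (by norm_num))
  generalize a + (a ^ 2 + c) = x at *
  generalize (2 * b + 1) * x * (x + 1) = y at *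
  have hyC : (y : ℂ)^2 = (x:ℂ)^6+2*(x:ℂ)^5+(x:ℂ)^4+2*(x:ℂ)^3+6*(x:ℂ)^2+4*(x:ℂ)+1 := by
    have := congrArg (fun w : K => (w : ℂ)) hy
    push_cast at this
    exact this
  by_cases hxr : ∀ r : ℚ, (x : ℂ) ≠ r
  · exact (E2 hxr (quad_span hK hxr x.2) x.2 y.2 hyC).elim
  push Not at hxr
  obtain ⟨u, hu⟩ := hxr
  have hxu : x = (u : K) := by
    apply Subtype.ext
    simpa using hu
  subst hxu
  have hu0 : u ≠ 0 := by rintro rfl; simp at hx0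
  have hu1 : u ≠ -1 := by rintro rfl; simp at hx1
  rw [hu] at hyC
  have hyr : ∀ r : ℚ, (y : ℂ) ≠ r := by
    intro r hr
    rw [hr] at hyC
    have : r^2 = u^6+2*u^5+u^4+2*u^3+6*u^2+4*u+1 := by exact_mod_cast hyC
    rcases E1 this with h | h
    · exact hu0 h
    · exact hu1 h
  have hsp := quad_span hK hyr y.2
  have hyim : (y : ℂ).im = 0 := by
    have hnn : (0:ℚ) ≤ u^6+2*u^5+u^4+2*u^3+6*u^2+4*u+1 := by
      nlinarith [sq_nonneg (u^3+u^2-1), sq_nonneg (u^3+u^2+1), sq_nonneg (u^2+u), sq_nonneg (2*u+1), sq_nonneg u, sq_nonneg (u^3+u^2+u+1), sq_nonneg (u^3+u^2)]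
    have h2 : (y : ℂ)^2 = (((u^6+2*u^5+u^4+2*u^3+6*u^2+4*u+1 : ℚ) : ℝ) : ℂ) := by rw [hyC]; push_cast; rfl
    have hnr : (0:ℝ) ≤ ((u^6+2*u^5+u^4+2*u^3+6*u^2+4*u+1 : ℚ) : ℝ) := by exact_mod_cast hnn
    have hre := congrArg Complex.re h2
    have him := congrArg Complex.im h2
    rw [Complex.ofReal_re] at hre
    rw [Complex.ofReal_im] at him
    rw [← hre] at hnr
    simp only [pow_two, Complex.mul_re, Complex.mul_im] at hnr him
    have : (y:ℂ).re * (y:ℂ).im = 0 := by linarith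
    rcases mul_eq_zero.1 this with h | h
    · rw [h] at hnr; nlinarith
    · exact h
  refine ⟨u, hu0, hu1, ?_, ⟨y, ?_, ?_⟩, ?_⟩
  · have h1 : (u : K) + 1 ≠ 0 := fun h => hx1 (by linear_combination h)
    push_cast
    rw [eq_div_iff (mul_ne_zero (mul_ne_zero (by norm_num) (pow_ne_zero 2 hx0)) (pow_ne_zero 2 h1))]
    linear_combination hc
  · rw [hyC]; push_cast; rfl
  · apply le_antisymm
    · intro z hz
      obtain ⟨m, n, rfl⟩ := hsp z hz
      have hy' := mem_adjoin_simple_self ℚ (y : ℂ)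
      exact add_mem (mul_mem (SubfieldClass.ratCast_mem _ m) hy') (SubfieldClass.ratCast_mem _ n)
    · rw [adjoin_simple_le_iff]; exact y.2
  · intro w
    obtain ⟨m, n, h⟩ := hsp w w.2
    rw [h]
    simp [hyim]
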